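/- Krivine-Stengle Positivstellensatz for trace polynomials, positive definite case: Let S ∪ {a} be a finite subset of Sym TT_n. Then a(X) is positive definite for every X ∈ K_S if and only if there exist t₁, t₂ ∈ T_S^tr such that a·t₁ = t₁·a = 1 + t₂ in TT_n. -/

import Mathlib

noncomputable section

open Matrix

/-- The polynomial ring ℝ[ξ] in the g·n² commuting variables ξ_{jıȷ}. -/
abbrev PolyRing (n g : ℕ) : Type := MvPolynomial (Fin g × Fin n × Fin n) ℝ

/-- n×n matrices over ℝ[ξ]. -/
abbrev MatP (n g : ℕ) : Type := Matrix (Fin n) (Fin n) (PolyRing n g)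

/-- The generic matrices Ξ_j = (ξ_{jıȷ})_{ıȷ}. -/
def genMat (n g : ℕ) (j : Fin g) : MatP n g :=
  Matrix.of fun a b => MvPolynomial.X (j, a, b)

/-- The set of generic matrices together with their transposes. -/
def genSet (n g : ℕ) : Set (MatP n g) :=
  Set.range (genMat n g) ∪ Set.range (fun j => (genMat n g j)ᵀ)

/-- The trace ring TT_n: the ℝ-subalgebra of M_n(ℝ[ξ]) generated by the Ξ_j, their
transposes, and the scalar matrices tr(w)·1 for all products w of the Ξ_j, Ξ_jᵀ. -/
def traceRing (n g : ℕ) : Subalgebra ℝ (MatP n g) :=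
  Algebra.adjoin ℝ
    (genSet n g ∪
      {m | ∃ w ∈ Submonoid.closure (genSet n g), m = (Matrix.trace w) • (1 : MatP n g)})

/-- The center C_n of the trace ring: the scalar matrices in TT_n. -/
def centerSet (n g : ℕ) : Set (MatP n g) :=
  {c | c ∈ traceRing n g ∧ ∃ p : PolyRing n g, c = p • (1 : MatP n g)}

/-- Evaluation of a matrix of polynomials at a g-tuple X of n×n real matrices. -/
def evalMat (n g : ℕ) (X : Fin g → Matrix (Fin n) (Fin n) ℝ) (h : MatP n g) :
    Matrix (Fin n) (Fin n) ℝ :=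
  h.map (MvPolynomial.eval fun v => X v.1 v.2.1 v.2.2)

/-- The semialgebraic set K_S determined by S. -/
def KSet (n g : ℕ) (S : Set (MatP n g)) : Set (Fin g → Matrix (Fin n) (Fin n) ℝ) :=
  {X | ∀ s ∈ S, (evalMat n g X s).PosSemidef}

/-- Cyclic quadratic module in Sym TT_n. -/
def IsCyclicQM (n g : ℕ) (Q : Set (MatP n g)) : Prop :=
  (∀ q ∈ Q, q ∈ traceRing n g ∧ qᵀ = q) ∧
  (1 : MatP n g) ∈ Q ∧
  (∀ a ∈ Q, ∀ b ∈ Q, a + b ∈ Q) ∧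
  (∀ h ∈ traceRing n g, ∀ q ∈ Q, h * q * hᵀ ∈ Q) ∧
  (∀ q ∈ Q, (Matrix.trace q) • (1 : MatP n g) ∈ Q)

/-- Cyclic preordering: a cyclic quadratic module whose intersection with the center
is closed under multiplication. -/
def IsCyclicPreordering (n g : ℕ) (T : Set (MatP n g)) : Prop :=
  IsCyclicQM n g T ∧
  ∀ a ∈ T ∩ centerSet n g, ∀ b ∈ T ∩ centerSet n g, a * b ∈ T

/-- The smallest cyclic preordering T_S^tr containing S. -/
def TtrS (n g : ℕ) (S : Set (MatP n g)) : Set (MatP n g) :=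
  {a | ∀ T : Set (MatP n g), IsCyclicPreordering n g T → S ⊆ T → a ∈ T}

universe u

/-- A subset of a commutative ring that is closed under sums and products, contains all squares
and does not contain `-1`. -/
structure IsPreorderCone {A : Type*} [CommRing A] (P : Set A) : Prop where
  add : ∀ a ∈ P, ∀ b ∈ P, a + b ∈ P
  mul : ∀ a ∈ P, ∀ b ∈ P, a * b ∈ P
  sq : ∀ a, a * a ∈ P
  neg_one : (-1 : A) ∉ P

/-- A positive cone of an ordering of a commutative ring with prime support. -/
structure IsPrimeCone {A : Type*} [CommRing A] (P : Set A) : Prop extends IsPreorderCone P where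
  total : ∀ a, a ∈ P ∨ -a ∈ P
  prime : ∀ a b, a * b ∈ P → -(a * b) ∈ P → (a ∈ P ∧ -a ∈ P) ∨ (b ∈ P ∧ -b ∈ P)

namespace IsPreorderCone

variable {A : Type*} [CommRing A] {P : Set A}

theorem zero (hP : IsPreorderCone P) : (0 : A) ∈ P := by simpa using hP.sq 0

theorem one (hP : IsPreorderCone P) : (1 : A) ∈ P := by simpa using hP.sq 1

theorem mem_of_maximal (hP : IsPreorderCone P)
    (hmax : ∀ P', IsPreorderCone P' → P ⊆ P' → P' = P) (a : A)
    (ha : ∀ p ∈ P, ∀ q ∈ P, p + a * q ≠ -1) : a ∈ P := by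
  have h : IsPreorderCone {x | ∃ p ∈ P, ∃ q ∈ P, x = p + a * q} := by
    refine ⟨?_, ?_, ?_, ?_⟩
    · rintro _ ⟨p, hp, q, hq, rfl⟩ _ ⟨p', hp', q', hq', rfl⟩
      exact ⟨p + p', hP.add _ hp _ hp', q + q', hP.add _ hq _ hq', by ring⟩
    · rintro _ ⟨p, hp, q, hq, rfl⟩ _ ⟨p', hp', q', hq', rfl⟩
      exact ⟨p * p' + a * a * (q * q'), hP.add _ (hP.mul _ hp _ hp') _
        (hP.mul _ (hP.sq a) _ (hP.mul _ hq _ hq')), p * q' + q * p',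
        hP.add _ (hP.mul _ hp _ hq') _ (hP.mul _ hq _ hp'), by ring⟩
    · exact fun x => ⟨x * x, hP.sq x, 0, hP.zero, by ring⟩
    · rintro ⟨p, hp, q, hq, h⟩
      exact ha p hp q hq h.symm
  rw [← hmax _ h fun p hp => ⟨p, hp, 0, hP.zero, by ring⟩]
  exact ⟨0, hP.zero, 1, hP.one, by ring⟩

theorem exists_maximal (hP : IsPreorderCone P) :
    ∃ M, P ⊆ M ∧ IsPreorderCone M ∧ ∀ P', IsPreorderCone P' → M ⊆ P' → P' = M := by
  obtain ⟨M, hPM, hM⟩ := zorn_subset_nonempty {P : Set A | IsPreorderCone P} (fun c hc hchain hne => by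
    refine ⟨⋃₀ c, ⟨?_, ?_, ?_, ?_⟩, fun s hs => Set.subset_sUnion_of_mem hs⟩
    · rintro a ⟨s, hs, has⟩ b ⟨t, ht, hbt⟩
      rcases hchain.total hs ht with h | h
      · exact ⟨t, ht, (hc ht).add _ (h has) _ hbt⟩
      · exact ⟨s, hs, (hc hs).add _ has _ (h hbt)⟩
    · rintro a ⟨s, hs, has⟩ b ⟨t, ht, hbt⟩
      rcases hchain.total hs ht with h | h
      · exact ⟨t, ht, (hc ht).mul _ (h has) _ hbt⟩
      · exact ⟨s, hs, (hc hs).mul _ has _ (h hbt)⟩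
    · obtain ⟨s, hs⟩ := hne
      exact fun a => ⟨s, hs, (hc hs).sq a⟩
    · rintro ⟨s, hs, h⟩
      exact (hc hs).neg_one h) P hP
  exact ⟨M, hPM, hM.prop, fun P' hP' h => (hM.eq_of_subset hP' h).symm⟩

/-- Every preordering extends to an ordering with prime support. -/
theorem exists_isPrimeCone (hP : IsPreorderCone P) : ∃ M, P ⊆ M ∧ IsPrimeCone M := by
  obtain ⟨M, hPM, hM, hmax⟩ := hP.exists_maximal
  have key := hM.mem_of_maximal hmax
  refine ⟨M, hPM, hM, fun a => ?_, fun a b hab hab' => ?_⟩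
  · by_contra! h
    have h1 := mt (key a) h.1
    have h2 := mt (key (-a)) h.2
    push Not at h1 h2
    obtain ⟨p, hp, q, hq, h1⟩ := h1
    obtain ⟨p', hp', q', hq', h2⟩ := h2
    refine hM.neg_one ?_
    have : (-1 : A) = p + p' + p * p' + a * a * (q * q') := by
      linear_combination -(1 + p) * h2 - a * q' * h1
    rw [this]
    exact hM.add _ (hM.add _ (hM.add _ hp _ hp') _ (hM.mul _ hp _ hp')) _
      (hM.mul _ (hM.sq a) _ (hM.mul _ hq _ hq'))
  · have main : ∀ a b : A, -(a * b) ∈ M → a ∈ M ∨ b ∈ M := by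
      intro a b h
      by_contra! hn
      have h1 := mt (key a) hn.1
      have h2 := mt (key b) hn.2
      push Not at h1 h2
      obtain ⟨p, hp, q, hq, h1⟩ := h1
      obtain ⟨p', hp', q', hq', h2⟩ := h2
      refine hM.neg_one ?_
      have : (-1 : A) = p + p' + p * p' + -(a * b) * (q * q') := by
        linear_combination -(1 + p) * h2 + b * q' * h1
      rw [this]
      exact hM.add _ (hM.add _ (hM.add _ hp _ hp') _ (hM.mul _ hp _ hp')) _
        (hM.mul _ h _ (hM.mul _ hq _ hq'))
    have h1 := main a b hab'
    have h2 := main (-a) b (by simpa using hab)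
    have h3 := main a (-b) (by simpa using hab)
    have h4 := main (-a) (-b) (by simpa using hab')
    tauto

end IsPreorderCone

theorem exists_linearOrder_of_cone {K : Type*} [Field K] (N : Set K)
    (hadd : ∀ a ∈ N, ∀ b ∈ N, a + b ∈ N) (hmul : ∀ a ∈ N, ∀ b ∈ N, a * b ∈ N)
    (htotal : ∀ a, a ∈ N ∨ -a ∈ N) (hanti : ∀ a, a ∈ N → -a ∈ N → a = 0) :
    ∃ _ : LinearOrder K, IsStrictOrderedRing K ∧ ∀ x : K, 0 ≤ x ↔ x ∈ N := by
  classical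
  let C : RingCone K :=
    { carrier := N
      add_mem' := fun {a b} ha hb => hadd a ha b hb
      mul_mem' := fun {a b} ha hb => hmul a ha b hb
      zero_mem' := by simpa using htotal 0
      one_mem' := by
        rcases htotal 1 with h | h
        · exact h
        · simpa using hmul _ h _ h
      eq_zero_of_mem_of_neg_mem' := fun {a} => hanti a }
  have : HasMemOrNegMem C := ⟨htotal⟩
  let L : LinearOrder K := .mkOfAddGroupCone C
  have hR : IsOrderedRing K := .mkOfCone C
  refine ⟨L, IsOrderedRing.toIsStrictOrderedRing K, fun x => ?_⟩
  change x - 0 ∈ N ↔ x ∈ N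
  simp

/-- An ordering with prime support gives a ring homomorphism to an ordered field. -/
theorem IsPrimeCone.exists_orderedField {A : Type u} [CommRing A] {P : Set A}
    (hP : IsPrimeCone P) :
    ∃ (K : Type u) (_ : Field K) (_ : LinearOrder K) (_ : IsStrictOrderedRing K) (φ : A →+* K),
      (∀ a, 0 ≤ φ a ↔ a ∈ P) ∧ ∀ x, ∃ a b, φ b ≠ 0 ∧ x * φ b = φ a := by
  have hsupp : ∀ a b, a ∈ P → -a ∈ P → b * a ∈ P ∧ -(b * a) ∈ P := by
    intro a b ha ha'
    rcases hP.total b with hb | hb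
    · exact ⟨hP.mul _ hb _ ha, by simpa using hP.mul _ hb _ ha'⟩
    · exact ⟨by simpa using hP.mul _ hb _ ha', by simpa using hP.mul _ hb _ ha⟩
  let I : Ideal A :=
    { carrier := {a | a ∈ P ∧ -a ∈ P}
      add_mem' := fun {a b} ha hb => ⟨hP.add _ ha.1 _ hb.1, by
        rw [neg_add]; exact hP.add _ ha.2 _ hb.2⟩
      zero_mem' := ⟨hP.zero, by simpa using hP.zero⟩
      smul_mem' := fun b a ha => hsupp a b ha.1 ha.2 }
  have hI : I.IsPrime := by
    refine ⟨fun h => ?_, fun {a b} hab => hP.prime a b hab.1 hab.2⟩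
    have : (1 : A) ∈ I := h ▸ Submodule.mem_top
    exact hP.neg_one this.2
  let K := FractionRing (A ⧸ I)
  let φ : A →+* K := (algebraMap (A ⧸ I) K).comp (Ideal.Quotient.mk I)
  have hφ0 : ∀ a, φ a = 0 ↔ a ∈ P ∧ -a ∈ P := by
    intro a
    change algebraMap (A ⧸ I) K (Ideal.Quotient.mk I a) = 0 ↔ a ∈ I
    rw [IsFractionRing.to_map_eq_zero_iff, Ideal.Quotient.eq_zero_iff_mem]
  have hφP : ∀ a b, φ a = φ b → b ∈ P → a ∈ P := by
    intro a b h hb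
    have : φ (a - b) = 0 := by simp [h]
    simpa using hP.add _ ((hφ0 _).1 this).1 _ hb
  have hφsurj : ∀ x : K, ∃ a b, φ b ≠ 0 ∧ x * φ b = φ a := by
    intro x
    obtain ⟨a, b, hb, rfl⟩ := IsFractionRing.div_surjective (A := A ⧸ I) x
    obtain ⟨a, rfl⟩ := Ideal.Quotient.mk_surjective a
    obtain ⟨b, rfl⟩ := Ideal.Quotient.mk_surjective b
    have : φ b ≠ 0 := by
      simpa [φ] using nonZeroDivisors.ne_zero hb
    exact ⟨a, b, this, div_mul_cancel₀ _ this⟩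
  have hcancel : ∀ a b, φ b ≠ 0 → a * (b * b) ∈ P → a ∈ P := by
    intro a b hb h
    rcases hP.total a with ha | ha
    · exact ha
    · have := hP.mul _ ha _ (hP.sq b)
      rw [neg_mul] at this
      have h0 := (hφ0 _).2 ⟨h, this⟩
      have : φ a = 0 := by simpa [hb] using h0
      exact ((hφ0 _).1 this).1
  let N : Set K := {x | ∃ a b, φ b ≠ 0 ∧ a ∈ P ∧ x * (φ b * φ b) = φ a}
  have hN : ∀ x a b, φ b ≠ 0 → x * (φ b * φ b) = φ a → x ∈ N → a ∈ P := by
    rintro x a b hb hx ⟨a', b', hb', ha', hx'⟩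
    refine hcancel a b' hb' (hφP _ (a' * (b * b)) ?_ (hP.mul _ ha' _ (hP.sq b)))
    rw [map_mul, map_mul, map_mul, map_mul, ← hx, ← hx']
    ring
  have hrep : ∀ x : K, ∃ a b, φ b ≠ 0 ∧ x * (φ b * φ b) = φ a := by
    intro x
    obtain ⟨a, b, hb, hx⟩ := hφsurj x
    exact ⟨a * b, b, hb, by rw [map_mul, ← hx]; ring⟩
  obtain ⟨L, hL, hLN⟩ := exists_linearOrder_of_cone N (by
      rintro x ⟨a, b, hb, ha, hx⟩ y ⟨a', b', hb', ha', hy⟩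
      refine ⟨a * (b' * b') + a' * (b * b), b * b', by simp [hb, hb'],
        hP.add _ (hP.mul _ ha _ (hP.sq _)) _ (hP.mul _ ha' _ (hP.sq _)), ?_⟩
      simp only [map_mul, map_add, ← hx, ← hy]
      ring) (by
      rintro x ⟨a, b, hb, ha, hx⟩ y ⟨a', b', hb', ha', hy⟩
      refine ⟨a * a', b * b', by simp [hb, hb'], hP.mul _ ha _ ha', ?_⟩
      simp only [map_mul, ← hx, ← hy]
      ring) (by
      intro x
      obtain ⟨a, b, hb, hx⟩ := hrep x
      rcases hP.total a with ha | ha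
      · exact .inl ⟨a, b, hb, ha, hx⟩
      · exact .inr ⟨-a, b, hb, ha, by rw [map_neg, ← hx]; ring⟩) (by
      rintro x hx hx'
      obtain ⟨a, b, hb, h⟩ := hrep x
      have h1 := hN x a b hb h hx
      have h2 := hN (-x) (-a) b hb (by rw [map_neg, ← h]; ring) hx'
      have h3 := (hφ0 a).2 ⟨h1, h2⟩
      rw [h3] at h
      simpa [hb] using h)
  refine ⟨K, inferInstance, L, hL, φ, fun a => ?_, hφsurj⟩
  rw [hLN]
  refine ⟨hN (φ a) a 1 (by simp) (by simp), fun h => ⟨a, 1, by simp, h, by simp⟩⟩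

/-- The intermediate value property for polynomials over an ordered field. -/
def PolyIVT (R : Type*) [Field R] [LinearOrder R] : Prop :=
  ∀ (p : Polynomial R) (a b : R), a ≤ b → p.eval a ≤ 0 → 0 ≤ p.eval b →
    ∃ c, a ≤ c ∧ c ≤ b ∧ p.eval c = 0

theorem polyIVT_real : PolyIVT ℝ := by
  intro p a b hab ha hb
  obtain ⟨c, hc, h⟩ := intermediate_value_Icc hab (f := fun x => p.eval x)
    p.continuous.continuousOn ⟨ha, hb⟩
  exact ⟨c, hc.1, hc.2, h⟩

section SignChange

open Polynomial

variable {F : Type*} [Field F] [LinearOrder F] [IsStrictOrderedRing F]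

theorem exists_irreducible_factor_sign_change (h : F[X]) (a b : F)
    (hab : h.eval a * h.eval b < 0) :
    ∃ q, Irreducible q ∧ q ∣ h ∧ q.eval a * q.eval b < 0 := by
  induction h using WfDvdMonoid.induction_on_irreducible with
  | zero => simp at hab
  | unit u hu =>
    obtain ⟨c, -, rfl⟩ := Polynomial.isUnit_iff.1 hu
    simp only [eval_C] at hab
    exact absurd hab (not_lt.2 (mul_self_nonneg c))
  | mul p i hp hi ih =>
    by_cases h : i.eval a * i.eval b < 0
    · exact ⟨i, hi, dvd_mul_right _ _, h⟩
    · simp only [eval_mul] at hab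
      obtain ⟨q, hq, hqp, h'⟩ := ih (by
        by_contra! h2
        push Not at h
        nlinarith [mul_nonneg h h2])
      exact ⟨q, hq, hqp.mul_left _, h'⟩

/-- The nonnegative combinations of squares of polynomials satisfying `D`. -/
def sqCombo (D : F[X] → Prop) : AddSubmonoid F[X] :=
  AddSubmonoid.closure {s | ∃ c g, 0 ≤ c ∧ D g ∧ s = C c * (g * g)}

theorem not_dvd_one_add_sqCombo (n : ℕ) : ∀ (f : F[X]) (a b : F), f.natDegree ≤ n →
    Irreducible f → f.eval a * f.eval b < 0 → ∀ s ∈ sqCombo (fun _ => True), ¬ f ∣ 1 + s := by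
  induction n using Nat.strong_induction_on with
  | _ n ih =>
  intro f a b hn hf hab s hs hdvd
  have hpos : 0 < f.natDegree := hf.natDegree_pos
  obtain ⟨s', hs', hdvd', hdeg, heval⟩ : ∃ s' ∈ sqCombo (fun _ => True), f ∣ s - s' ∧
      s'.natDegree ≤ 2 * (f.natDegree - 1) ∧ ∀ x, 0 ≤ s'.eval x := by
    clear hdvd
    induction hs using AddSubmonoid.closure_induction with
    | mem x hx =>
      obtain ⟨c, g, hc, -, rfl⟩ := hx
      have hmod : (g % f).natDegree ≤ f.natDegree - 1 :=
        Nat.le_sub_one_of_lt (natDegree_mod_lt g hpos.ne')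
      refine ⟨C c * ((g % f) * (g % f)), AddSubmonoid.subset_closure ⟨c, g % f, hc, trivial, rfl⟩,
        ?_, ?_, fun x => ?_⟩
      · refine ⟨C c * (g / f) * (g + g % f), ?_⟩
        have := EuclideanDomain.div_add_mod g f
        linear_combination (-C c * (g + g % f)) * this
      · refine (natDegree_C_mul_le _ _).trans (natDegree_mul_le.trans ?_)
        omega
      · simp only [eval_mul, eval_C]
        exact mul_nonneg hc (mul_self_nonneg _)
    | zero => exact ⟨0, zero_mem _, by simp, by simp, by simp⟩
    | add x y _ _ hx hy =>
      obtain ⟨s, hs, h1, h2, h3⟩ := hx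
      obtain ⟨t, ht, h4, h5, h6⟩ := hy
      refine ⟨s + t, add_mem hs ht, ?_, ?_, fun x => ?_⟩
      · rw [add_sub_add_comm]
        exact dvd_add h1 h4
      · exact (natDegree_add_le _ _).trans (max_le h2 h5)
      · rw [eval_add]
        exact add_nonneg (h3 x) (h6 x)
  obtain ⟨h, hh⟩ : f ∣ 1 + s' := by
    have := dvd_sub hdvd hdvd'
    convert this using 1
    ring
  have hev : ∀ x, 0 < f.eval x * h.eval x := by
    intro x
    rw [← eval_mul, ← hh, eval_add, eval_one]
    linarith [heval x]
  have hh0 : h ≠ 0 := by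
    rintro rfl
    simpa using hev a
  have hdegh : h.natDegree < n := by
    have h1 : (1 + s').natDegree ≤ 2 * (f.natDegree - 1) := by
      refine (natDegree_add_le _ _).trans (max_le (by simp) hdeg)
    rw [hh, natDegree_mul hf.ne_zero hh0] at h1
    omega
  have hsign : h.eval a * h.eval b < 0 := by
    by_contra! h2
    nlinarith [mul_pos (hev a) (hev b), mul_nonneg (neg_nonneg.2 hab.le) h2]
  obtain ⟨q, hq, hqh, hqs⟩ := exists_irreducible_factor_sign_change h a b hsign
  exact ih _ hdegh q a b (natDegree_le_of_dvd hqh hh0) hq hqs s' hs'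
    (hh ▸ hqh.mul_left _)

theorem exists_cone_adjoinRoot (f : F[X]) (a b : F) (hf : Irreducible f)
    (hab : f.eval a * f.eval b < 0) :
    ∃ P : Set (AdjoinRoot f), IsPrimeCone P ∧ ∀ c : F, 0 ≤ c → AdjoinRoot.of f c ∈ P := by
  have hT : IsPreorderCone (AdjoinRoot.mk f '' (sqCombo (F := F) fun _ => True)) := by
    refine ⟨?_, ?_, ?_, ?_⟩
    · rintro _ ⟨s, hs, rfl⟩ _ ⟨t, ht, rfl⟩
      exact ⟨s + t, add_mem hs ht, map_add _ _ _⟩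
    · rintro _ ⟨s, hs, rfl⟩ _ ⟨t, ht, rfl⟩
      refine ⟨s * t, ?_, map_mul _ _ _⟩
      rw [SetLike.mem_coe] at hs ht ⊢
      induction hs using AddSubmonoid.closure_induction with
      | mem x hx =>
        obtain ⟨c, g, hc, -, rfl⟩ := hx
        induction ht using AddSubmonoid.closure_induction with
        | mem y hy =>
          obtain ⟨d, k, hd, -, rfl⟩ := hy
          exact AddSubmonoid.subset_closure ⟨c * d, g * k, mul_nonneg hc hd, trivial, by
            rw [C_mul]; ring⟩
        | zero => simp
        | add y z _ _ hy hz => simpa only [mul_add] using add_mem hy hz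
      | zero => simp
      | add y z _ _ hy hz => simpa only [add_mul] using add_mem hy hz
    · intro x
      obtain ⟨g, rfl⟩ := AdjoinRoot.mk_surjective x
      exact ⟨g * g, AddSubmonoid.subset_closure ⟨1, g, zero_le_one, trivial, by simp⟩, map_mul _ _ _⟩
    · rintro ⟨s, hs, h⟩
      refine not_dvd_one_add_sqCombo _ f a b le_rfl hf hab s hs ?_
      rw [← AdjoinRoot.mk_eq_zero, map_add, h]
      simp
  obtain ⟨P, hTP, hP⟩ := hT.exists_isPrimeCone
  refine ⟨P, hP, fun c hc => hTP ⟨C c, AddSubmonoid.subset_closure ⟨c, 1, hc, trivial, by simp⟩, ?_⟩⟩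
  rw [AdjoinRoot.mk_C]

theorem polyIVT_of_exists_root
    (h : ∀ (f : F[X]) (a b : F), Irreducible f → f.eval a * f.eval b < 0 → ∃ c, f.eval c = 0) :
    PolyIVT F := by
  intro p a b hab ha hb
  rcases ha.eq_or_lt with ha | ha
  · exact ⟨a, le_rfl, hab, ha⟩
  rcases hb.eq_or_lt with hb | hb
  · exact ⟨b, hab, le_rfl, hb.symm⟩
  obtain ⟨q, hq, hqp, hs⟩ := exists_irreducible_factor_sign_change p a b (mul_neg_of_neg_of_pos ha hb)
  obtain ⟨c, hc⟩ := h q a b hq hs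
  obtain ⟨u, hu⟩ := dvd_iff_isRoot.2 hc
  rcases hq.isUnit_or_isUnit hu with h1 | h1
  · exact absurd h1 (not_isUnit_X_sub_C c)
  obtain ⟨d, -, rfl⟩ := Polynomial.isUnit_iff.1 h1
  rw [hu] at hs
  simp only [eval_mul, eval_sub, eval_X, eval_C] at hs
  have h2 : (a - c) * (b - c) < 0 := by
    by_contra! h2
    nlinarith [mul_nonneg h2 (mul_self_nonneg d)]
  refine ⟨c, ?_, ?_, ?_⟩
  · by_contra! h3
    nlinarith
  · by_contra! h3
    nlinarith
  · exact eval_eq_zero_of_dvd_of_eval_eq_zero hqp hc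

end SignChange

/-- The cone of nonnegative elements of an ordered subfield. -/
structure IsSubfieldCone {Ω : Type*} [Field Ω] (P : Set Ω) : Prop where
  add : ∀ x ∈ P, ∀ y ∈ P, x + y ∈ P
  mul : ∀ x ∈ P, ∀ y ∈ P, x * y ∈ P
  inv : ∀ x ∈ P, x⁻¹ ∈ P
  sub : ∀ x ∈ P, ∀ y ∈ P, x - y ∈ P ∨ y - x ∈ P
  anti : ∀ x ∈ P, -x ∈ P → x = 0
  one : (1 : Ω) ∈ P

namespace IsSubfieldCone

variable {Ω : Type*} [Field Ω] {P : Set Ω}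

theorem zero (hP : IsSubfieldCone P) : (0 : Ω) ∈ P := by
  simpa using hP.sub 1 hP.one 1 hP.one

/-- The subfield whose nonnegative elements are given by a cone. -/
def subfield (hP : IsSubfieldCone P) : Subfield Ω where
  carrier := {x | x ∈ P ∨ -x ∈ P}
  zero_mem' := .inl hP.zero
  one_mem' := .inl hP.one
  add_mem' := by
    rintro x y (hx | hx) (hy | hy)
    · exact .inl (hP.add _ hx _ hy)
    · simpa [add_comm, sub_eq_add_neg] using hP.sub _ hx _ hy
    · simpa [add_comm, sub_eq_add_neg] using (hP.sub _ hx _ hy).symm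
    · exact .inr (by rw [neg_add]; exact hP.add _ hx _ hy)
  mul_mem' := by
    rintro x y (hx | hx) (hy | hy)
    · exact .inl (hP.mul _ hx _ hy)
    · exact .inr (by simpa using hP.mul _ hx _ hy)
    · exact .inr (by simpa using hP.mul _ hx _ hy)
    · exact .inl (by simpa using hP.mul _ hx _ hy)
  neg_mem' := by
    rintro x (hx | hx)
    · exact .inr (by simpa using hx)
    · exact .inl hx
  inv_mem' := by
    rintro x (hx | hx)
    · exact .inl (hP.inv _ hx)
    · exact .inr (by simpa [inv_neg] using hP.inv _ hx)

theorem exists_maximal (hP : IsSubfieldCone P) :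
    ∃ M, P ⊆ M ∧ IsSubfieldCone M ∧ ∀ P', IsSubfieldCone P' → M ⊆ P' → P' = M := by
  obtain ⟨M, hPM, hM⟩ := zorn_subset_nonempty {P : Set Ω | IsSubfieldCone P} (fun c hc hchain hne => by
    have key : ∀ a ∈ ⋃₀ c, ∀ b ∈ ⋃₀ c, ∃ s ∈ c, a ∈ s ∧ b ∈ s := by
      rintro a ⟨s, hs, has⟩ b ⟨t, ht, hbt⟩
      rcases hchain.total hs ht with h | h
      · exact ⟨t, ht, h has, hbt⟩
      · exact ⟨s, hs, has, h hbt⟩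
    refine ⟨⋃₀ c, ⟨?_, ?_, ?_, ?_, ?_, ?_⟩, fun s hs => Set.subset_sUnion_of_mem hs⟩
    · intro x hx y hy
      obtain ⟨s, hs, h1, h2⟩ := key x hx y hy
      exact ⟨s, hs, (hc hs).add _ h1 _ h2⟩
    · intro x hx y hy
      obtain ⟨s, hs, h1, h2⟩ := key x hx y hy
      exact ⟨s, hs, (hc hs).mul _ h1 _ h2⟩
    · rintro x ⟨s, hs, h⟩
      exact ⟨s, hs, (hc hs).inv _ h⟩
    · intro x hx y hy
      obtain ⟨s, hs, h1, h2⟩ := key x hx y hy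
      exact ((hc hs).sub _ h1 _ h2).imp (fun h => ⟨s, hs, h⟩) (fun h => ⟨s, hs, h⟩)
    · intro x hx hy
      obtain ⟨s, hs, h1, h2⟩ := key x hx _ hy
      exact (hc hs).anti _ h1 h2
    · obtain ⟨s, hs⟩ := hne
      exact ⟨s, hs, (hc hs).one⟩) P hP
  exact ⟨M, hPM, hM.prop, fun P' hP' h => (hM.eq_of_subset hP' h).symm⟩

end IsSubfieldCone

open Polynomial in
/-- Every ordered field embeds into one with the intermediate value property. -/
theorem exists_polyIVT_extension (K : Type u) [Field K] [LinearOrder K] [IsStrictOrderedRing K] :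
    ∃ (R : Type u) (_ : Field R) (_ : LinearOrder R) (_ : IsStrictOrderedRing R) (φ : K →+* R),
      StrictMono φ ∧ PolyIVT R := by
  let Ω := AlgebraicClosure K
  let ι : K →+* Ω := algebraMap K Ω
  have hP0 : IsSubfieldCone (ι '' {x | 0 ≤ x}) := by
    refine ⟨?_, ?_, ?_, ?_, ?_, ⟨1, zero_le_one, map_one _⟩⟩
    · rintro _ ⟨x, hx, rfl⟩ _ ⟨y, hy, rfl⟩
      exact ⟨x + y, add_nonneg hx hy, map_add _ _ _⟩
    · rintro _ ⟨x, hx, rfl⟩ _ ⟨y, hy, rfl⟩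
      exact ⟨x * y, mul_nonneg hx hy, map_mul _ _ _⟩
    · rintro _ ⟨x, hx, rfl⟩
      exact ⟨x⁻¹, inv_nonneg.2 hx, map_inv₀ _ _⟩
    · rintro _ ⟨x, hx, rfl⟩ _ ⟨y, hy, rfl⟩
      rcases le_total x y with h | h
      · exact .inr ⟨y - x, sub_nonneg.2 h, map_sub _ _ _⟩
      · exact .inl ⟨x - y, sub_nonneg.2 h, map_sub _ _ _⟩
    · rintro _ ⟨x, hx, rfl⟩ ⟨y, hy, h⟩
      have h' : y = -x := ι.injective (by rw [h, map_neg])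
      have : x = 0 := le_antisymm (by simpa [h'] using hy) hx
      rw [this, map_zero]
  obtain ⟨P, hPP, hP, hmax⟩ := hP0.exists_maximal
  let F := hP.subfield
  obtain ⟨L, hL, hLN⟩ := exists_linearOrder_of_cone (K := F) {x | (x : Ω) ∈ P}
    (fun a ha b hb => hP.add _ ha _ hb) (fun a ha b hb => hP.mul _ ha _ hb)
    (fun a => a.2) (fun a ha hb => Subtype.ext (hP.anti _ ha hb))
  have hιF : ∀ x, ι x ∈ F := by
    intro x
    rcases le_total 0 x with h | h
    · exact .inl (hPP ⟨x, h, rfl⟩)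
    · exact .inr (hPP ⟨-x, neg_nonneg.2 h, map_neg _ _⟩)
  refine ⟨F, inferInstance, L, hL, ι.codRestrict F hιF, ?_, ?_⟩
  · intro x y hxy
    refine lt_of_le_of_ne ?_ ?_
    · rw [← sub_nonneg, hLN]
      exact hPP ⟨y - x, sub_nonneg.2 hxy.le, map_sub _ _ _⟩
    · intro h
      exact hxy.ne ((ι.codRestrict F hιF).injective h)
  · refine polyIVT_of_exists_root fun f a b hf hab => ?_
    obtain ⟨Q, hQ, hQc⟩ := exists_cone_adjoinRoot f a b hf hab
    have : Fact (Irreducible f) := ⟨hf⟩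
    have : FiniteDimensional F (AdjoinRoot f) :=
      (AdjoinRoot.powerBasis hf.ne_zero).finite
    let e : AdjoinRoot f →ₐ[F] Ω := IsAlgClosed.lift
    have hanti : ∀ x ∈ Q, -x ∈ Q → x = 0 := by
      intro x hx hx'
      by_contra h0
      refine hQ.neg_one ?_
      have := hQ.mul _ hx' _ (hQ.mul _ hx _ (hQ.sq x⁻¹))
      convert this using 1
      field_simp
    have hQ' : IsSubfieldCone (e '' Q) := by
      refine ⟨?_, ?_, ?_, ?_, ?_, ⟨1, hQ.one, map_one _⟩⟩
      · rintro _ ⟨x, hx, rfl⟩ _ ⟨y, hy, rfl⟩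
        exact ⟨x + y, hQ.add _ hx _ hy, map_add _ _ _⟩
      · rintro _ ⟨x, hx, rfl⟩ _ ⟨y, hy, rfl⟩
        exact ⟨x * y, hQ.mul _ hx _ hy, map_mul _ _ _⟩
      · rintro _ ⟨x, hx, rfl⟩
        refine ⟨x * (x⁻¹ * x⁻¹), hQ.mul _ hx _ (hQ.sq _), ?_⟩
        by_cases h0 : x = 0
        · simp [h0]
        · rw [← mul_assoc, mul_inv_cancel₀ h0, one_mul, map_inv₀]
      · rintro _ ⟨x, hx, rfl⟩ _ ⟨y, hy, rfl⟩
        exact (hQ.total (x - y)).imp (fun h => ⟨x - y, h, map_sub _ _ _⟩)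
          (fun h => ⟨y - x, by simpa using h, map_sub _ _ _⟩)
      · rintro _ ⟨x, hx, rfl⟩ ⟨y, hy, h⟩
        have h' : y = -x := e.toRingHom.injective (by simpa using h)
        rw [hanti x hx (h' ▸ hy), map_zero]
    have hPQ : P ⊆ e '' Q := by
      intro x hx
      refine ⟨AdjoinRoot.of f ⟨x, .inl hx⟩, hQc _ ((hLN _).2 hx), ?_⟩
      exact e.commutes ⟨x, .inl hx⟩
    have hQP := hmax _ hQ' hPQ
    have hroot : e (AdjoinRoot.root f) ∈ F := by
      change _ ∈ P ∨ _ ∈ P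
      rw [← hQP]
      exact (hQ.total (AdjoinRoot.root f)).imp (fun h => ⟨_, h, rfl⟩) fun h => ⟨_, h, map_neg _ _⟩
    refine ⟨⟨_, hroot⟩, ?_⟩
    have h1 : aeval (e (AdjoinRoot.root f)) f = 0 := by
      rw [aeval_algHom_apply, AdjoinRoot.aeval_eq, AdjoinRoot.mk_self, map_zero]
    have h2 : aeval (algebraMap F Ω ⟨_, hroot⟩) f = 0 := h1
    rw [aeval_algebraMap_apply] at h2
    have := (algebraMap F Ω).injective (h2.trans (map_zero _).symm)
    simpa [coe_aeval_eq_eval] using this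

section IVT

open Polynomial

variable {R : Type*} [Field R] [LinearOrder R] [IsStrictOrderedRing R]

theorem PolyIVT.exists_root (hR : PolyIVT R) (p : R[X]) {a b : R} (hab : a ≤ b)
    (h : p.eval a * p.eval b ≤ 0) : ∃ c, a ≤ c ∧ c ≤ b ∧ p.eval c = 0 := by
  rcases le_total (p.eval a) 0 with ha | ha
  · rcases le_total 0 (p.eval b) with hb | hb
    · exact hR p a b hab ha hb
    · rcases mul_eq_zero.1 (le_antisymm h (mul_nonneg_of_nonpos_of_nonpos ha hb)) with h0 | h0
      · exact ⟨a, le_rfl, hab, h0⟩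
      · exact ⟨b, hab, le_rfl, h0⟩
  · rcases le_total (p.eval b) 0 with hb | hb
    · simpa using hR (-p) a b hab (by simpa using ha) (by simpa using hb)
    · rcases mul_eq_zero.1 (le_antisymm h (mul_nonneg ha hb)) with h0 | h0
      · exact ⟨a, le_rfl, hab, h0⟩
      · exact ⟨b, hab, le_rfl, h0⟩

theorem exists_eq_pow_mul_eval_ne_zero {R : Type*} [Field R] {p : R[X]} (hp : p ≠ 0) {a : R} (ha : p.eval a = 0) :
    ∃ (m : ℕ) (q : R[X]), p = (X - C a) ^ (m + 1) * q ∧ q.eval a ≠ 0 := by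
  obtain ⟨q, h1, h2⟩ := exists_eq_pow_rootMultiplicity_mul_and_not_dvd p hp a
  have : 0 < p.rootMultiplicity a := (rootMultiplicity_pos hp).2 ha
  obtain ⟨m, hm⟩ := Nat.exists_eq_succ_of_ne_zero this.ne'
  refine ⟨m, q, by rw [hm] at h1; exact h1, fun h => h2 (dvd_iff_isRoot.2 h)⟩

theorem PolyIVT.rolle_aux (hR : PolyIVT R) (p : R[X]) {a b : R} (hab : a < b) (hp : p ≠ 0)
    (ha : p.eval a = 0) (hb : p.eval b = 0) (hno : ∀ c, a < c → c < b → p.eval c ≠ 0) :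
    ∃ c, a < c ∧ c < b ∧ p.derivative.eval c = 0 := by
  obtain ⟨m, q, rfl, hqa⟩ := exists_eq_pow_mul_eval_ne_zero hp ha
  have hq0 : q ≠ 0 := by rintro rfl; simp at hqa
  have hqb : q.eval b = 0 := by
    simpa [sub_ne_zero.2 hab.ne'] using hb
  obtain ⟨l, r, rfl, hrb⟩ := exists_eq_pow_mul_eval_ne_zero hq0 hqb
  have hra : r.eval a ≠ 0 := by
    intro h
    simp [h] at hqa
  have hpos : 0 < r.eval a * r.eval b := by
    by_contra! h
    obtain ⟨c, h1, h2, h3⟩ := hR.exists_root r hab.le h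
    refine hno c (lt_of_le_of_ne h1 ?_) (lt_of_le_of_ne h2 ?_) (by simp [h3])
    · rintro rfl; exact hra h3
    · rintro rfl; exact hrb h3
  let s : R[X] := (C ((m : R) + 1) * (X - C b) + C ((l : R) + 1) * (X - C a)) * r +
    (X - C a) * (X - C b) * derivative r
  have hder : derivative ((X - C a) ^ (m + 1) * ((X - C b) ^ (l + 1) * r)) =
      (X - C a) ^ m * (X - C b) ^ l * s := by
    simp only [derivative_mul, derivative_X_sub_C_pow, s, Nat.add_sub_cancel]
    push_cast
    simp only [map_add, map_natCast, map_one]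
    ring
  have hsa : s.eval a = ((m : R) + 1) * (a - b) * r.eval a := by simp [s]
  have hsb : s.eval b = ((l : R) + 1) * (b - a) * r.eval b := by simp [s]
  have hm : (0 : R) < (m : R) + 1 := by positivity
  have hl : (0 : R) < (l : R) + 1 := by positivity
  have hlt : s.eval a * s.eval b < 0 := by
    rw [hsa, hsb]
    have : 0 < ((m : R) + 1) * ((l : R) + 1) * ((b - a) * (b - a)) * (r.eval a * r.eval b) :=
      mul_pos (mul_pos (mul_pos hm hl) (mul_pos (sub_pos.2 hab) (sub_pos.2 hab))) hpos
    linarith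
  obtain ⟨c, h1, h2, h3⟩ := hR.exists_root s hab.le hlt.le
  refine ⟨c, lt_of_le_of_ne h1 ?_, lt_of_le_of_ne h2 ?_, by rw [hder]; simp [h3]⟩
  · rintro rfl; simp [h3] at hlt
  · rintro rfl; simp [h3] at hlt

theorem PolyIVT.rolle (hR : PolyIVT R) (p : R[X]) {a b : R} (hab : a < b)
    (ha : p.eval a = 0) (hb : p.eval b = 0) :
    ∃ c, a < c ∧ c < b ∧ p.derivative.eval c = 0 := by
  by_cases hp : p = 0
  · obtain ⟨c, h1, h2⟩ := exists_between hab
    exact ⟨c, h1, h2, by simp [hp]⟩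
  let E := {x : R | x ∈ p.roots.toFinset ∧ a < x}
  have hE : E.Finite := (p.roots.toFinset.finite_toSet).subset fun x hx => hx.1
  obtain ⟨b', hb', hmin⟩ := Set.exists_min_image E id hE ⟨b, by simp [hp, hb], hab⟩
  have hb'0 : p.eval b' = 0 := by simpa [hp] using hb'.1
  have hle : b' ≤ b := hmin b ⟨by simp [hp, hb], hab⟩
  obtain ⟨c, h1, h2, h3⟩ := hR.rolle_aux p hb'.2 hp ha hb'0 (fun c h1 h2 h3 =>
    absurd (hmin c ⟨by simp [hp, h3], h1⟩) (not_le.2 h2))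
  exact ⟨c, h1, h2.trans_le hle, h3⟩

theorem PolyIVT.strictMono (hR : PolyIVT R) (p : R[X]) {a b : R} (hab : a < b)
    (h : ∀ c, a < c → c < b → 0 < p.derivative.eval c) : p.eval a < p.eval b := by
  obtain ⟨c, h1, h2, h3⟩ := hR.rolle
    (p - C (p.eval a) - C ((p.eval b - p.eval a) / (b - a)) * (X - C a)) hab (by simp) (by
      simp [div_mul_cancel₀ _ (sub_ne_zero.2 hab.ne')])
  have h4 := h c h1 h2
  simp only [derivative_sub, derivative_C, derivative_mul, derivative_X, eval_sub,
    eval_C, zero_mul, zero_add, sub_zero, mul_one] at h3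
  have h5 : 0 < (p.eval b - p.eval a) / (b - a) := by linarith
  rw [div_pos_iff_of_pos_right (sub_pos.2 hab)] at h5
  linarith

theorem exists_forall_le_abs_eval (n : ℕ) : ∀ p : R[X], p.natDegree = n + 1 → ∀ c : R,
    ∃ N, ∀ x, N ≤ x → c ≤ |p.eval x| := by
  induction n with
  | zero =>
    intro p hp c
    rw [eq_X_add_C_of_natDegree_le_one hp.le]
    have h0 : p.coeff 1 ≠ 0 := by
      have : p.leadingCoeff ≠ 0 := leadingCoeff_ne_zero.2 (by rintro rfl; simp at hp)
      rwa [leadingCoeff, hp] at this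
    refine ⟨(|c| + |p.coeff 0|) / |p.coeff 1|, fun x hx => ?_⟩
    have h1 : 0 < |p.coeff 1| := abs_pos.2 h0
    rw [div_le_iff₀ h1] at hx
    simp only [eval_add, eval_mul, eval_C, eval_X]
    have h2 := abs_sub_abs_le_abs_sub (p.coeff 1 * x) (-p.coeff 0)
    rw [abs_neg, sub_neg_eq_add, abs_mul] at h2
    nlinarith [le_abs_self c, le_abs_self x]
  | succ n ih =>
    intro p hp c
    obtain ⟨N, hN⟩ := ih p.divX (by rw [natDegree_divX_eq_natDegree_tsub_one, hp]; rfl) 1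
    refine ⟨max N (max 0 (|c| + |p.coeff 0|)), fun x hx => ?_⟩
    have hN' := hN x ((le_max_left _ _).trans hx)
    have h0 : 0 ≤ x := (le_max_left _ _).trans ((le_max_right _ _).trans hx)
    have h1 : |c| + |p.coeff 0| ≤ x := (le_max_right _ _).trans ((le_max_right _ _).trans hx)
    conv_rhs => rw [← divX_mul_X_add p]
    simp only [eval_add, eval_mul, eval_C, eval_X]
    have h2 := abs_sub_abs_le_abs_sub (p.divX.eval x * x) (-p.coeff 0)
    rw [abs_neg, sub_neg_eq_add, abs_mul, abs_of_nonneg h0] at h2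
    nlinarith [le_abs_self c]

/-- A polynomial that is nonpositive at `y` and increasing to the right of `y` until the next
point of `E`, where it is positive, has a root before that point. -/
theorem PolyIVT.exists_root_above (hR : PolyIVT R) (p : R[X]) {E : Set R} (hE : E.Finite) (y : R)
    (hd : ∀ x, y ≤ x → (∀ a ∈ E, y < a → x < a) → 0 < p.derivative.eval x)
    (hy : p.eval y ≤ 0)
    (hb : ∀ a ∈ E, y < a → (∀ c ∈ E, y < c → a ≤ c) → 0 < p.eval a) :
    ∃ x, y ≤ x ∧ (∀ a ∈ E, y < a → x < a) ∧ p.eval x = 0 := by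
  by_cases hne : ({a | a ∈ E ∧ y < a} : Set R).Nonempty
  · obtain ⟨a, ha, hmin⟩ := Set.exists_min_image {a | a ∈ E ∧ y < a} id
      (hE.subset fun x hx => hx.1) hne
    have hpa := hb a ha.1 ha.2 fun c hc hyc => hmin c ⟨hc, hyc⟩
    obtain ⟨x, h1, h2, h3⟩ := hR p y a ha.2.le hy hpa.le
    refine ⟨x, h1, fun c hc hyc => lt_of_lt_of_le (lt_of_le_of_ne h2 ?_) (hmin c ⟨hc, hyc⟩), h3⟩
    rintro rfl
    exact hpa.ne' h3
  · have hE' : ∀ a ∈ E, ¬ y < a := fun a ha h => hne ⟨a, ha, h⟩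
    have hd' : ∀ x, y ≤ x → 0 < p.derivative.eval x :=
      fun x hx => hd x hx fun a ha h => absurd h (hE' a ha)
    have hdeg : p.natDegree ≠ 0 := by
      intro h
      have := hd' y le_rfl
      rw [derivative_of_natDegree_zero h] at this
      simp at this
    obtain ⟨n, hn⟩ := Nat.exists_eq_succ_of_ne_zero hdeg
    obtain ⟨N, hN⟩ := exists_forall_le_abs_eval n p hn (1 - p.eval y)
    have h1 := hN (max N (y + 1)) (le_max_left _ _)
    have h2 : y < max N (y + 1) := (lt_add_one y).trans_le (le_max_right _ _)
    have h3 := hR.strictMono p h2 fun c hc _ => hd' c hc.le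
    have h4 : 0 ≤ p.eval (max N (y + 1)) := by
      by_contra! h
      rw [abs_of_neg h] at h1
      linarith
    obtain ⟨x, h5, h6, h7⟩ := hR p y _ h2.le hy h4
    exact ⟨x, h5, fun a ha h => absurd h (hE' a ha), h7⟩

theorem PolyIVT.exists_root_below (hR : PolyIVT R) (p : R[X]) {E : Set R} (hE : E.Finite) (y : R)
    (hd : ∀ x, x ≤ y → (∀ a ∈ E, a < y → a < x) → 0 < p.derivative.eval x)
    (hy : 0 ≤ p.eval y)
    (hb : ∀ a ∈ E, a < y → (∀ c ∈ E, c < y → c ≤ a) → p.eval a < 0) :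
    ∃ x, x ≤ y ∧ (∀ a ∈ E, a < y → a < x) ∧ p.eval x = 0 := by
  obtain ⟨x, h1, h2, h3⟩ := hR.exists_root_above (-(p.comp (-X))) (E := Neg.neg '' E)
    (hE.image _) (-y) (by
      intro x hx h
      have := hd (-x) (by linarith) fun a ha hay => by
        have := h (-a) ⟨a, ha, rfl⟩ (by linarith)
        linarith
      simpa [derivative_comp] using this) (by simpa using hy) (by
      rintro _ ⟨a, ha, rfl⟩ h1 h2
      have := hb a ha (by linarith) fun c hc hcy => by
        have := h2 (-c) ⟨c, hc, rfl⟩ (by linarith)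
        linarith
      simpa using this)
  refine ⟨-x, by linarith, fun a ha hay => ?_, by simpa using h3⟩
  have := h2 (-a) ⟨a, ha, rfl⟩ (by linarith)
  linarith

end IVT

section Matching

variable {R₁ R₂ : Type*} [LinearOrder R₁] [LinearOrder R₂]

/-- The points `y` and `z` have the same position with respect to the pairs in `M`. -/
def SamePos (M : Set (R₁ × R₂)) (y : R₁) (z : R₂) : Prop :=
  ∀ p ∈ M, (p.1 < y ↔ p.2 < z) ∧ (y < p.1 ↔ z < p.2)

theorem cmp_eq_cmp_iff {a b : R₁} {c d : R₂} :
    cmp a b = cmp c d ↔ (a < b ↔ c < d) ∧ (b < a ↔ d < c) := by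
  constructor
  · intro h
    exact ⟨lt_iff_lt_of_cmp_eq_cmp h, lt_iff_lt_of_cmp_eq_cmp (by rwa [cmp_eq_cmp_symm])⟩
  · rintro ⟨h1, h2⟩
    rcases lt_trichotomy a b with h | h | h
    · rw [cmp_eq_lt_iff _ _ |>.2 h, cmp_eq_lt_iff _ _ |>.2 (h1.1 h)]
    · subst h
      rw [cmp_self_eq_eq, eq_comm, cmp_eq_eq_iff]
      simp only [lt_irrefl, false_iff, not_lt] at h1 h2
      exact le_antisymm h2 h1
    · rw [cmp_eq_gt_iff _ _ |>.2 h, cmp_eq_gt_iff _ _ |>.2 (h2.1 h)]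

theorem SamePos.mono {M M' : Set (R₁ × R₂)} (h : M' ⊆ M) {y : R₁} {z : R₂}
    (hyz : SamePos M y z) : SamePos M' y z := fun p hp => hyz p (h hp)

theorem SamePos.eq_iff {M : Set (R₁ × R₂)} {y : R₁} {z : R₂} (h : SamePos M y z)
    {p : R₁ × R₂} (hp : p ∈ M) : p.1 = y ↔ p.2 = z := by
  obtain ⟨h1, h2⟩ := h p hp
  rw [← not_iff_not, ← ne_eq, ← ne_eq, ne_iff_lt_or_gt, ne_iff_lt_or_gt, h1, h2]

theorem SamePos.swap {M : Set (R₁ × R₂)} {y : R₁} {z : R₂} (h : SamePos M y z) :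
    SamePos (Prod.swap '' M) z y := by
  rintro _ ⟨p, hp, rfl⟩
  exact ⟨(h p hp).1.symm, (h p hp).2.symm⟩

theorem samePos_swap {M : Set (R₁ × R₂)} {y : R₁} {z : R₂} :
    SamePos (Prod.swap '' M) z y ↔ SamePos M y z :=
  ⟨fun h => by simpa [Set.image_image] using h.swap, SamePos.swap⟩

theorem exists_samePos [DenselyOrdered R₂] [NoMinOrder R₂] [NoMaxOrder R₂] [Nonempty R₂]
    {M : Set (R₁ × R₂)} (hfin : M.Finite) (hM : ∀ p ∈ M, SamePos M p.1 p.2) (y : R₁) :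
    ∃ z, SamePos M y z := by
  obtain ⟨z, hz⟩ := Order.PartialIso.exists_across
    (⟨hfin.toFinset, fun p hp q hq => cmp_eq_cmp_iff.2 (hM q (by simpa using hq) p
      (by simpa using hp))⟩ : Order.PartialIso R₁ R₂) y
  exact ⟨z, fun p hp => cmp_eq_cmp_iff.1 (hz p (by simpa using hp))⟩

theorem exists_samePos' [DenselyOrdered R₁] [NoMinOrder R₁] [NoMaxOrder R₁] [Nonempty R₁]
    {M : Set (R₁ × R₂)} (hfin : M.Finite) (hM : ∀ p ∈ M, SamePos M p.1 p.2) (z : R₂) :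
    ∃ y, SamePos M y z := by
  obtain ⟨y, hy⟩ := exists_samePos (hfin.image Prod.swap) (by
    rintro _ ⟨p, hp, rfl⟩
    exact (hM p hp).swap) z
  exact ⟨y, samePos_swap.1 hy⟩

end Matching

section Signs

variable {R₁ R₂ : Type*} [Field R₁] [LinearOrder R₁] [Field R₂] [LinearOrder R₂]

theorem sign_eq_sign_iff {x : R₁} {y : R₂} : SignType.sign x = SignType.sign y ↔
    (0 < x ↔ 0 < y) ∧ (x < 0 ↔ y < 0) := by
  constructor
  · intro h
    rw [← sign_eq_one_iff, ← sign_eq_one_iff, ← sign_eq_neg_one_iff, ← sign_eq_neg_one_iff, h]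
    exact ⟨Iff.rfl, Iff.rfl⟩
  · rintro ⟨h1, h2⟩
    rcases lt_trichotomy x 0 with h | h | h
    · rw [sign_neg h, sign_neg (h2.1 h)]
    · subst h
      simp only [lt_irrefl, false_iff, not_lt] at h1 h2
      rw [le_antisymm h1 h2, sign_zero, sign_zero]
    · rw [sign_pos h, sign_pos (h1.1 h)]

theorem eq_zero_iff_of_sign_eq {x : R₁} {y : R₂} (h : SignType.sign x = SignType.sign y) :
    x = 0 ↔ y = 0 := by
  rw [← sign_eq_zero_iff, h, sign_eq_zero_iff]

end Signs

section SignMatching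

open Polynomial

variable {R₁ R₂ : Type*} [Field R₁] [LinearOrder R₁] [IsStrictOrderedRing R₁]
  [Field R₂] [LinearOrder R₂] [IsStrictOrderedRing R₂]

/-- `M` is a finite partial isomorphism such that each pair of polynomials in `Q` has matching
signs at points in the same position with respect to `M`. -/
structure SignMatched (Q : Set (R₁[X] × R₂[X])) (M : Set (R₁ × R₂)) : Prop where
  finite : M.Finite
  iso : ∀ p ∈ M, SamePos M p.1 p.2
  sign : ∀ y z, SamePos M y z → ∀ q ∈ Q,
    SignType.sign (q.1.eval y) = SignType.sign (q.2.eval z)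

variable {Q : Set (R₁[X] × R₂[X])} {M : Set (R₁ × R₂)}

theorem SignMatched.mem_of_root (h : SignMatched Q M) {q : R₁[X] × R₂[X]} (hq : q ∈ Q)
    (hq0 : q.1 ≠ 0) {y : R₁} {z : R₂} (hy : q.1.eval y = 0) (hyz : SamePos M y z) :
    (y, z) ∈ M := by
  by_contra hyM
  have hne : ∀ p ∈ M, p.1 ≠ y := by
    intro p hp h1
    have h2 := (hyz.eq_iff hp).1 h1
    exact hyM (by rw [← h1, ← h2]; exact hp)
  obtain ⟨b, hb, hbM⟩ : ∃ b, y < b ∧ ∀ p ∈ M, y < p.1 → b ≤ p.1 := by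
    by_cases hn : ({p | p ∈ M ∧ y < p.1} : Set (R₁ × R₂)).Nonempty
    · obtain ⟨p, hp, hmin⟩ := Set.exists_min_image {p | p ∈ M ∧ y < p.1} Prod.fst
        (h.finite.subset fun x hx => hx.1) hn
      exact ⟨p.1, hp.2, fun r hr hyr => hmin r ⟨hr, hyr⟩⟩
    · exact ⟨y + 1, lt_add_one y, fun p hp h1 => absurd ⟨p, hp, h1⟩ hn⟩
  have hroots : Set.Ico y b ⊆ {x | x ∈ q.1.roots.toFinset} := by
    intro x hx
    have hxz : SamePos M x z := by
      intro p hp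
      rw [← (hyz p hp).1, ← (hyz p hp).2]
      rcases lt_or_gt_of_ne (hne p hp) with h1 | h1
      · simp [h1, h1.not_gt, h1.trans_le hx.1, (h1.trans_le hx.1).not_gt]
      · have := hx.2.trans_le (hbM p hp h1)
        simp [h1, h1.not_gt, this, this.not_gt]
    have h1 := h.sign y z hyz q hq
    have h2 := h.sign x z hxz q hq
    rw [← h1, hy, sign_zero, sign_eq_zero_iff] at h2
    simp [hq0, h2]
  exact (Set.Ico_infinite hb) (q.1.roots.toFinset.finite_toSet.subset hroots)

theorem SignMatched.restrict (hR₂ : PolyIVT R₂) (h : SignMatched Q M)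
    {Q₀ : Set (R₁[X] × R₂[X])} (hQ₀ : Q₀ ⊆ Q) (h0 : ∀ q ∈ Q₀, q.1 = 0 ↔ q.2 = 0) :
    SignMatched Q₀ {p | p ∈ M ∧ ∃ q ∈ Q₀, q.1 ≠ 0 ∧ q.1.eval p.1 = 0} := by
  set M₀ := {p | p ∈ M ∧ ∃ q ∈ Q₀, q.1 ≠ 0 ∧ q.1.eval p.1 = 0} with hM₀
  have hsub : M₀ ⊆ M := fun p hp => hp.1
  refine ⟨h.finite.subset hsub, fun p hp => (h.iso p hp.1).mono hsub, fun y z hyz q hq => ?_⟩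
  by_cases hq0 : q.1 = 0
  · rw [hq0, (h0 q hq).1 hq0]
    simp
  obtain ⟨z', hz'⟩ := exists_samePos h.finite h.iso y
  rw [h.sign y z' hz' q (hQ₀ hq)]
  by_cases hy : ∃ p ∈ M₀, p.1 = y
  · obtain ⟨p, hp, h1⟩ := hy
    rw [← (hyz.eq_iff hp).1 h1, ((hz'.mono hsub).eq_iff hp).1 h1]
  push Not at hy
  have hroot : ∀ w w', (∀ p ∈ M₀, (p.1 < y ↔ p.2 < w) ∧ (y < p.1 ↔ w < p.2)) →
      (∀ p ∈ M₀, (p.1 < y ↔ p.2 < w') ∧ (y < p.1 ↔ w' < p.2)) → w ≤ w' →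
      ¬ q.2.eval w * q.2.eval w' ≤ 0 := by
    intro w w' hw hw' hww' hle
    obtain ⟨c, h1, h2, h3⟩ := hR₂.exists_root q.2 hww' hle
    obtain ⟨x, hx⟩ := exists_samePos' h.finite h.iso c
    have hx0 : q.1.eval x = 0 := by
      have := h.sign x c hx q (hQ₀ hq)
      rwa [h3, sign_zero, sign_eq_zero_iff] at this
    have hm : (x, c) ∈ M₀ := ⟨h.mem_of_root (hQ₀ hq) hq0 hx0 hx, q, hq, hq0, hx0⟩
    rcases lt_or_gt_of_ne (hy _ hm) with h4 | h4
    · exact absurd (((hw _ hm).1).1 h4) (not_lt.2 h1)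
    · exact absurd (((hw' _ hm).2).1 h4) (not_lt.2 h2)
  have hpos : 0 < q.2.eval z' * q.2.eval z := by
    by_contra! hle
    rcases le_total z z' with h1 | h1
    · exact hroot z z' hyz (hz'.mono hsub) h1 (by rwa [mul_comm])
    · exact hroot z' z (hz'.mono hsub) hyz h1 hle
  rcases mul_pos_iff.1 hpos with h1 | h1
  · rw [sign_pos h1.1, sign_pos h1.2]
  · rw [sign_neg h1.1, sign_neg h1.2]

theorem SamePos.eq_zero_of_increasing (hR₁ : PolyIVT R₁) (hR₂ : PolyIVT R₂) (hfin : M.Finite)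
    (hiso : ∀ p ∈ M, SamePos M p.1 p.2)
    (p₁ : R₁[X]) (p₂ : R₂[X]) {y : R₁} {z : R₂} (hyz : SamePos M y z) (hyM : (y, z) ∉ M)
    (hsign : ∀ p ∈ M, SignType.sign (p₁.eval p.1) = SignType.sign (p₂.eval p.2))
    (hd₁ : ∀ x, SamePos M x z → 0 < p₁.derivative.eval x)
    (hd₂ : ∀ w, SamePos M y w → 0 < p₂.derivative.eval w)
    (hroot : ∀ y₀ z₀, p₁.eval y₀ = 0 → p₂.eval z₀ = 0 → SamePos M y₀ z₀ →
      (y₀ ≤ y ↔ z₀ ≤ z) ∧ (y ≤ y₀ ↔ z ≤ z₀))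
    (h₁ : p₁.eval y ≤ 0) (h₂ : 0 ≤ p₂.eval z) : p₁.eval y = 0 ∧ p₂.eval z = 0 := by
  have hne : ∀ p ∈ M, p.1 ≠ y := by
    intro p hp h1
    have h2 := (hyz.eq_iff hp).1 h1
    exact hyM (by rw [← h1, ← h2]; exact hp)
  have hne' : ∀ p ∈ M, p.2 ≠ z := fun p hp h1 => hne p hp ((hyz.eq_iff hp).2 h1)
  have hup : ∀ x, y ≤ x → (∀ p ∈ M, y < p.1 → x < p.1) → SamePos M x z := by
    intro x hx h p hp
    rw [← (hyz p hp).1, ← (hyz p hp).2]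
    rcases lt_or_gt_of_ne (hne p hp) with h1 | h1
    · simp [h1, h1.not_gt, h1.trans_le hx, (h1.trans_le hx).not_gt]
    · simp [h1, h1.not_gt, h p hp h1, (h p hp h1).not_gt]
  have hup' : ∀ x, z ≤ x → (∀ p ∈ M, z < p.2 → x < p.2) → SamePos M y x := by
    intro x hx h p hp
    rw [(hyz p hp).1, (hyz p hp).2]
    rcases lt_or_gt_of_ne (hne' p hp) with h1 | h1
    · simp [h1, h1.not_gt, h1.trans_le hx, (h1.trans_le hx).not_gt]
    · simp [h1, h1.not_gt, h p hp h1, (h p hp h1).not_gt]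
  have hdown : ∀ x, x ≤ y → (∀ p ∈ M, p.1 < y → p.1 < x) → SamePos M x z := by
    intro x hx h p hp
    rw [← (hyz p hp).1, ← (hyz p hp).2]
    rcases lt_or_gt_of_ne (hne p hp) with h1 | h1
    · simp [h1, h1.not_gt, h p hp h1, (h p hp h1).not_gt]
    · simp [h1, h1.not_gt, hx.trans_lt h1, (hx.trans_lt h1).not_gt]
  have hdown' : ∀ x, x ≤ z → (∀ p ∈ M, p.2 < z → p.2 < x) → SamePos M y x := by
    intro x hx h p hp
    rw [(hyz p hp).1, (hyz p hp).2]
    rcases lt_or_gt_of_ne (hne' p hp) with h1 | h1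
    · simp [h1, h1.not_gt, h p hp h1, (h p hp h1).not_gt]
    · simp [h1, h1.not_gt, hx.trans_lt h1, (hx.trans_lt h1).not_gt]
  obtain ⟨y₀, hy₀, hyc, hy0⟩ := hR₁.exists_root_above p₁ (hfin.image Prod.fst) y
    (fun x hx h => hd₁ x (hup x hx fun p hp => h p.1 ⟨p, hp, rfl⟩)) h₁ (by
      rintro _ ⟨p, hp, rfl⟩ hyp hmin
      rw [← sign_eq_one_iff, hsign p hp, sign_eq_one_iff]
      refine h₂.trans_lt (hR₂.strictMono p₂ ((hyz p hp).2.1 hyp) fun c h1 h2 => hd₂ c ?_)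
      refine hup' c h1.le fun r hr hzr => h2.trans_le ?_
      have h3 := hmin r.1 ⟨r, hr, rfl⟩ ((hyz r hr).2.2 hzr)
      by_contra! h4
      exact h3.not_gt ((hiso p hp r hr).1.2 h4))
  obtain ⟨z₀, hz₀, hzc, hz0⟩ := hR₂.exists_root_below p₂ (hfin.image Prod.snd) z
    (fun x hx h => hd₂ x (hdown' x hx fun p hp => h p.2 ⟨p, hp, rfl⟩)) h₂ (by
      rintro _ ⟨p, hp, rfl⟩ hyp hmin
      rw [← sign_eq_neg_one_iff, ← hsign p hp, sign_eq_neg_one_iff]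
      refine (hR₁.strictMono p₁ ((hyz p hp).1.2 hyp) fun c h1 h2 => hd₁ c ?_).trans_le h₁
      refine hdown c h2.le fun r hr hzr => lt_of_le_of_lt ?_ h1
      have h3 := hmin r.2 ⟨r, hr, rfl⟩ ((hyz r hr).1.1 hzr)
      by_contra! h4
      exact h3.not_gt ((hiso r hr p hp).1.1 h4))
  have hpos : SamePos M y₀ z₀ := by
    intro p hp
    have h1 := hup y₀ hy₀ (fun p hp => hyc p.1 ⟨p, hp, rfl⟩) p hp
    have h2 := hdown' z₀ hz₀ (fun p hp => hzc p.2 ⟨p, hp, rfl⟩) p hp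
    have h3 := hyz p hp
    rw [h1.1, h1.2, ← h3.1, ← h3.2, h2.1, h2.2]
    exact ⟨Iff.rfl, Iff.rfl⟩
  obtain ⟨h1, h2⟩ := hroot y₀ z₀ hy0 hz0 hpos
  have h3 : y₀ = y := le_antisymm (h1.2 hz₀) hy₀
  have h4 : z₀ = z := le_antisymm hz₀ (h2.1 hy₀)
  exact ⟨h3 ▸ hy0, h4 ▸ hz0⟩

theorem SamePos.sign_eq_of_increasing (hR₁ : PolyIVT R₁) (hR₂ : PolyIVT R₂) (hfin : M.Finite)
    (hiso : ∀ p ∈ M, SamePos M p.1 p.2)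
    (p₁ : R₁[X]) (p₂ : R₂[X]) {y : R₁} {z : R₂} (hyz : SamePos M y z) (hyM : (y, z) ∉ M)
    (hsign : ∀ p ∈ M, SignType.sign (p₁.eval p.1) = SignType.sign (p₂.eval p.2))
    (hd₁ : ∀ x, SamePos M x z → 0 < p₁.derivative.eval x)
    (hd₂ : ∀ w, SamePos M y w → 0 < p₂.derivative.eval w)
    (hroot : ∀ y₀ z₀, p₁.eval y₀ = 0 → p₂.eval z₀ = 0 → SamePos M y₀ z₀ →
      (y₀ ≤ y ↔ z₀ ≤ z) ∧ (y ≤ y₀ ↔ z ≤ z₀)) :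
    SignType.sign (p₁.eval y) = SignType.sign (p₂.eval z) := by
  have h1 := hyz.eq_zero_of_increasing hR₁ hR₂ hfin hiso p₁ p₂ hyM hsign hd₁ hd₂ hroot
  have h2 := hyz.swap.eq_zero_of_increasing hR₂ hR₁ (hfin.image _) (by
      rintro _ ⟨p, hp, rfl⟩
      exact (hiso p hp).swap) p₂ p₁ (by
      rintro ⟨p, hp, h⟩
      rw [Prod.swap_eq_iff_eq_swap] at h
      rw [h] at hp
      exact hyM hp) (by
      rintro _ ⟨p, hp, rfl⟩
      exact (hsign p hp).symm) (fun w hw => hd₂ w (samePos_swap.1 hw))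
      (fun w hw => hd₁ w (samePos_swap.1 hw))
      (fun z₀ y₀ hz hy h => by
        have := hroot y₀ z₀ hy hz (samePos_swap.1 h)
        exact ⟨this.1.symm, this.2.symm⟩)
  rw [sign_eq_sign_iff]
  rcases lt_trichotomy (p₁.eval y) 0 with h3 | h3 | h3 <;>
  rcases lt_trichotomy (p₂.eval z) 0 with h4 | h4 | h4
  · simp [h3, h4, h3.not_gt, h4.not_gt]
  · exact absurd (h1 h3.le h4.ge).1 h3.ne
  · exact absurd (h1 h3.le h4.le).1 h3.ne
  · exact absurd (h2 h4.le h3.ge).1 h4.ne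
  · simp [h3, h4]
  · exact absurd (h1 h3.le h4.le).2 h4.ne'
  · exact absurd (h2 h4.le h3.le).1 h4.ne
  · exact absurd (h2 h4.le h3.le).2 h3.ne'
  · simp [h3, h4, h3.not_gt, h4.not_gt]

theorem SignMatched.exists_insert (hR₁ : PolyIVT R₁) (hR₂ : PolyIVT R₂) (h : SignMatched Q M)
    (p₁ : R₁[X]) (p₂ : R₂[X])
    (hsign : ∀ p ∈ M, SignType.sign (p₁.eval p.1) = SignType.sign (p₂.eval p.2))
    (hmem : (derivative p₁, derivative p₂) ∈ Q) (hd₁ : derivative p₁ ≠ 0)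
    (hd₂ : derivative p₂ ≠ 0) : ∃ M', SignMatched (insert (p₁, p₂) Q) M' := by
  set N : Set (R₁ × R₂) := {p | p₁.eval p.1 = 0 ∧ p₂.eval p.2 = 0 ∧ SamePos M p.1 p.2} with hN
  have hp₁ : p₁ ≠ 0 := by rintro rfl; simp at hd₁
  have hp₂ : p₂ ≠ 0 := by rintro rfl; simp at hd₂
  have hNfin : N.Finite := by
    refine ((p₁.roots.toFinset ×ˢ p₂.roots.toFinset).finite_toSet).subset fun p hp => ?_
    simp [hp₁, hp₂, hp.1, hp.2.1]
  have hlt : ∀ p ∈ N, ∀ r ∈ N, p.1 < r.1 → p.2 < r.2 := by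
    rintro p ⟨hp1, hp2, hp3⟩ r ⟨hr1, hr2, hr3⟩ hlt
    obtain ⟨c, h1, h2, h3⟩ := hR₁.rolle p₁ hlt hp1 hr1
    obtain ⟨w, hw⟩ := exists_samePos h.finite h.iso c
    have hcw := h.mem_of_root hmem hd₁ h3 hw
    exact ((hp3 _ hcw).2.1 h1).trans ((hr3 _ hcw).1.1 h2)
  have hlt' : ∀ p ∈ N, ∀ r ∈ N, p.2 < r.2 → p.1 < r.1 := by
    rintro p ⟨hp1, hp2, hp3⟩ r ⟨hr1, hr2, hr3⟩ hlt
    obtain ⟨c, h1, h2, h3⟩ := hR₂.rolle p₂ hlt hp2 hr2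
    obtain ⟨x, hx⟩ := exists_samePos' h.finite h.iso c
    have hcx := h.mem_of_root hmem hd₁ ((eq_zero_iff_of_sign_eq (h.sign x c hx _ hmem)).2 h3) hx
    exact ((hp3 _ hcx).2.2 h1).trans ((hr3 _ hcx).1.2 h2)
  have hpos : ∀ p ∈ M ∪ N, SamePos M p.1 p.2 := by
    rintro p (hp | hp)
    · exact h.iso p hp
    · exact hp.2.2
  have hiso : ∀ p ∈ M ∪ N, ∀ r ∈ M ∪ N, p.1 < r.1 ↔ p.2 < r.2 := by
    intro p hp r hr
    rcases hp with hpM | hpN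
    · exact (hpos r hr p hpM).1
    · rcases hr with hrM | hrN
      · exact (hpos p (.inr hpN) r hrM).2
      · exact ⟨hlt p hpN r hrN, hlt' p hpN r hrN⟩
  refine ⟨M ∪ N, h.finite.union hNfin, fun p hp r hr => ⟨hiso r hr p hp, hiso p hp r hr⟩, ?_⟩
  intro y z hyz q hq
  have hyzM : SamePos M y z := hyz.mono Set.subset_union_left
  rcases hq with rfl | hq
  swap
  · exact h.sign y z hyzM q hq
  by_cases hyM : (y, z) ∈ M
  · exact hsign _ hyM
  have hne : (derivative p₁).eval y ≠ 0 := fun h0 => hyM (h.mem_of_root hmem hd₁ h0 hyzM)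
  have hs := h.sign y z hyzM _ hmem
  have hroot : ∀ y₀ z₀, p₁.eval y₀ = 0 → p₂.eval z₀ = 0 → SamePos M y₀ z₀ →
      (y₀ ≤ y ↔ z₀ ≤ z) ∧ (y ≤ y₀ ↔ z ≤ z₀) := by
    intro y₀ z₀ h1 h2 h3
    have h4 := hyz (y₀, z₀) (.inr ⟨h1, h2, h3⟩)
    simp only [← not_lt, h4.1, h4.2, and_self]
  rcases lt_or_gt_of_ne hne with h1 | h1
  · have h2 := (sign_eq_sign_iff.1 hs).2.1 h1
    have := hyzM.sign_eq_of_increasing hR₁ hR₂ h.finite h.iso (-p₁) (-p₂) hyM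
      (fun p hp => by simp only [eval_neg, Left.sign_neg, hsign p hp])
      (fun x hx => by
        simp only [derivative_neg, eval_neg, Left.neg_pos_iff]
        exact (sign_eq_sign_iff.1 (h.sign x z hx _ hmem)).2.2 h2)
      (fun w hw => by
        simp only [derivative_neg, eval_neg, Left.neg_pos_iff]
        exact (sign_eq_sign_iff.1 (h.sign y w hw _ hmem)).2.1 h1)
      (fun y₀ z₀ h1 h2 h3 => hroot y₀ z₀ (by simpa using h1) (by simpa using h2) h3)
    simpa only [eval_neg, Left.sign_neg, neg_inj] using this
  · have h2 := (sign_eq_sign_iff.1 hs).1.1 h1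
    exact hyzM.sign_eq_of_increasing hR₁ hR₂ h.finite h.iso p₁ p₂ hyM hsign
      (fun x hx => (sign_eq_sign_iff.1 (h.sign x z hx _ hmem)).1.2 h2)
      (fun w hw => (sign_eq_sign_iff.1 (h.sign y w hw _ hmem)).1.1 h1) hroot

end SignMatching

section QuantifierElimination

open Polynomial

theorem derivative_map_ne_zero_of_leadingCoeff {A S : Type*} [CommRing A] [Field S] [CharZero S]
    (φ : A →+* S) {p : A[X]} (hφ : φ p.leadingCoeff ≠ 0) (hdeg : p.natDegree ≠ 0) :
    derivative (p.map φ) ≠ 0 := by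
  intro h0
  have h1 : (p.map φ).natDegree = p.natDegree := natDegree_map_of_leadingCoeff_ne_zero _ hφ
  have h2 := derivative_eq_zero.1 h0
  exact hdeg (h1.symm.trans h2)

variable {A R₁ R₂ : Type*} [CommRing A] [Field R₁] [LinearOrder R₁] [IsStrictOrderedRing R₁]
  [Field R₂] [LinearOrder R₂] [IsStrictOrderedRing R₂]

/-- The ring homomorphisms `φ₁` and `φ₂` give the same signs on `B`. -/
def SameSigns (φ₁ : A →+* R₁) (φ₂ : A →+* R₂) (B : Set A) : Prop :=
  ∀ b ∈ B, SignType.sign (φ₁ b) = SignType.sign (φ₂ b)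

theorem SameSigns.mono {φ₁ : A →+* R₁} {φ₂ : A →+* R₂} {B B' : Set A} (h : SameSigns φ₁ φ₂ B)
    (hB : B' ⊆ B) : SameSigns φ₁ φ₂ B' := fun b hb => h b (hB hb)

theorem SameSigns.eq_zero_iff {φ₁ : A →+* R₁} {φ₂ : A →+* R₂} {B : Set A}
    (h : SameSigns φ₁ φ₂ B) {b : A} (hb : b ∈ B) : φ₁ b = 0 ↔ φ₂ b = 0 :=
  eq_zero_iff_of_sign_eq (h b hb)

theorem SameSigns.map_eq_zero_iff {φ₁ : A →+* R₁} {φ₂ : A →+* R₂} {B : Set A}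
    (h : SameSigns φ₁ φ₂ B) {q : A[X]} (hq : ∀ i, q.coeff i ∈ B) :
    q.map φ₁ = 0 ↔ q.map φ₂ = 0 := by
  simp only [Polynomial.ext_iff, coeff_map, coeff_zero]
  exact forall_congr' fun i => h.eq_zero_iff (hq i)

theorem exists_pseudo_remainder (q : A[X]) (hq : q ≠ 0) (n : ℕ) : ∀ p : A[X], p.natDegree < n →
    ∃ (k : ℕ) (s r : A[X]), C (q.leadingCoeff ^ k) * p = s * q + r ∧ r.degree < q.degree := by
  induction n with
  | zero => intro p hp; omega
  | succ n ih =>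
    intro p hp
    by_cases hlt : p.degree < q.degree
    · exact ⟨0, 0, p, by simp, hlt⟩
    push Not at hlt
    have hle : q.natDegree ≤ p.natDegree := natDegree_le_natDegree hlt
    have hp0 : p ≠ 0 := by
      rintro rfl
      exact hq (by simpa using hlt)
    set t : A[X] := C (p.leadingCoeff) * X ^ (p.natDegree - q.natDegree) with ht
    set p' := C q.leadingCoeff * p - t * q with hp'
    have hdeg : p'.natDegree < p.natDegree ∨ p' = 0 := by
      by_cases h0 : p' = 0
      · exact .inr h0
      left
      have h1 : p'.natDegree ≤ p.natDegree := by
        refine (natDegree_sub_le _ _).trans (max_le (natDegree_C_mul_le _ _) ?_)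
        refine natDegree_mul_le.trans ?_
        have := natDegree_C_mul_X_pow_le p.leadingCoeff (p.natDegree - q.natDegree)
        rw [← ht] at this
        omega
      refine lt_of_le_of_ne h1 fun h2 => ?_
      have h3 : p'.coeff p.natDegree = 0 := by
        rw [hp', coeff_sub, coeff_C_mul, ht, mul_assoc, coeff_C_mul]
        conv_lhs => rw [show X ^ (p.natDegree - q.natDegree) * q = q * X ^ (p.natDegree - q.natDegree)
          from mul_comm _ _]
        rw [coeff_mul_X_pow', if_pos (Nat.sub_le _ _), Nat.sub_sub_self hle, coeff_natDegree,
          coeff_natDegree]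
        ring
      rw [← h2, coeff_natDegree, leadingCoeff_eq_zero] at h3
      exact h0 h3
    rcases hdeg with hdeg | hdeg
    · obtain ⟨k, s, r, h1, h2⟩ := ih p' (by omega)
      refine ⟨k + 1, s + C (q.leadingCoeff ^ k) * t, r, ?_, h2⟩
      have h3 : C (q.leadingCoeff ^ k) * (C q.leadingCoeff * p - t * q) = s * q + r := h1
      rw [pow_succ, C_mul]
      linear_combination h3
    · refine ⟨1, t, 0, ?_, ?_⟩
      · rw [pow_one]
        linear_combination hdeg
      · rw [degree_zero, bot_lt_iff_ne_bot]
        simpa using hq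

theorem map_eraseLead_of_eq_zero {S : Type*} [CommRing S] (φ : A →+* S) {q : A[X]}
    (h : φ q.leadingCoeff = 0) : q.eraseLead.map φ = q.map φ := by
  conv_rhs => rw [← eraseLead_add_C_mul_X_pow q]
  rw [Polynomial.map_add, Polynomial.map_mul, map_C, h, C_0, zero_mul, add_zero]

variable (R₂) in
/-- At roots of `q`, the sign of `p` is the sign of a polynomial of smaller degree than `q`. -/
theorem exists_sign_remainder (φ₁ : A →+* R₁) (p : A[X]) (n : ℕ) : ∀ q : A[X], q.natDegree < n →
    q.map φ₁ ≠ 0 → ∃ (B : Set A) (r : A[X]), B.Finite ∧ r.degree < q.degree ∧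
      ∀ φ₂ : A →+* R₂, SameSigns φ₁ φ₂ B → ∀ (a : R₁) (b : R₂), (q.map φ₁).eval a = 0 →
        (q.map φ₂).eval b = 0 →
          SignType.sign ((p.map φ₁).eval a) = SignType.sign ((r.map φ₁).eval a) ∧
          SignType.sign ((p.map φ₂).eval b) = SignType.sign ((r.map φ₂).eval b) := by
  induction n with
  | zero => intro q hq; omega
  | succ n ih =>
    intro q hqn hq
    have hq0 : q ≠ 0 := by rintro rfl; simp at hq
    by_cases hlc : φ₁ q.leadingCoeff = 0
    · have hmap : q.eraseLead.map φ₁ = q.map φ₁ := map_eraseLead_of_eq_zero φ₁ hlc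
      by_cases hd : q.natDegree = 0
      · exfalso
        apply hq
        rw [eq_C_of_natDegree_eq_zero hd, map_C]
        rw [leadingCoeff, hd] at hlc
        rw [hlc, C_0]
      have hlt : q.eraseLead.natDegree < n := by
        have := eraseLead_natDegree_le q
        omega
      obtain ⟨B, r, hB, hr, h⟩ := ih q.eraseLead hlt (by rwa [hmap])
      refine ⟨insert q.leadingCoeff B, r, hB.insert _, hr.trans (degree_eraseLead_lt hq0), ?_⟩
      intro φ₂ hφ a b ha hb
      have hlc₂ : φ₂ q.leadingCoeff = 0 := (hφ.eq_zero_iff (Set.mem_insert _ _)).1 hlc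
      have hmap₂ : q.eraseLead.map φ₂ = q.map φ₂ := map_eraseLead_of_eq_zero φ₂ hlc₂
      exact h φ₂ (hφ.mono (Set.subset_insert _ _)) a b (by rwa [hmap]) (by rwa [hmap₂])
    · obtain ⟨k, s, r, h1, h2⟩ := exists_pseudo_remainder q hq0 _ p (Nat.lt_succ_self _)
      refine ⟨{q.leadingCoeff}, C (q.leadingCoeff ^ k) * r, Set.finite_singleton _,
        by
        refine lt_of_le_of_lt ?_ h2
        rw [← smul_eq_C_mul]
        exact degree_smul_le _ _, ?_⟩
      intro φ₂ hφ a b ha hb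
      have hlc₂ : φ₂ q.leadingCoeff ≠ 0 := mt (hφ.eq_zero_iff rfl).2 hlc
      have key : C (q.leadingCoeff ^ k) * r =
          C (q.leadingCoeff ^ k * q.leadingCoeff ^ k) * p - C (q.leadingCoeff ^ k) * s * q := by
        rw [C_mul]
        linear_combination (-C (q.leadingCoeff ^ k)) * h1
      constructor
      · rw [key]
        simp only [Polynomial.map_sub, Polynomial.map_mul, map_C, eval_sub, eval_mul, eval_C, ha,
          mul_zero, sub_zero, sign_mul]
        have : SignType.sign (φ₁ (q.leadingCoeff ^ k * q.leadingCoeff ^ k)) = 1 := by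
          rw [map_mul, map_pow, sign_pos (mul_self_pos.2 (pow_ne_zero _ hlc))]
        rw [this, one_mul]
      · rw [key]
        simp only [Polynomial.map_sub, Polynomial.map_mul, map_C, eval_sub, eval_mul, eval_C, hb,
          mul_zero, sub_zero, sign_mul]
        have : SignType.sign (φ₂ (q.leadingCoeff ^ k * q.leadingCoeff ^ k)) = 1 := by
          rw [map_mul, map_pow, sign_pos (mul_self_pos.2 (pow_ne_zero _ hlc₂))]
        rw [this, one_mul]

variable (R₂) in
/-- The signs of `Q` along the real line over `R₁` are determined by finitely many signs. -/
def SignDetermined (φ₁ : A →+* R₁) (Q : Set A[X]) : Prop :=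
  ∃ B : Set A, B.Finite ∧ ∀ φ₂ : A →+* R₂, SameSigns φ₁ φ₂ B →
    ∃ M, SignMatched ((fun q : A[X] => (q.map φ₁, q.map φ₂)) '' Q) M

theorem SignDetermined.insert_of_map_ne_zero (hR₁ : PolyIVT R₁) (hR₂ : PolyIVT R₂)
    (φ₁ : A →+* R₁) (Q : Set A[X]) (hQ : Q.Finite) (p : A[X]) (hp' : derivative p ∈ Q)
    (hlc : φ₁ p.leadingCoeff ≠ 0) (hdeg : p.natDegree ≠ 0) (r : A[X] → A[X])
    (B : A[X] → Set A) (hB : ∀ q, (B q).Finite)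
    (hr : ∀ q, q.map φ₁ ≠ 0 → ∀ φ₂ : A →+* R₂, SameSigns φ₁ φ₂ (B q) → ∀ (a : R₁) (b : R₂),
      (q.map φ₁).eval a = 0 → (q.map φ₂).eval b = 0 →
          SignType.sign ((p.map φ₁).eval a) = SignType.sign (((r q).map φ₁).eval a) ∧
          SignType.sign ((p.map φ₂).eval b) = SignType.sign (((r q).map φ₂).eval b))
    (h : SignDetermined R₂ φ₁ (Q ∪ r '' Q)) : SignDetermined R₂ φ₁ (insert p Q) := by
  obtain ⟨B₀, hB₀, h⟩ := h
  refine ⟨insert p.leadingCoeff (B₀ ∪ ⋃ q ∈ Q, (Set.range q.coeff ∪ B q)),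
    (hB₀.union (hQ.biUnion fun q _ => (finite_range_coeff q).union (hB q))).insert _, ?_⟩
  intro φ₂ hφ
  have hlc₂ : φ₂ p.leadingCoeff ≠ 0 := mt (hφ.eq_zero_iff (Set.mem_insert _ _)).2 hlc
  have hφ' := hφ.mono (Set.subset_insert _ _)
  obtain ⟨M, hM⟩ := h φ₂ (hφ'.mono Set.subset_union_left)
  have hQφ : ∀ q ∈ Q, SameSigns φ₁ φ₂ (Set.range q.coeff ∪ B q) := fun q hq =>
    (hφ'.mono Set.subset_union_right).mono (Set.subset_biUnion_of_mem (u := fun q =>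
      Set.range (Polynomial.coeff q) ∪ B q) hq)
  set F := fun q : A[X] => (q.map φ₁, q.map φ₂) with hF
  have hM₁ := hM.restrict hR₂ (Q₀ := F '' Q) (Set.image_mono Set.subset_union_left) (by
    rintro _ ⟨q, hq, rfl⟩
    exact (hQφ q hq).map_eq_zero_iff fun i => .inl ⟨i, rfl⟩)
  obtain ⟨M', hM'⟩ := hM₁.exists_insert hR₁ hR₂ (p.map φ₁) (p.map φ₂) (by
    rintro x ⟨hx, _, ⟨q, hq, rfl⟩, hq0, hxq⟩
    have hs := hM.sign x.1 x.2 (hM.iso x hx)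
    have hxq₂ : (q.map φ₂).eval x.2 = 0 :=
      (eq_zero_iff_of_sign_eq (hs (F q) ⟨q, .inl hq, rfl⟩)).1 hxq
    obtain ⟨h1, h2⟩ := hr q hq0 φ₂ ((hQφ q hq).mono Set.subset_union_right) x.1 x.2 hxq hxq₂
    rw [h1, h2]
    exact hs (F (r q)) ⟨r q, .inr ⟨q, hq, rfl⟩, rfl⟩)
    ⟨derivative p, hp', by simp [hF, derivative_map]⟩ 
    (derivative_map_ne_zero_of_leadingCoeff φ₁ hlc hdeg)
    (derivative_map_ne_zero_of_leadingCoeff φ₂ hlc₂ hdeg)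
  exact ⟨M', by rwa [Set.image_insert_eq]⟩

theorem SignDetermined.mono {φ₁ : A →+* R₁} {Q Q' : Set A[X]} (h : SignDetermined R₂ φ₁ Q)
    (hQ : Q' ⊆ Q) : SignDetermined R₂ φ₁ Q' := by
  obtain ⟨B, hB, h⟩ := h
  refine ⟨B, hB, fun φ₂ hφ => ?_⟩
  obtain ⟨M, hM⟩ := h φ₂ hφ
  exact ⟨M, hM.finite, hM.iso, fun y z hyz q hq => hM.sign y z hyz q (Set.image_mono hQ hq)⟩

theorem SignDetermined.insert_of_leadingCoeff (φ₁ : A →+* R₁) (Q : Set A[X]) (p : A[X])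
    (hlc : φ₁ p.leadingCoeff = 0) (h : SignDetermined R₂ φ₁ (insert p.eraseLead Q)) :
    SignDetermined R₂ φ₁ (insert p Q) := by
  obtain ⟨B, hB, h⟩ := h
  refine ⟨insert p.leadingCoeff B, hB.insert _, fun φ₂ hφ => ?_⟩
  have hlc₂ : φ₂ p.leadingCoeff = 0 := (hφ.eq_zero_iff (Set.mem_insert _ _)).1 hlc
  obtain ⟨M, hM⟩ := h φ₂ (hφ.mono (Set.subset_insert _ _))
  refine ⟨M, ?_⟩
  rw [Set.image_insert_eq, map_eraseLead_of_eq_zero φ₁ hlc, map_eraseLead_of_eq_zero φ₂ hlc₂] at hM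
  rwa [Set.image_insert_eq]

theorem SignDetermined.insert_C (φ₁ : A →+* R₁) (Q : Set A[X]) (c : A)
    (h : SignDetermined R₂ φ₁ Q) : SignDetermined R₂ φ₁ (insert (C c) Q) := by
  obtain ⟨B, hB, h⟩ := h
  refine ⟨insert c B, hB.insert _, fun φ₂ hφ => ?_⟩
  obtain ⟨M, hM⟩ := h φ₂ (hφ.mono (Set.subset_insert _ _))
  refine ⟨M, hM.finite, hM.iso, fun y z hyz q hq => ?_⟩
  rw [Set.image_insert_eq] at hq
  rcases hq with rfl | hq
  · simpa using hφ c (Set.mem_insert _ _)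
  · exact hM.sign y z hyz q hq

theorem signDetermined_of_degree_lt (hR₁ : PolyIVT R₁) (hR₂ : PolyIVT R₂) (φ₁ : A →+* R₁) (d : ℕ) :
    ∀ Q : Set A[X], Q.Finite → (∀ q ∈ Q, q.degree < d) → SignDetermined R₂ φ₁ Q := by
  induction d with
  | zero =>
    intro Q _ hQ
    refine ⟨∅, Set.finite_empty, fun φ₂ _ => ⟨∅, Set.finite_empty, by simp, ?_⟩⟩
    rintro y z - _ ⟨q, hq, rfl⟩
    have : q = 0 := by simpa [Nat.WithBot.lt_zero_iff] using hQ q hq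
    simp [this]
  | succ d ihd =>
    have main : ∀ H : Set A[X], H.Finite → (∀ q ∈ H, q.degree < (d + 1 : ℕ)) →
        ∀ L : Set A[X], L.Finite → (∀ q ∈ L, q.degree < d) → SignDetermined R₂ φ₁ (L ∪ H) := by
      intro H hH
      induction H, hH using Set.Finite.induction_on with
      | empty =>
        intro _ L hL hLd
        rw [Set.union_empty]
        exact ihd L hL hLd
      | @insert p H hpH hH ih =>
        intro hHd L hL hLd
        have ih' := ih fun q hq => hHd q (Set.mem_insert_of_mem _ hq)
        have hpd := hHd p (Set.mem_insert _ _)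
        have key : ∀ q : A[X], q.degree < d → SignDetermined R₂ φ₁ (insert q (L ∪ H)) := by
          intro q hq
          rw [← Set.insert_union]
          exact ih' _ (hL.insert q) (by
            rintro q' (rfl | hq')
            exacts [hq, hLd q' hq'])
        rw [Set.union_insert]
        by_cases hpd' : p.degree < d
        · exact key p hpd'
        have hp0 : p ≠ 0 := by
          rintro rfl
          exact hpd' (by simp)
        have hlt : ∀ q : A[X], q.degree < p.degree → q.degree < d := by
          intro q hq
          rw [degree_eq_natDegree hp0] at hq hpd
          have : p.natDegree ≤ d := by
            have := Nat.cast_lt.1 hpd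
            omega
          exact hq.trans_le (Nat.cast_le.2 this)
        by_cases hlc : φ₁ p.leadingCoeff = 0
        · exact SignDetermined.insert_of_leadingCoeff φ₁ _ p hlc
            (key _ (hlt _ (degree_eraseLead_lt hp0)))
        by_cases hdeg : p.natDegree = 0
        · rw [eq_C_of_natDegree_eq_zero hdeg]
          exact SignDetermined.insert_C φ₁ _ _ (ih' L hL hLd)
        have hder : (derivative p).degree < d := hlt _ (degree_derivative_lt hp0)
        have hrem : ∀ q : A[X], ∃ (B : Set A) (r : A[X]), B.Finite ∧
            (q.degree < (d + 1 : ℕ) → r.degree < d) ∧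
            (q.map φ₁ ≠ 0 → ∀ φ₂ : A →+* R₂, SameSigns φ₁ φ₂ B → ∀ (a : R₁) (b : R₂),
              (q.map φ₁).eval a = 0 → (q.map φ₂).eval b = 0 →
              SignType.sign ((p.map φ₁).eval a) = SignType.sign ((r.map φ₁).eval a) ∧
              SignType.sign ((p.map φ₂).eval b) = SignType.sign ((r.map φ₂).eval b)) := by
          intro q
          by_cases hq : q.map φ₁ = 0
          · exact ⟨∅, 0, Set.finite_empty, fun _ => by simp, fun h => absurd hq h⟩
          · obtain ⟨B, r, hB, hr, h⟩ := exists_sign_remainder R₂ φ₁ p _ q (Nat.lt_succ_self _) hq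
            have hq0 : q ≠ 0 := by rintro rfl; simp at hq
            refine ⟨B, r, hB, fun hqd => hr.trans_le ?_, fun _ => h⟩
            rw [degree_eq_natDegree hq0] at hqd ⊢
            exact Nat.cast_le.2 (Nat.lt_succ_iff.1 (Nat.cast_lt.1 hqd))
        choose B r hB hrd hr using hrem
        set Q₁ := insert (derivative p) (L ∪ H) with hQ₁
        have hQ₁fin : Q₁.Finite := (hL.union hH).insert _
        have hsucc : (d : WithBot ℕ) < (d + 1 : ℕ) := Nat.cast_lt.2 (Nat.lt_succ_self d)
        have hQ₁d : ∀ q ∈ Q₁, q.degree < (d + 1 : ℕ) := by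
          rintro q (rfl | hq | hq)
          exacts [hder.trans hsucc, (hLd q hq).trans hsucc, hHd q (Set.mem_insert_of_mem _ hq)]
        have h₁ : SignDetermined R₂ φ₁ (insert p Q₁) := by
          refine SignDetermined.insert_of_map_ne_zero hR₁ hR₂ φ₁ Q₁ hQ₁fin p (Set.mem_insert _ _)
            hlc hdeg r B hB hr ?_
          refine (ih' (insert (derivative p) L ∪ r '' Q₁) ((hL.insert _).union (hQ₁fin.image _))
            ?_).mono ?_
          · rintro _ ((rfl | hq) | ⟨q, hq, rfl⟩)
            exacts [hder, hLd _ hq, hrd q (hQ₁d q hq)]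
          · rintro q ((rfl | hq | hq) | hq)
            exacts [.inl (.inl (.inl rfl)), .inl (.inl (.inr hq)), .inr hq, .inl (.inr hq)]
        exact h₁.mono (Set.insert_subset_insert (Set.subset_insert _ _))
    intro Q hQ hQd
    simpa using main Q hQ hQd ∅ Set.finite_empty (by simp)

/-- One-variable sign transfer with parameters between fields with the intermediate value
property for polynomials. -/
theorem exists_sign_transfer (hR₁ : PolyIVT R₁) (hR₂ : PolyIVT R₂) (φ₁ : A →+* R₁)
    (Q : Set A[X]) (hQ : Q.Finite) : ∃ B : Set A, B.Finite ∧ ∀ φ₂ : A →+* R₂,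
      SameSigns φ₁ φ₂ B → ∀ y : R₁, ∃ z : R₂, ∀ q ∈ Q,
        SignType.sign ((q.map φ₁).eval y) = SignType.sign ((q.map φ₂).eval z) := by
  obtain ⟨d, hd⟩ : ∃ d : ℕ, ∀ q ∈ Q, q.degree < d := by
    obtain ⟨d, hd⟩ := (hQ.image natDegree).bddAbove
    refine ⟨d + 1, fun q hq => degree_le_natDegree.trans_lt (Nat.cast_lt.2 ?_)⟩
    exact Nat.lt_succ_of_le (hd ⟨q, hq, rfl⟩)
  obtain ⟨B, hB, h⟩ := signDetermined_of_degree_lt hR₁ hR₂ φ₁ d Q hQ hd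
  refine ⟨B, hB, fun φ₂ hφ y => ?_⟩
  obtain ⟨M, hM⟩ := h φ₂ hφ
  obtain ⟨z, hz⟩ := exists_samePos hM.finite hM.iso y
  exact ⟨z, fun q hq => hM.sign y z hz _ ⟨q, hq, rfl⟩⟩

end QuantifierElimination

section ArtinLang

theorem RingHom.sign_map_real {R : Type*} [Field R] [LinearOrder R] [IsStrictOrderedRing R]
    (φ : ℝ →+* R) (x : ℝ) : SignType.sign (φ x) = SignType.sign x := by
  have hpos : ∀ y : ℝ, 0 < y → 0 < φ y := by
    intro y hy
    rw [← Real.mul_self_sqrt hy.le, map_mul]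
    exact mul_self_pos.2 ((map_ne_zero φ).2 (Real.sqrt_pos.2 hy).ne')
  rcases lt_trichotomy x 0 with h | rfl | h
  · have := hpos (-x) (neg_pos.2 h)
    rw [map_neg, neg_pos] at this
    rw [sign_neg h, sign_neg this]
  · simp
  · rw [sign_pos h, sign_pos (hpos x h)]

variable {R : Type*} [Field R] [LinearOrder R] [IsStrictOrderedRing R]

theorem MvPolynomial.eval₂_eq_eval_map_finSuccEquiv {S T : Type*} [CommRing S] [CommRing T] {q : ℕ}
    (φ : S →+* T) (y : Fin (q + 1) → T) (b : MvPolynomial (Fin (q + 1)) S) :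
    MvPolynomial.eval₂ φ y b = ((MvPolynomial.finSuccEquiv S q b).map
      (MvPolynomial.eval₂Hom φ fun i : Fin q => y i.succ)).eval (y 0) := by
  have : MvPolynomial.eval₂Hom φ y = ((Polynomial.evalRingHom (y 0)).comp
      (Polynomial.mapRingHom (MvPolynomial.eval₂Hom φ fun i : Fin q => y i.succ))).comp
      ((MvPolynomial.finSuccEquiv S q).toAlgHom.toRingHom) := by
    apply MvPolynomial.ringHom_ext
    · intro r
      simp [MvPolynomial.finSuccEquiv_apply]
    · intro i
      refine Fin.cases ?_ (fun j => ?_) i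
      · simp [MvPolynomial.finSuccEquiv_X_zero]
      · simp [MvPolynomial.finSuccEquiv_X_succ]
  exact RingHom.congr_fun this b

theorem PolyIVT.exists_real_point (hR : PolyIVT R) (φ : ℝ →+* R) (q : ℕ) :
    ∀ (y : Fin q → R) (B : Set (MvPolynomial (Fin q) ℝ)), B.Finite → ∃ z : Fin q → ℝ, ∀ b ∈ B,
      SignType.sign (MvPolynomial.eval₂ φ y b) = SignType.sign (MvPolynomial.eval z b) := by
  induction q with
  | zero =>
    intro y B hB
    refine ⟨Fin.elim0, fun b _ => ?_⟩
    rw [MvPolynomial.eq_C_of_isEmpty b, MvPolynomial.eval₂_C, MvPolynomial.eval_C,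
      RingHom.sign_map_real]
  | succ q ih =>
    intro y B hB
    obtain ⟨B', hB', h⟩ := exists_sign_transfer hR polyIVT_real
      (MvPolynomial.eval₂Hom φ fun i => y i.succ) (MvPolynomial.finSuccEquiv ℝ q '' B)
      (hB.image _)
    obtain ⟨z', hz'⟩ := ih (fun i => y i.succ) B' hB'
    obtain ⟨z₀, hz₀⟩ := h (MvPolynomial.eval z') hz' (y 0)
    refine ⟨Fin.cons z₀ z', fun b hb => ?_⟩
    rw [MvPolynomial.eval₂_eq_eval_map_finSuccEquiv, hz₀ _ ⟨b, hb, rfl⟩,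
      ← MvPolynomial.eval_eq_eval_mv_eval']

/-- A form of the Artin–Lang homomorphism theorem. -/
theorem exists_real_specialization {K : Type u} [Field K] [LinearOrder K] [IsStrictOrderedRing K]
    [Algebra ℝ K] {ι : Type*} [Finite ι] (y : ι → K) : ∃ z : ι → ℝ, (∀ i, 0 ≤ y i → 0 ≤ z i) ∧
      ∀ p : MvPolynomial ι ℝ, MvPolynomial.aeval y p = 0 → MvPolynomial.aeval z p = 0 := by
  classical
  obtain ⟨R, _, _, _, φ, hφ, hR⟩ := exists_polyIVT_extension K
  obtain ⟨q, ⟨e⟩⟩ := Finite.exists_equiv_fin ι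
  have hnoeth : IsNoetherianRing (MvPolynomial ι ℝ) := inferInstance
  obtain ⟨G, hG⟩ := hnoeth.noetherian
    (RingHom.ker (MvPolynomial.aeval y : MvPolynomial ι ℝ →ₐ[ℝ] K))
  set Φ : ℝ →+* R := φ.comp (algebraMap ℝ K)
  obtain ⟨z, hz⟩ := hR.exists_real_point Φ q (fun i => φ (y (e.symm i)))
    ((MvPolynomial.rename e '' (G : Set (MvPolynomial ι ℝ))) ∪ Set.range MvPolynomial.X)
    ((G.finite_toSet.image _).union (Set.finite_range _))
  refine ⟨fun i => z (e i), fun i hi => ?_, fun p hp => ?_⟩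
  · have h1 := hz (MvPolynomial.X (e i)) (.inr ⟨_, rfl⟩)
    rw [MvPolynomial.eval₂_X, MvPolynomial.eval_X, Equiv.symm_apply_apply] at h1
    by_contra hneg
    rw [not_le] at hneg
    have h2 := (sign_eq_sign_iff.1 h1).2.2 hneg
    have h3 := hφ.monotone hi
    rw [map_zero] at h3
    exact absurd h2 (not_lt.2 h3)
  · have hmem : p ∈ Submodule.span (MvPolynomial ι ℝ) (G : Set (MvPolynomial ι ℝ)) := by
      rw [hG]
      exact hp
    have hle : Submodule.span (MvPolynomial ι ℝ) (G : Set (MvPolynomial ι ℝ)) ≤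
        RingHom.ker (MvPolynomial.aeval (fun i => z (e i)) : MvPolynomial ι ℝ →ₐ[ℝ] ℝ) := by
      rw [Submodule.span_le]
      intro b hb
      have hb0 : MvPolynomial.aeval y b = 0 := by
        have : b ∈ Submodule.span (MvPolynomial ι ℝ) (G : Set (MvPolynomial ι ℝ)) :=
          Submodule.subset_span hb
        rw [hG] at this
        exact this
      have h1 := hz (MvPolynomial.rename e b) (.inl ⟨b, hb, rfl⟩)
      rw [MvPolynomial.eval₂_rename, MvPolynomial.eval_rename] at h1
      have h2 : MvPolynomial.eval₂ Φ ((fun i => φ (y (e.symm i))) ∘ e) b = 0 := by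
        have : ((fun i => φ (y (e.symm i))) ∘ e) = fun i => φ (y i) := by
          funext i
          simp
        rw [this]
        have h3 := MvPolynomial.hom_eval₂ b (algebraMap ℝ K) φ y
        rw [← MvPolynomial.aeval_def, hb0, map_zero] at h3
        exact h3.symm
      have h4 := (eq_zero_iff_of_sign_eq h1).1 h2
      change MvPolynomial.aeval (fun i => z (e i)) b = 0
      rw [MvPolynomial.aeval_eq_eval]
      exact h4
    exact hle hmem

end ArtinLang

section TraceRing

variable {n g : ℕ}

/-- The subalgebra generated by the traces of words. -/
def traceSubalgebra (n g : ℕ) : Subalgebra ℝ (PolyRing n g) :=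
  Algebra.adjoin ℝ {p | ∃ w ∈ Submonoid.closure (genSet n g), p = Matrix.trace w}

theorem transpose_mem_genSet {w : MatP n g} (hw : w ∈ genSet n g) : wᵀ ∈ genSet n g := by
  rcases hw with ⟨j, rfl⟩ | ⟨j, rfl⟩
  · exact .inr ⟨j, rfl⟩
  · exact .inl ⟨j, by simp⟩

theorem transpose_mem_closure_genSet {w : MatP n g} (hw : w ∈ Submonoid.closure (genSet n g)) :
    wᵀ ∈ Submonoid.closure (genSet n g) := by
  induction hw using Submonoid.closure_induction with
  | mem x hx => exact Submonoid.subset_closure (transpose_mem_genSet hx)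
  | one => simp
  | mul x y _ _ hx hy => rw [transpose_mul]; exact mul_mem hy hx

theorem mem_traceRing_of_mem_closure {w : MatP n g} (hw : w ∈ Submonoid.closure (genSet n g)) :
    w ∈ traceRing n g := by
  have : Submonoid.closure (genSet n g) ≤ (traceRing n g).toSubmonoid :=
    Submonoid.closure_le.2 fun x hx => Algebra.subset_adjoin (.inl hx)
  exact this hw

theorem smul_one_mem_traceRing {p : PolyRing n g} (hp : p ∈ traceSubalgebra n g) :
    p • (1 : MatP n g) ∈ traceRing n g := by
  induction hp using Algebra.adjoin_induction with
  | mem x hx =>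
    obtain ⟨w, hw, rfl⟩ := hx
    exact Algebra.subset_adjoin (.inr ⟨w, hw, rfl⟩)
  | algebraMap r =>
    rw [algebraMap_smul]
    exact Subalgebra.smul_mem _ (one_mem _) r
  | add x y _ _ hx hy => rw [add_smul]; exact add_mem hx hy
  | mul x y _ _ hx hy =>
    have : (x * y) • (1 : MatP n g) = x • (1 : MatP n g) * y • (1 : MatP n g) := by
      rw [smul_mul_smul_comm, one_mul]
    rw [this]; exact mul_mem hx hy

theorem mem_span_of_mem_traceRing {h : MatP n g} (hh : h ∈ traceRing n g) :
    h ∈ Submodule.span (traceSubalgebra n g)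
      (Submonoid.closure (genSet n g) : Set (MatP n g)) := by
  rw [← Algebra.adjoin_eq_span]
  change h ∈ Algebra.adjoin (traceSubalgebra n g) (genSet n g)
  induction hh using Algebra.adjoin_induction with
  | mem x hx =>
    rcases hx with hx | ⟨w, hw, rfl⟩
    · exact Algebra.subset_adjoin hx
    · have : trace w • (1 : MatP n g) = (⟨trace w, Algebra.subset_adjoin ⟨w, hw, rfl⟩⟩ :
        traceSubalgebra n g) • (1 : MatP n g) := rfl
      rw [this]
      exact Subalgebra.smul_mem _ (one_mem _) _
  | algebraMap r =>
    have : algebraMap ℝ (MatP n g) r = (algebraMap ℝ (traceSubalgebra n g) r) • (1 : MatP n g) := by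
      rw [algebraMap_smul, Algebra.algebraMap_eq_smul_one]
    rw [this]
    exact Subalgebra.smul_mem _ (one_mem _) _
  | add x y _ _ hx hy => exact add_mem hx hy
  | mul x y _ _ hx hy => exact mul_mem hx hy

/-- Induction principle for the trace ring as a module over the traces. -/
theorem traceRing_induction {P : MatP n g → Prop}
    (word : ∀ w ∈ Submonoid.closure (genSet n g), P w) (zero : P 0)
    (add : ∀ x y, x ∈ traceRing n g → y ∈ traceRing n g → P x → P y → P (x + y))
    (smul : ∀ p ∈ traceSubalgebra n g, ∀ x ∈ traceRing n g, P x → P (p • x)) {h : MatP n g}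
    (hh : h ∈ traceRing n g) : P h := by
  suffices h ∈ traceRing n g ∧ P h from this.2
  have hmem := mem_span_of_mem_traceRing hh
  clear hh
  induction hmem using Submodule.span_induction with
  | mem x hx => exact ⟨mem_traceRing_of_mem_closure hx, word x hx⟩
  | zero => exact ⟨zero_mem _, zero⟩
  | add x y _ _ hx hy => exact ⟨add_mem hx.1 hy.1, add x y hx.1 hy.1 hx.2 hy.2⟩
  | smul a x _ hx =>
    refine ⟨?_, smul a.1 a.2 x hx.1 hx.2⟩
    have : a • x = (a.1 • (1 : MatP n g)) * x := by rw [smul_mul_assoc, one_mul]; rfl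
    rw [this]
    exact mul_mem (smul_one_mem_traceRing a.2) hx.1

theorem smul_mem_traceRing {p : PolyRing n g} (hp : p ∈ traceSubalgebra n g) {h : MatP n g}
    (hh : h ∈ traceRing n g) : p • h ∈ traceRing n g := by
  rw [← one_mul h, ← smul_mul_assoc]
  exact mul_mem (smul_one_mem_traceRing hp) hh

theorem trace_mem_traceSubalgebra {h : MatP n g} (hh : h ∈ traceRing n g) :
    trace h ∈ traceSubalgebra n g := by
  refine traceRing_induction (P := fun h => trace h ∈ traceSubalgebra n g)
    (fun w hw => Algebra.subset_adjoin ⟨w, hw, rfl⟩) (by simp) (fun x y _ _ hx hy => ?_)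
    (fun p hp x _ hx => ?_) hh
  · rw [trace_add]; exact add_mem hx hy
  · rw [trace_smul]; exact mul_mem hp hx

theorem transpose_mem_traceRing {h : MatP n g} (hh : h ∈ traceRing n g) : hᵀ ∈ traceRing n g := by
  refine traceRing_induction (P := fun h => hᵀ ∈ traceRing n g)
    (fun w hw => mem_traceRing_of_mem_closure (transpose_mem_closure_genSet hw)) (by simp)
    (fun x y _ _ hx hy => ?_) (fun p hp x _ hx => ?_) hh
  · rw [transpose_add]; exact add_mem hx hy
  · rw [transpose_smul]; exact smul_mem_traceRing hp hx

end TraceRing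

section Evaluation

variable {n g : ℕ} (X : Fin g → Matrix (Fin n) (Fin n) ℝ)

/-- Evaluation of polynomials at a tuple of matrices. -/
abbrev evalPoly : PolyRing n g →ₐ[ℝ] ℝ :=
  MvPolynomial.aeval fun v => X v.1 v.2.1 v.2.2

theorem evalMat_eq (h : MatP n g) : evalMat n g X h = (evalPoly X).mapMatrix h := by
  ext i j
  simp [evalMat, evalPoly, MvPolynomial.aeval_eq_eval]

theorem evalMat_transpose (h : MatP n g) : evalMat n g X hᵀ = (evalMat n g X h)ᵀ := rfl

theorem evalMat_trace (h : MatP n g) : trace (evalMat n g X h) = evalPoly X (trace h) := by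
  rw [evalMat_eq]
  exact (AddMonoidHom.map_trace (evalPoly X) h).symm

theorem evalMat_add (h k : MatP n g) : evalMat n g X (h + k) = evalMat n g X h + evalMat n g X k := by
  simp only [evalMat_eq, map_add]

theorem evalMat_mul (h k : MatP n g) : evalMat n g X (h * k) = evalMat n g X h * evalMat n g X k := by
  simp only [evalMat_eq, map_mul]

theorem evalMat_one : evalMat n g X 1 = 1 := by
  simp only [evalMat_eq, map_one]

theorem evalMat_smul_one (p : PolyRing n g) : evalMat n g X (p • 1) = evalPoly X p • 1 := by
  have : p • (1 : MatP n g) = scalar (Fin n) p := smul_one_eq_diagonal p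
  ext i j
  rw [this]
  by_cases h : i = j
  · subst h
    simp [evalMat_eq]
  · simp [evalMat_eq, h]

end Evaluation

section CyclicPreordering

variable {n g : ℕ} {S : Set (MatP n g)}

theorem isCyclicPreordering_symmetric (n g : ℕ) :
    IsCyclicPreordering n g {q | q ∈ traceRing n g ∧ qᵀ = q} := by
  refine ⟨⟨fun q hq => hq, ⟨one_mem _, transpose_one⟩, ?_, ?_, ?_⟩, ?_⟩
  · rintro a ⟨ha, ha'⟩ b ⟨hb, hb'⟩
    exact ⟨add_mem ha hb, by rw [transpose_add, ha', hb']⟩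
  · rintro h hh q ⟨hq, hq'⟩
    exact ⟨mul_mem (mul_mem hh hq) (transpose_mem_traceRing hh), by
      simp [transpose_mul, hq', mul_assoc]⟩
  · rintro q ⟨hq, -⟩
    exact ⟨smul_one_mem_traceRing (trace_mem_traceSubalgebra hq), by simp⟩
  · rintro a ⟨⟨ha, ha'⟩, _, p, rfl⟩ b ⟨⟨hb, hb'⟩, _, p', rfl⟩
    exact ⟨mul_mem ha hb, by simp⟩

theorem isCyclicPreordering_TtrS (hS : ∀ s ∈ S, s ∈ traceRing n g ∧ sᵀ = s) :
    IsCyclicPreordering n g (TtrS n g S) := by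
  refine ⟨⟨fun q hq => hq _ (isCyclicPreordering_symmetric n g) hS, fun T hT _ => hT.1.2.1,
    fun a ha b hb T hT hST => hT.1.2.2.1 a (ha T hT hST) b (hb T hT hST),
    fun h hh q hq T hT hST => hT.1.2.2.2.1 h hh q (hq T hT hST),
    fun q hq T hT hST => hT.1.2.2.2.2 q (hq T hT hST)⟩, ?_⟩
  rintro a ⟨ha, hac⟩ b ⟨hb, hbc⟩ T hT hST
  exact hT.2 a ⟨ha T hT hST, hac⟩ b ⟨hb T hT hST, hbc⟩

theorem subset_TtrS : S ⊆ TtrS n g S := fun _ hs _ _ hST => hST hs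

theorem isCyclicPreordering_posSemidef (S : Set (MatP n g)) : IsCyclicPreordering n g
    {q | (q ∈ traceRing n g ∧ qᵀ = q) ∧ ∀ X ∈ KSet n g S, (evalMat n g X q).PosSemidef} := by
  obtain ⟨⟨-, h1, h2, h3, h4⟩, h5⟩ := isCyclicPreordering_symmetric n g
  refine ⟨⟨fun q hq => hq.1, ⟨h1, fun X _ => ?_⟩, fun a ha b hb => ⟨h2 a ha.1 b hb.1, fun X hX => ?_⟩,
    fun h hh q hq => ⟨h3 h hh q hq.1, fun X hX => ?_⟩, fun q hq => ⟨h4 q hq.1, fun X hX => ?_⟩⟩, ?_⟩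
  · rw [evalMat_one]
    exact PosSemidef.one
  · rw [evalMat_add]
    exact (ha.2 X hX).add (hb.2 X hX)
  · rw [evalMat_mul, evalMat_mul, evalMat_transpose]
    exact (hq.2 X hX).mul_mul_conjTranspose_same _
  · rw [evalMat_smul_one, ← evalMat_trace]
    exact PosSemidef.one.smul (hq.2 X hX).trace_nonneg
  · rintro a ⟨⟨ha, ha'⟩, hac, p, rfl⟩ b ⟨⟨hb, hb'⟩, hbc, p', rfl⟩
    refine ⟨h5 _ ⟨ha, hac, p, rfl⟩ _ ⟨hb, hbc, p', rfl⟩, fun X hX => ?_⟩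
    have h1 := ha' X hX
    have h2 := hb' X hX
    rw [evalMat_mul]
    rw [evalMat_smul_one] at h1 h2 ⊢
    rw [evalMat_smul_one]
    rcases Nat.eq_zero_or_pos n with rfl | hn
    · rw [Subsingleton.elim (_ * _) (1 : Matrix (Fin 0) (Fin 0) ℝ)]
      exact PosSemidef.one
    · have h3 := h1.diag_nonneg (i := ⟨0, hn⟩)
      have h4 := h2.diag_nonneg (i := ⟨0, hn⟩)
      simp only [Matrix.smul_apply, one_apply_eq, smul_eq_mul, mul_one] at h3 h4
      rw [smul_mul_smul_comm, one_mul]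
      exact PosSemidef.one.smul (mul_nonneg h3 h4)

theorem evalMat_posSemidef_of_mem_TtrS (hS : ∀ s ∈ S, s ∈ traceRing n g ∧ sᵀ = s) {q : MatP n g}
    (hq : q ∈ TtrS n g S) {X : Fin g → Matrix (Fin n) (Fin n) ℝ} (hX : X ∈ KSet n g S) :
    (evalMat n g X q).PosSemidef :=
  (hq _ (isCyclicPreordering_posSemidef S) fun s hs => ⟨hS s hs, fun _ hX => hX s hs⟩).2 X hX

theorem posDef_of_mul_eq_one_add {m : Type*} [Fintype m] [DecidableEq m] {a t₁ t₂ : Matrix m m ℝ}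
    (ha : a.IsHermitian) (h₁ : t₁.PosSemidef) (h₂ : t₂.PosSemidef) (h : t₁ * a = 1 + t₂) :
    a.PosDef := by
  rw [ha.posDef_iff_eigenvalues_pos]
  intro i
  set v : m → ℝ := ⇑(ha.eigenvectorBasis i) with hv
  have hv0 : v ≠ 0 := by
    intro h0
    have := ha.eigenvectorBasis.orthonormal.ne_zero i
    exact this (by ext k; exact congrFun h0 k)
  have h3 : v ⬝ᵥ ((t₁ * a) *ᵥ v) = ha.eigenvalues i * (v ⬝ᵥ (t₁ *ᵥ v)) := by
    rw [← mulVec_mulVec, ha.mulVec_eigenvectorBasis i, mulVec_smul, dotProduct_smul, smul_eq_mul]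
  rw [h, add_mulVec, one_mulVec, dotProduct_add] at h3
  have h4 : 0 < v ⬝ᵥ v := by
    have := dotProduct_star_self_pos_iff.2 hv0
    simpa using this
  have h5 : 0 ≤ v ⬝ᵥ (t₁ *ᵥ v) := by simpa using h₁.dotProduct_mulVec_nonneg v
  have h6 : 0 ≤ v ⬝ᵥ (t₂ *ᵥ v) := by simpa using h₂.dotProduct_mulVec_nonneg v
  by_contra h7
  nlinarith [mul_nonneg (neg_nonneg.2 (not_lt.1 h7)) h5]

theorem posDef_of_exists_TtrS (hS : ∀ s ∈ S, s ∈ traceRing n g ∧ sᵀ = s) {a : MatP n g}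
    (ha : aᵀ = a) (h : ∃ t₁ ∈ TtrS n g S, ∃ t₂ ∈ TtrS n g S, a * t₁ = 1 + t₂ ∧ t₁ * a = 1 + t₂)
    {X : Fin g → Matrix (Fin n) (Fin n) ℝ} (hX : X ∈ KSet n g S) : (evalMat n g X a).PosDef := by
  obtain ⟨t₁, ht₁, t₂, ht₂, h₁, h₂⟩ := h
  refine posDef_of_mul_eq_one_add ?_ (evalMat_posSemidef_of_mem_TtrS hS ht₁ hX)
    (evalMat_posSemidef_of_mem_TtrS hS ht₂ hX) ?_
  · rw [IsHermitian, conjTranspose_eq_transpose_of_trivial, ← evalMat_transpose, ha]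
  · rw [← evalMat_mul, h₂, evalMat_add, evalMat_one]

/-- The central elements of `TtrS`, as polynomials. -/
def centralPart (S : Set (MatP n g)) : Set (PolyRing n g) := {p | p • (1 : MatP n g) ∈ TtrS n g S}

variable {p q : PolyRing n g}

theorem centralPart_add (hS : ∀ s ∈ S, s ∈ traceRing n g ∧ sᵀ = s)
    (hp : p ∈ centralPart S) (hq : q ∈ centralPart S) :
    p + q ∈ centralPart S := by
  change (p + q) • (1 : MatP n g) ∈ TtrS n g S
  rw [add_smul]
  exact (isCyclicPreordering_TtrS hS).1.2.2.1 _ hp _ hq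

theorem centralPart_mul (hS : ∀ s ∈ S, s ∈ traceRing n g ∧ sᵀ = s)
    (hp : p ∈ centralPart S) (hq : q ∈ centralPart S) :
    p * q ∈ centralPart S := by
  have h := isCyclicPreordering_TtrS hS
  have : (p * q) • (1 : MatP n g) = p • (1 : MatP n g) * q • (1 : MatP n g) := by
    rw [smul_mul_smul_comm, one_mul]
  change (p * q) • (1 : MatP n g) ∈ TtrS n g S
  rw [this]
  exact h.2 _ ⟨hp, (h.1.1 _ hp).1, p, rfl⟩ _ ⟨hq, (h.1.1 _ hq).1, q, rfl⟩

theorem centralPart_sq (hS : ∀ s ∈ S, s ∈ traceRing n g ∧ sᵀ = s)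
    (hp : p ∈ traceSubalgebra n g) : p * p ∈ centralPart S := by
  have h := isCyclicPreordering_TtrS hS
  have h1 := h.1.2.2.2.1 _ (smul_one_mem_traceRing hp) _ h.1.2.1
  rw [transpose_smul, transpose_one, mul_one, smul_mul_smul_comm, one_mul] at h1
  exact h1

theorem centralPart_trace (hS : ∀ s ∈ S, s ∈ traceRing n g ∧ sᵀ = s)
    {h s : MatP n g} (hh : h ∈ traceRing n g) (hs : s ∈ insert 1 S) :
    trace (h * s * hᵀ) ∈ centralPart S := by
  have hT := isCyclicPreordering_TtrS hS
  refine (hT.1.2.2.2.2 _ (hT.1.2.2.2.1 h hh s ?_) :)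
  rcases hs with rfl | hs
  exacts [hT.1.2.1, subset_TtrS hs]

end CyclicPreordering

section TracialStar

variable {A : Type*} [Ring A] [Algebra ℝ A]

/-- A real algebra with a positive involution and an invariant faithful trace. -/
structure TracialStar (A : Type*) [Ring A] [Algebra ℝ A] where
  st : A →ₗ[ℝ] A
  tr : A →ₗ[ℝ] ℝ
  st_st : ∀ a, st (st a) = a
  st_mul : ∀ a b, st (a * b) = st b * st a
  tr_mul_comm : ∀ a b, tr (a * b) = tr (b * a)
  tr_st : ∀ a, tr (st a) = tr a
  tr_pos : ∀ a, a ≠ 0 → 0 < tr (st a * a)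

namespace TracialStar

variable (T : TracialStar A)

/-- Self-adjoint idempotents. -/
def IsProj (e : A) : Prop := T.st e = e ∧ e * e = e

/-- Nonzero projections without proper nonzero subprojections. -/
def IsMinProj (e : A) : Prop :=
  T.IsProj e ∧ e ≠ 0 ∧ ∀ q, T.IsProj q → e * q = q → q = 0 ∨ q = e

variable {T}

theorem st_one : T.st 1 = 1 := by
  have h := T.st_mul (T.st 1) 1
  rw [mul_one, T.st_st, mul_one] at h
  exact h.symm

theorem isProj_one : T.IsProj 1 := ⟨st_one, mul_one 1⟩

theorem eq_zero_of_mul_self {y : A} (hy : T.st y = y) (h : y * y = 0) : y = 0 := by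
  by_contra h0
  have := T.tr_pos y h0
  rw [hy, h, map_zero] at this
  exact lt_irrefl _ this

theorem st_pow (y : A) (k : ℕ) : T.st (y ^ k) = T.st y ^ k := by
  induction k with
  | zero => simp [st_one]
  | succ k ih => rw [pow_succ, T.st_mul, ih, pow_succ']

theorem st_aeval {y : A} (hy : T.st y = y) (p : Polynomial ℝ) :
    T.st (Polynomial.aeval y p) = Polynomial.aeval y p := by
  induction p using Polynomial.induction_on' with
  | add p q hp hq => simp [hp, hq]
  | monomial k a => simp [Polynomial.aeval_monomial, ← Algebra.smul_def, st_pow, hy]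

theorem eq_zero_of_pow {y : A} (hy : T.st y = y) (k : ℕ) (h : y ^ (k + 1) = 0) : y = 0 := by
  induction k with
  | zero => simpa using h
  | succ k ih =>
    apply ih
    apply eq_zero_of_mul_self (T := T)
    · rw [st_pow, hy]
    · rw [← pow_add, show k + 1 + (k + 1) = (k + 1 + 1) + k by ring, pow_add, h, zero_mul]

theorem mul_right_of_mul_left {e y : A} (he : T.IsProj e) (hy : T.st y = y) (h : e * y = y) :
    y * e = y := by
  have := T.st_mul e y
  rw [h, he.1, hy] at this
  exact this.symm

theorem st_mul_of_mul {e u : A} (he : T.IsProj e) (h : u * e = u) : e * T.st u = T.st u := by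
  have := T.st_mul u e
  rw [h, he.1] at this
  exact this.symm

theorem st_mul_of_mul' {e u : A} (he : T.IsProj e) (h : e * u = u) : T.st u * e = T.st u := by
  have := T.st_mul e u
  rw [h, he.1] at this
  exact this.symm

theorem tr_proj_pos {e : A} (he : T.IsProj e) (h0 : e ≠ 0) : 0 < T.tr e := by
  have := T.tr_pos e h0
  rwa [he.1, he.2] at this

theorem commute_aeval {e y : A} (h₁ : e * y = y) (h₂ : y * e = y) (p : Polynomial ℝ) :
    Commute e (Polynomial.aeval y p) := by
  induction p using Polynomial.induction_on' with
  | add p q hp hq => rw [map_add]; exact hp.add_right hq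
  | monomial k a =>
    rw [Polynomial.aeval_monomial]
    have hey : Commute e y := h₁.trans h₂.symm
    have hea : Commute e (algebraMap ℝ A a) := (Algebra.commutes a e).symm
    exact hea.mul_right (hey.pow_right k)

variable [Module.Finite ℝ A]

theorem exists_kernel_proj {e y : A} (he : T.IsProj e) (hy : T.st y = y) (h : e * y = y) :
    ∃ q s, T.IsProj q ∧ e * q = q ∧ y * q = 0 ∧ q = e + s * y := by
  have h' := mul_right_of_mul_left he hy h
  have hint : IsIntegral ℝ y := Algebra.IsIntegral.isIntegral y
  obtain ⟨r, hr, hr'⟩ := Polynomial.exists_eq_pow_rootMultiplicity_mul_and_not_dvd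
    (minpoly ℝ y) (minpoly.ne_zero hint) 0
  set k := Polynomial.rootMultiplicity 0 (minpoly ℝ y)
  rw [Polynomial.C_0, sub_zero] at hr hr'
  have hr0 : r.coeff 0 ≠ 0 := mt Polynomial.X_dvd_iff.2 hr'
  set c := r.coeff 0
  set R := Polynomial.aeval y r with hR
  have hkr : y ^ k * R = 0 := by
    have := minpoly.aeval ℝ y
    rw [hr, map_mul, map_pow, Polynomial.aeval_X] at this
    exact this
  have hcomm : Commute y R := by
    exact Polynomial.aeval_X (R := ℝ) y ▸ (Commute.all (Polynomial.X : Polynomial ℝ) r).map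
      (Polynomial.aeval y)
  have hRs : T.st R = R := st_aeval hy r
  have hz : y * R = 0 := by
    apply eq_zero_of_pow (T := T) (k := k)
    · rw [T.st_mul, hRs, hy, hcomm.eq]
    · rw [hcomm.mul_pow, pow_succ' y, pow_succ' R, mul_assoc, ← mul_assoc (y ^ k), hkr, zero_mul,
        mul_zero]
  have heR : Commute e R := commute_aeval h h' r
  have hRdecomp : R = Polynomial.aeval y r.divX * y + c • (1 : A) := by
    conv_lhs => rw [hR, ← Polynomial.divX_mul_X_add r]
    rw [map_add, map_mul, Polynomial.aeval_X, Polynomial.aeval_C, Algebra.algebraMap_eq_smul_one]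
  have hq : c⁻¹ • (R * e) = e + (c⁻¹ • Polynomial.aeval y r.divX) * y := by
    rw [hRdecomp, add_mul, mul_assoc, h', smul_mul_assoc, one_mul, smul_add, smul_smul,
      inv_mul_cancel₀ hr0, one_smul, smul_mul_assoc, add_comm]
  have hyq : y * (c⁻¹ • (R * e)) = 0 := by
    rw [mul_smul_comm, ← mul_assoc, hz, zero_mul, smul_zero]
  have heq : e * (c⁻¹ • (R * e)) = c⁻¹ • (R * e) := by
    rw [mul_smul_comm, ← mul_assoc, heR.eq, mul_assoc, he.2]
  refine ⟨c⁻¹ • (R * e), c⁻¹ • Polynomial.aeval y r.divX, ⟨?_, ?_⟩, heq, hyq, hq⟩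
  · rw [map_smul, T.st_mul, hRs, he.1, heR.eq]
  · nth_rw 1 [hq]
    rw [add_mul, heq, mul_assoc, hyq, mul_zero, add_zero]

theorem IsMinProj.exists_inv {e y : A} (he : T.IsMinProj e) (hy : T.st y = y) (h : e * y = y)
    (h0 : y ≠ 0) : ∃ s, e = s * y := by
  obtain ⟨q, s, hq, heq, hyq, hqs⟩ := exists_kernel_proj he.1 hy h
  rcases he.2.2 q hq heq with rfl | rfl
  · exact ⟨-s, by rw [neg_mul, eq_neg_iff_add_eq_zero]; exact hqs.symm⟩
  · exact absurd ((mul_right_of_mul_left hq hy h).symm.trans hyq) h0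

theorem IsMinProj.eq_zero_or {e y v : A} (he : T.IsMinProj e) (hy : T.st y = y) (h : e * y = y)
    (hv : e * v = v) (hyv : y * v = 0) : y = 0 ∨ v = 0 := by
  by_contra! hne
  obtain ⟨s, hs⟩ := he.exists_inv hy h hne.1
  apply hne.2
  rw [← hv, hs, mul_assoc, hyv, mul_zero]

theorem IsMinProj.eq_smul_of_quadratic {e x : A} (he : T.IsMinProj e) (hx : T.st x = x)
    (h : e * x = x) {a b c : ℝ} (hp : a • (x * x) + b • x + c • e = 0)
    (hne : a ≠ 0 ∨ b ≠ 0 ∨ c ≠ 0) : ∃ r : ℝ, x = r • e := by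
  have h' := mul_right_of_mul_left he.1 hx h
  by_cases ha : a = 0
  · subst ha
    rw [zero_smul, zero_add] at hp
    by_cases hb : b = 0
    · subst hb
      rw [zero_smul, zero_add, smul_eq_zero] at hp
      simp_all [he.2.1]
    · refine ⟨-(b⁻¹ * c), ?_⟩
      have := congrArg (fun z => b⁻¹ • z) hp
      simp only [smul_add, smul_smul, smul_zero, inv_mul_cancel₀ hb, one_smul] at this
      rw [neg_smul]
      exact eq_neg_of_add_eq_zero_left this
  have hlin : ∀ d : ℝ, (2 * a) • x + d • e = 0 → ∃ r : ℝ, x = r • e := by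
    intro d hd
    refine ⟨-((2 * a)⁻¹ * d), ?_⟩
    have h2a : 2 * a ≠ 0 := mul_ne_zero two_ne_zero ha
    have := congrArg (fun z => (2 * a)⁻¹ • z) hd
    simp only [smul_add, smul_smul, smul_zero, inv_mul_cancel₀ h2a, one_smul] at this
    rw [neg_smul]
    exact eq_neg_of_add_eq_zero_left this
  set w := fun d : ℝ => (2 * a) • x + d • e with hw
  have hws : ∀ d, T.st (w d) = w d := by
    intro d
    simp [hw, hx, he.1.1]
  have hwe : ∀ d, e * w d = w d := by
    intro d
    simp [hw, mul_add, h, he.1.2]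
  have hmul : ∀ d, w (b - d) * w (b + d) = (b ^ 2 - 4 * a * c - d ^ 2) • e := by
    intro d
    simp only [hw, mul_add, add_mul, smul_mul_smul_comm, h, h', he.1.2]
    linear_combination (norm := module) (4 * a) • hp
  rcases lt_or_ge (b ^ 2 - 4 * a * c) 0 with hd | hd
  · exfalso
    have h1 := hmul 0
    rw [sub_zero, add_zero] at h1
    by_cases hw0 : w b = 0
    · rw [hw0, mul_zero] at h1
      have := smul_eq_zero.1 h1.symm
      rcases this with h2 | h2
      · linarith
      · exact he.2.1 h2
    · have h2 := T.tr_pos _ hw0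
      rw [hws, h1, map_smul, smul_eq_mul] at h2
      nlinarith [tr_proj_pos he.1 he.2.1]
  · have h1 := hmul (Real.sqrt (b ^ 2 - 4 * a * c))
    rw [Real.sq_sqrt hd, sub_self, zero_smul] at h1
    rcases he.eq_zero_or (hws _) (hwe _) (hwe _) h1 with h2 | h2
    exacts [hlin _ h2, hlin _ h2]

/-- Self-adjoint elements under a minimal projection are scalar. -/
theorem IsMinProj.eq_smul {e x : A} (he : T.IsMinProj e) (hx : T.st x = x) (h : e * x = x) :
    ∃ r : ℝ, x = r • e := by
  have h' := mul_right_of_mul_left he.1 hx h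
  have main : ∀ n, ∀ p : Polynomial ℝ, p.natDegree < n → p ≠ 0 → Polynomial.aeval x p * e = 0 →
      ∃ r : ℝ, x = r • e := by
    intro n
    induction n with
    | zero => intro p hp; omega
    | succ n ih =>
      intro p hpn hp hpe
      have hnu : ¬ IsUnit p := by
        intro hu
        obtain ⟨c, hc, rfl⟩ := Polynomial.isUnit_iff.1 hu
        rw [Polynomial.aeval_C, ← Algebra.smul_def, smul_eq_zero] at hpe
        rcases hpe with h1 | h1
        · exact hc.ne_zero h1
        · exact he.2.1 h1
      obtain ⟨q, hq, r, rfl⟩ := WfDvdMonoid.exists_irreducible_factor hnu hp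
      have hcom : ∀ q : Polynomial ℝ, e * Polynomial.aeval x q = Polynomial.aeval x q * e :=
        fun q => commute_aeval h h' q
      have hcorner : ∀ q : Polynomial ℝ, e * (Polynomial.aeval x q * e) =
          Polynomial.aeval x q * e := by
        intro q
        rw [← mul_assoc, hcom, mul_assoc, he.1.2]
      have hzero : (Polynomial.aeval x q * e) * (Polynomial.aeval x r * e) = 0 := by
        rw [mul_assoc, hcorner, ← mul_assoc, ← map_mul, hpe]
      have hsym : T.st (Polynomial.aeval x q * e) = Polynomial.aeval x q * e := by
        rw [T.st_mul, st_aeval hx, he.1.1, hcom]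
      have hq0 := hq.ne_zero
      have hr0 : r ≠ 0 := right_ne_zero_of_mul hp
      rcases he.eq_zero_or hsym (hcorner q) (hcorner r) hzero with h1 | h1
      · have hdeg : q.natDegree ≤ 2 := hq.natDegree_le_two
        have hqq := Polynomial.as_sum_range_C_mul_X_pow' q (Nat.lt_succ_of_le hdeg)
        simp only [Finset.sum_range_succ, Finset.sum_range_zero] at hqq
        refine he.eq_smul_of_quadratic hx h (a := q.coeff 2) (b := q.coeff 1) (c := q.coeff 0) ?_ ?_
        · rw [hqq] at h1
          simp only [map_add, map_mul, Polynomial.aeval_C, Polynomial.aeval_X,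
            ← Algebra.smul_def, zero_add, pow_zero, pow_one, add_mul, smul_mul_assoc,
            map_one, one_mul, h', pow_two, mul_assoc] at h1
          rw [← h1]
          abel
        · by_contra! hcon
          apply hq0
          rw [hqq, hcon.1, hcon.2.1, hcon.2.2]
          simp
      · refine ih r ?_ hr0 h1
        have h2 : (q * r).natDegree = q.natDegree + r.natDegree := Polynomial.natDegree_mul hq0 hr0
        have h3 := hq.natDegree_pos
        omega
  have hint : IsIntegral ℝ x := Algebra.IsIntegral.isIntegral x
  exact main _ (minpoly ℝ x) (Nat.lt_succ_self _) (minpoly.ne_zero hint) (by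
    rw [minpoly.aeval, zero_mul])

end TracialStar

end TracialStar

namespace TracialStar

variable {A : Type*} [Ring A] [Algebra ℝ A] {T : TracialStar A}

/-- Integrality conditions on the trace forced by realizability on a real Euclidean space. -/
structure IsIntegral (T : TracialStar A) : Prop where
  proj : ∀ e, T.IsProj e → ∃ k : ℕ, T.tr e = k
  skew : ∀ e j, T.IsProj e → e * j = j → T.st j = -j → j * j = -e → ∃ k : ℕ, T.tr e = 2 * k
  quat : ∀ e i j, T.IsProj e → e * i = i → T.st i = -i → i * i = -e →
    e * j = j → T.st j = -j → j * j = -e → i * j = -(j * i) → ∃ k : ℕ, T.tr e = 4 * k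

/-- The elements `x` with `f * x = x = x * e`. -/
def corner (f e : A) : Submodule ℝ A where
  carrier := {x | f * x = x ∧ x * e = x}
  zero_mem' := by simp
  add_mem' := by
    rintro a b ⟨h₁, h₂⟩ ⟨h₃, h₄⟩
    exact ⟨by rw [mul_add, h₁, h₃], by rw [add_mul, h₂, h₄]⟩
  smul_mem' := by
    rintro c a ⟨h₁, h₂⟩
    exact ⟨by rw [mul_smul_comm, h₁], by rw [smul_mul_assoc, h₂]⟩

theorem mul_right_of_skew {e x : A} (he : T.IsProj e) (h : e * x = x) (hx : T.st x = -x) :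
    x * e = x := by
  have := st_mul_of_mul' he h
  rw [hx, neg_mul, neg_inj] at this
  exact this

section Finite

variable [Module.Finite ℝ A]

/-- A nonzero element linking two minimal projections is a scaled partial isometry. -/
theorem IsMinProj.exists_link {e f u : A} (he : T.IsMinProj e) (hf : T.IsMinProj f)
    (h₁ : f * u = u) (h₂ : u * e = u) (hu : u ≠ 0) :
    ∃ c : ℝ, 0 < c ∧ T.st u * u = c • e ∧ u * T.st u = c • f := by
  obtain ⟨c, hc⟩ := he.eq_smul (x := T.st u * u) (by rw [T.st_mul, T.st_st])
    (by rw [← mul_assoc, st_mul_of_mul he.1 h₂])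
  obtain ⟨d, hd⟩ := hf.eq_smul (x := u * T.st u) (by rw [T.st_mul, T.st_st])
    (by rw [← mul_assoc, h₁])
  have hcd : c • u = d • u := by
    rw [← h₂, ← mul_smul_comm, ← hc, ← mul_assoc, h₂, hd, smul_mul_assoc, h₁]
  have hcd' : c = d := smul_left_injective ℝ hu hcd
  refine ⟨c, ?_, hc, hcd' ▸ hd⟩
  have h := T.tr_pos u hu
  rw [hc, map_smul, smul_eq_mul] at h
  exact pos_of_mul_pos_left h (tr_proj_pos he.1 he.2.1).le

theorem IsMinProj.finrank_corner_eq {e f u : A} (he : T.IsMinProj e) (hf : T.IsMinProj f)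
    (h₁ : f * u = u) (h₂ : u * e = u) (hu : u ≠ 0) :
    Module.finrank ℝ (corner f f) = Module.finrank ℝ (corner e e) := by
  obtain ⟨c, hc, huu, huu'⟩ := he.exists_link hf h₁ h₂ hu
  have h₁' := st_mul_of_mul' hf.1 h₁
  have h₂' := st_mul_of_mul he.1 h₂
  refine LinearEquiv.finrank_eq
    { toFun := fun x => ⟨T.st u * x * u, ?_, ?_⟩
      invFun := fun x => ⟨(c⁻¹ * c⁻¹) • (u * x * T.st u), ?_, ?_⟩
      map_add' := ?_
      map_smul' := ?_
      left_inv := ?_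
      right_inv := ?_ }
  · rw [← mul_assoc, ← mul_assoc, h₂']
  · rw [mul_assoc, h₂]
  · intro x y
    ext
    simp [mul_add, add_mul]
  · intro a x
    ext
    simp
  · rw [mul_smul_comm, ← mul_assoc, ← mul_assoc, h₁]
  · rw [smul_mul_assoc, mul_assoc, h₁']
  · intro x
    ext
    have : u * (T.st u * x * u) * T.st u = (u * T.st u) * x * (u * T.st u) := by
      simp only [mul_assoc]
    simp only [this, huu', smul_mul_assoc, mul_smul_comm, smul_smul, x.2.1, x.2.2]
    rw [show c⁻¹ * c⁻¹ * (c * c) = 1 by field_simp, one_smul]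
  · intro x
    ext
    have : T.st u * (u * x * T.st u) * u = (T.st u * u) * x * (T.st u * u) := by
      simp only [mul_assoc]
    simp only [this, huu, smul_mul_assoc, mul_smul_comm, smul_smul, x.2.1, x.2.2]
    rw [show c⁻¹ * c⁻¹ * (c * c) = 1 by field_simp, one_smul]

theorem IsMinProj.exists_normalize {e x : A} (he : T.IsMinProj e) (h : e * x = x)
    (hx : T.st x = -x) (h0 : x ≠ 0) : ∃ r : ℝ, r ≠ 0 ∧ (r • x) * (r • x) = -e := by
  obtain ⟨c, hc, hxx, -⟩ := he.exists_link he h (mul_right_of_skew he.1 h hx) h0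
  rw [hx, neg_mul] at hxx
  refine ⟨(Real.sqrt c)⁻¹, by positivity, ?_⟩
  rw [smul_mul_smul_comm, neg_eq_iff_eq_neg.1 hxx, smul_neg, smul_smul, ← mul_inv,
    Real.mul_self_sqrt hc.le, inv_mul_cancel₀ hc.ne', one_smul]

theorem IsMinProj.anticommutator {e x y : A} (he : T.IsMinProj e) (hx : e * x = x)
    (hx' : T.st x = -x) (hy : e * y = y) (hy' : T.st y = -y) : ∃ r : ℝ, x * y + y * x = r • e :=
  he.eq_smul (by rw [map_add, T.st_mul, T.st_mul, hx', hy']; simp [add_comm])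
    (by rw [mul_add, ← mul_assoc, ← mul_assoc, hx, hy])

/-- Frobenius: the corner of a minimal projection is `ℝ`, `ℂ` or `ℍ`. -/
theorem IsMinProj.exists_tr_eq {e : A} (he : T.IsMinProj e) (hT : T.IsIntegral) :
    ∃ c : ℕ, T.tr e = c * Module.finrank ℝ (corner e e) := by
  have hee := he.1.2
  have hmemE : e ∈ corner e e := ⟨hee, hee⟩
  have hdecomp : ∀ x ∈ corner e e, ∃ (r : ℝ) (y : A), T.st y = -y ∧ e * y = y ∧
      x = r • e + y := by
    rintro x ⟨h₁, h₂⟩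
    have h₃ := st_mul_of_mul he.1 h₂
    obtain ⟨r, hr⟩ := he.eq_smul (x := (2⁻¹ : ℝ) • (x + T.st x))
      (by rw [map_smul, map_add, T.st_st, add_comm]) (by rw [mul_smul_comm, mul_add, h₁, h₃])
    refine ⟨r, (2⁻¹ : ℝ) • (x - T.st x), ?_, ?_, ?_⟩
    · rw [map_smul, map_sub, T.st_st, ← smul_neg, neg_sub]
    · rw [mul_smul_comm, mul_sub, h₁, h₃]
    · rw [← hr]
      module
  have hfin : ∀ {m : ℕ} (v : Fin m → A), LinearIndependent ℝ v → (∀ i, v i ∈ corner e e) →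
      (∀ x, T.st x = -x → e * x = x → x ∈ Submodule.span ℝ (Set.range v)) →
      e ∈ Submodule.span ℝ (Set.range v) → Module.finrank ℝ (corner e e) = m := by
    intro m v hv hmem hsp hesp
    have : corner e e = Submodule.span ℝ (Set.range v) := by
      apply le_antisymm
      · intro x hx
        obtain ⟨r, y, hy, hey, rfl⟩ := hdecomp x hx
        exact add_mem (Submodule.smul_mem _ _ hesp) (hsp y hy hey)
      · rw [Submodule.span_le]
        rintro _ ⟨i, rfl⟩
        exact hmem i
    rw [this, finrank_span_eq_card hv, Fintype.card_fin]
  have hsmul0 : ∀ r : ℝ, r • e = 0 → r = 0 := fun r hr => (smul_eq_zero.1 hr).resolve_right he.2.1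
  by_cases h1 : ∀ x, T.st x = -x → e * x = x → x = 0
  · obtain ⟨k, hk⟩ := hT.proj e he.1
    refine ⟨k, ?_⟩
    rw [hfin ![e] (by simpa [linearIndependent_unique_iff] using he.2.1) (by simpa using hmemE)
      (fun x hx hex => by rw [h1 x hx hex]; exact zero_mem _)
      (Submodule.subset_span ⟨0, rfl⟩), hk]
    simp
  push Not at h1
  obtain ⟨x, hx, hex, hx0⟩ := h1
  obtain ⟨r, hr0, hr⟩ := he.exists_normalize hex hx hx0
  obtain ⟨i, hi, hei, hii⟩ : ∃ i, T.st i = -i ∧ e * i = i ∧ i * i = -e :=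
    ⟨r • x, by rw [map_smul, hx, smul_neg], by rw [mul_smul_comm, hex], hr⟩
  have hie := mul_right_of_skew he.1 hei hi
  by_cases h2 : ∀ x, T.st x = -x → e * x = x → ∃ r : ℝ, x = r • i
  · obtain ⟨k, hk⟩ := hT.skew e i he.1 hei hi hii
    refine ⟨k, ?_⟩
    rw [hfin ![e, i] ?_ ?_ ?_ (Submodule.subset_span ⟨0, rfl⟩), hk]
    · push_cast
      ring
    · rw [Fintype.linearIndependent_iff]
      intro a ha
      simp only [Fin.sum_univ_two, Matrix.cons_val_zero, Matrix.cons_val_one] at ha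
      have h3 := congrArg T.st ha
      simp only [map_add, map_smul, he.1.1, hi, map_zero] at h3
      have ha0 : a 0 = 0 := by
        apply hsmul0
        linear_combination (norm := module) (2⁻¹ : ℝ) • (ha + h3)
      have ha1 : a 1 = 0 := by
        apply hsmul0
        have := congrArg (fun z => z * i) ha
        simp only [ha0, zero_smul, zero_add, smul_mul_assoc, hii, zero_mul] at this
        simpa using this
      intro l
      fin_cases l
      exacts [ha0, ha1]
    · intro l
      fin_cases l
      exacts [hmemE, ⟨hei, hie⟩]
    · intro x hx hex
      obtain ⟨r, rfl⟩ := h2 x hx hex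
      exact Submodule.smul_mem _ _ (Submodule.subset_span ⟨1, rfl⟩)
  push Not at h2
  obtain ⟨l, hl, hel, hli⟩ := h2
  obtain ⟨μ, hμ⟩ := he.anticommutator hel hl hei hi
  obtain ⟨j, hj, hej, hjj, hij⟩ : ∃ j, T.st j = -j ∧ e * j = j ∧ j * j = -e ∧
      i * j = -(j * i) := by
    set y := l + (μ / 2) • i with hy
    have hy0 : y ≠ 0 := by
      intro h
      apply hli (-(μ / 2))
      rw [neg_smul]
      exact eq_neg_of_add_eq_zero_left h
    have hys : T.st y = -y := by
      rw [hy, map_add, map_smul, hl, hi, smul_neg, neg_add]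
    have hey : e * y = y := by
      rw [hy, mul_add, mul_smul_comm, hel, hei]
    have hiy : i * y + y * i = 0 := by
      simp only [hy, mul_add, add_mul, mul_smul_comm, smul_mul_assoc, hii]
      linear_combination (norm := module) hμ
    obtain ⟨r, -, hr⟩ := he.exists_normalize hey hys hy0
    refine ⟨r • y, by rw [map_smul, hys, smul_neg], by rw [mul_smul_comm, hey], hr, ?_⟩
    rw [mul_smul_comm, smul_mul_assoc, ← smul_neg, eq_neg_of_add_eq_zero_left hiy]
  have hje := mul_right_of_skew he.1 hej hj
  obtain ⟨k, hk⟩ : ∃ k, k = i * j := ⟨_, rfl⟩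
  have hks : T.st k = -k := by rw [hk, T.st_mul, hi, hj, neg_mul_neg, hij, neg_neg]
  have hek : e * k = k := by rw [hk, ← mul_assoc, hei]
  have hke := mul_right_of_skew he.1 hek hks
  have hji : j * i = -k := by rw [hk, hij, neg_neg]
  have hik : i * k = -j := by rw [hk, ← mul_assoc, hii, neg_mul, hej]
  have hki : k * i = j := by
    rw [hk, mul_assoc, hji, mul_neg, hik, neg_neg]
  have hkj : k * j = -i := by rw [hk, mul_assoc, hjj, mul_neg, hie]
  have hjk : j * k = i := by rw [hk, ← mul_assoc, hji, neg_mul, hkj, neg_neg]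
  have hkk : k * k = -e := by
    nth_rw 1 [hk]
    rw [mul_assoc, hjk, hii]
  obtain ⟨m, hm⟩ := hT.quat e i j he.1 hei hi hii hej hj hjj hij
  refine ⟨m, ?_⟩
  rw [hfin ![e, i, j, k] ?_ ?_ ?_ (Submodule.subset_span ⟨0, rfl⟩), hm]
  · push_cast
    ring
  · rw [Fintype.linearIndependent_iff]
    intro a ha
    simp only [Fin.sum_univ_four] at ha
    change a 0 • e + a 1 • i + a 2 • j + a 3 • k = 0 at ha
    have h3 := congrArg T.st ha
    simp only [map_add, map_smul, he.1.1, hi, hj, hks, map_zero] at h3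
    have key : ∀ w, a 1 • (i * w + w * i) + a 2 • (j * w + w * j) + a 3 • (k * w + w * k) = 0 := by
      intro w
      have h4 : a 1 • i + a 2 • j + a 3 • k = 0 := by
        linear_combination (norm := module) (2⁻¹ : ℝ) • (ha - h3)
      have h5 := congrArg (fun z => z * w + w * z) h4
      simp only [add_mul, mul_add, smul_mul_assoc, mul_smul_comm, zero_mul, mul_zero,
        add_zero] at h5
      rw [← h5]
      module
    have ha0 : a 0 = 0 := by
      apply hsmul0
      linear_combination (norm := module) (2⁻¹ : ℝ) • (ha + h3)
    have ha1 : a 1 = 0 := by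
      apply hsmul0
      have := key i
      rw [hii, hji, hki, ← hk, hik] at this
      linear_combination (norm := module) (-2⁻¹ : ℝ) • this
    have ha2 : a 2 = 0 := by
      apply hsmul0
      have := key j
      rw [hjj, hji, hkj, ← hk, hjk] at this
      linear_combination (norm := module) (-2⁻¹ : ℝ) • this
    have ha3 : a 3 = 0 := by
      apply hsmul0
      have := key k
      rw [hik, hki, hjk, hkj, hkk] at this
      linear_combination (norm := module) (-2⁻¹ : ℝ) • this
    intro l
    fin_cases l
    exacts [ha0, ha1, ha2, ha3]
  · intro l
    fin_cases l
    exacts [hmemE, ⟨hei, hie⟩, ⟨hej, hje⟩, ⟨hek, hke⟩]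
  · intro x hx hex
    obtain ⟨α, hα⟩ := he.anticommutator hex hx hei hi
    obtain ⟨β, hβ⟩ := he.anticommutator hex hx hej hj
    obtain ⟨γ, hγ⟩ := he.anticommutator hex hx hek hks
    set y := x + (α / 2) • i + (β / 2) • j + (γ / 2) • k with hy
    have hyi : y * i + i * y = 0 := by
      simp only [hy, mul_add, add_mul, mul_smul_comm, smul_mul_assoc, hii, hji, hki, ← hk, hik]
      linear_combination (norm := module) hα
    have hyj : y * j + j * y = 0 := by
      simp only [hy, mul_add, add_mul, mul_smul_comm, smul_mul_assoc, hjj, hji, hkj, ← hk, hjk]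
      linear_combination (norm := module) hβ
    have hyk : y * k + k * y = 0 := by
      simp only [hy, mul_add, add_mul, mul_smul_comm, smul_mul_assoc, hkk, hik, hki, hjk, hkj]
      linear_combination (norm := module) hγ
    have hyk' : y * k - k * y = 0 := by
      rw [hk, ← mul_assoc, eq_neg_of_add_eq_zero_left hyi, neg_mul, mul_assoc,
        eq_neg_of_add_eq_zero_left hyj, mul_neg, neg_neg, mul_assoc, sub_self]
    have hky : k * y = 0 := by
      linear_combination (norm := module) (2⁻¹ : ℝ) • (hyk - hyk')
    have hey : e * y = y := by
      simp only [hy, mul_add, mul_smul_comm, hex, hei, hej, hek]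
    have hy0 : y = 0 := by
      rw [← hey, ← neg_neg e, ← hkk, neg_mul, mul_assoc, hky, mul_zero, neg_zero]
    have hxe : x = -(α / 2) • i + -(β / 2) • j + -(γ / 2) • k := by
      rw [hy] at hy0
      linear_combination (norm := module) hy0
    rw [hxe]
    exact add_mem (add_mem (Submodule.smul_mem _ _ (Submodule.subset_span ⟨1, rfl⟩))
      (Submodule.smul_mem _ _ (Submodule.subset_span ⟨2, rfl⟩)))
      (Submodule.smul_mem _ _ (Submodule.subset_span ⟨3, rfl⟩))

end Finite

/-- Every projection is a sum of minimal ones. -/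
theorem proj_induction (hT : T.IsIntegral) {P : A → Prop} (zero : P 0)
    (min : ∀ e, T.IsMinProj e → P e) (add : ∀ a b, P a → P b → P (a + b)) {p : A}
    (hp : T.IsProj p) : P p := by
  obtain ⟨m, hm⟩ := hT.proj p hp
  induction m using Nat.strong_induction_on generalizing p with
  | _ m ih =>
    by_cases h0 : p = 0
    · rwa [h0]
    by_cases hmin : T.IsMinProj p
    · exact min p hmin
    obtain ⟨q, hq, hpq, hq0, hqp⟩ : ∃ q, T.IsProj q ∧ p * q = q ∧ q ≠ 0 ∧ q ≠ p := by
      by_contra! hcon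
      exact hmin ⟨hp, h0, fun q hq hpq => or_iff_not_imp_left.2 fun hq0 => hcon q hq hpq hq0⟩
    have hqp' := mul_right_of_mul_left hp hq.1 hpq
    have hpq' : T.IsProj (p - q) := by
      refine ⟨by rw [map_sub, hp.1, hq.1], ?_⟩
      rw [mul_sub, sub_mul, sub_mul, hp.2, hpq, hqp', hq.2, sub_self, sub_zero]
    have hpos := tr_proj_pos hq hq0
    have hpos' := tr_proj_pos hpq' (sub_ne_zero.2 hqp.symm)
    obtain ⟨k, hk⟩ := hT.proj q hq
    obtain ⟨l, hl⟩ := hT.proj _ hpq'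
    have hsum : k + l = m := by
      have : (k : ℝ) + l = m := by rw [← hk, ← hl, ← hm, map_sub]; ring
      exact_mod_cast this
    rw [hk] at hpos
    rw [hl] at hpos'
    have hk0 : 0 < k := by exact_mod_cast hpos
    have hl0 : 0 < l := by exact_mod_cast hpos'
    have := add _ _ (ih k (by omega) hq hk) (ih l (by omega) hpq' hl)
    rwa [add_sub_cancel] at this

end TracialStar

namespace TracialStar

variable {A : Type*} [Ring A] [Algebra ℝ A] {T : TracialStar A}

/-- `θ` is the character of a finite-dimensional real representation by matrices compatible with
the involution. -/
def Realizable (T : TracialStar A) (θ : A →ₗ[ℝ] ℝ) : Prop :=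
  ∃ (d : ℕ) (π : A →ₐ[ℝ] Matrix (Fin d) (Fin d) ℝ),
    (∀ a, π (T.st a) = (π a)ᵀ) ∧ ∀ a, trace (π a) = θ a

theorem Realizable.zero : T.Realizable 0 :=
  ⟨0, (AlgHom.ofLinearMap 0 (Subsingleton.elim _ _) fun _ _ => Subsingleton.elim _ _),
    fun _ => Subsingleton.elim _ _, fun a => by simp [trace]⟩

theorem Realizable.add {θ η : A →ₗ[ℝ] ℝ} (hθ : T.Realizable θ) (hη : T.Realizable η) :
    T.Realizable (θ + η) := by
  obtain ⟨d, π, h₁, h₂⟩ := hθ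
  obtain ⟨e, ρ, h₃, h₄⟩ := hη
  refine ⟨d + e, (reindexAlgEquiv ℝ ℝ finSumFinEquiv).toAlgHom.comp
    (AlgHom.ofLinearMap
      { toFun := fun a => fromBlocks (π a) 0 0 (ρ a)
        map_add' := fun a b => by simp [fromBlocks_add]
        map_smul' := fun c a => by simp [fromBlocks_smul] } (by simp)
      (fun a b => by simp [fromBlocks_multiply])), ?_, ?_⟩
  · intro a
    simp [h₁, h₃, fromBlocks_transpose]
  · intro a
    rw [LinearMap.add_apply, ← h₂, ← h₄]
    refine (Equiv.sum_comp finSumFinEquiv.symm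
      fun i => fromBlocks (π a) 0 0 (ρ a) i i).trans ?_
    simp [trace]

theorem Realizable.comm {θ : A →ₗ[ℝ] ℝ} (h : T.Realizable θ) (a b : A) :
    θ (a * b) = θ (b * a) := by
  obtain ⟨d, π, -, h₂⟩ := h
  rw [← h₂, ← h₂, map_mul, map_mul, trace_mul_comm]

theorem Realizable.st {θ : A →ₗ[ℝ] ℝ} (h : T.Realizable θ) (a : A) : θ (T.st a) = θ a := by
  obtain ⟨d, π, h₁, h₂⟩ := h
  rw [← h₂, ← h₂, h₁, trace_transpose]

theorem realizable_of_core {V : Type*} [AddCommGroup V] [Module ℝ V] [Module.Finite ℝ V]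
    (core : InnerProductSpace.Core ℝ V) (L : A →ₐ[ℝ] Module.End ℝ V)
    (h : ∀ a x y, core.inner (L (T.st a) x) y = core.inner x (L a y)) :
    T.Realizable (LinearMap.trace ℝ V ∘ₗ L.toLinearMap) := by
  let _ : NormedAddCommGroup V := core.toNormedAddCommGroup
  let _ : InnerProductSpace ℝ V := InnerProductSpace.ofCore core.toCore
  let b := stdOrthonormalBasis ℝ V
  refine ⟨_, (LinearMap.toMatrixAlgEquiv b.toBasis).toAlgHom.comp L, ?_, ?_⟩
  · intro a
    have hadj : L (T.st a) = LinearMap.adjoint (L a) := by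
      rw [LinearMap.eq_adjoint_iff]
      exact h a
    have := LinearMap.toMatrix_adjoint b b (L a)
    rw [← hadj, conjTranspose_eq_transpose_of_trivial] at this
    exact this
  · intro a
    exact (LinearMap.trace_eq_matrix_trace ℝ b.toBasis (L a)).symm

/-- The left ideal generated by an idempotent. -/
def leftIdeal (e : A) : Submodule ℝ A where
  carrier := {x | x * e = x}
  zero_mem' := by simp
  add_mem' := by
    intro a b (h₁ : a * e = a) (h₂ : b * e = b)
    simp [add_mul, h₁, h₂]
  smul_mem' := by
    intro c a (h : a * e = a)
    simp [h]

/-- Left multiplication on `leftIdeal e`. -/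
def leftMul (e : A) : A →ₐ[ℝ] Module.End ℝ (leftIdeal e) :=
  AlgHom.ofLinearMap
    { toFun := fun a =>
        { toFun := fun x => ⟨a * x, by
            change a * x * e = a * x
            rw [mul_assoc, show (x : A) * e = x from x.2]⟩
          map_add' := fun x y => by ext; simp [mul_add]
          map_smul' := fun c x => by ext; simp }
      map_add' := fun a b => by ext; simp [add_mul]
      map_smul' := fun c x => by ext; simp }
    (by ext; simp) (fun a b => by ext; simp [mul_assoc])

/-- The character of left multiplication on `leftIdeal e`. -/
def character (e : A) : A →ₗ[ℝ] ℝ :=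
  LinearMap.trace ℝ (leftIdeal e) ∘ₗ (leftMul e).toLinearMap

variable [Module.Finite ℝ A]

theorem realizable_character (e : A) : T.Realizable (character e) :=
  realizable_of_core (V := leftIdeal e)
    { inner := fun x y => T.tr (T.st x * y)
      conj_inner_symm := fun x y => by
        change T.tr (T.st y * x) = _
        rw [← T.tr_st, T.st_mul, T.st_st]
      re_inner_nonneg := fun x => by
        by_cases hx : (x : A) = 0
        · simp [hx]
        · exact (T.tr_pos _ hx).le
      add_left := fun x y z => by simp [add_mul]
      smul_left := fun x y r => by simp
      definite := fun x hx => by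
        by_contra h
        exact (T.tr_pos x fun h' => h (Subtype.ext h')).ne' hx } (leftMul e)
    fun a x y => by
      change T.tr (T.st (T.st a * x) * y) = T.tr (T.st x * (a * y))
      rw [T.st_mul, T.st_st, mul_assoc]

theorem trace_eq_finrank {V : Type*} [AddCommGroup V] [Module ℝ V] [Module.Finite ℝ V]
    {p : Submodule ℝ V} {f : V →ₗ[ℝ] V} (h : LinearMap.IsProj p f) :
    LinearMap.trace ℝ V f = Module.finrank ℝ p := h.trace

theorem character_proj {e f : A} (hf : T.IsProj f) :
    character e f = Module.finrank ℝ (corner f e) := by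
  have hle : corner f e ≤ leftIdeal e := fun x hx => hx.2
  have hproj : LinearMap.IsProj ((corner f e).submoduleOf (leftIdeal e)) (leftMul e f) := by
    constructor
    · intro x
      refine ⟨?_, (leftMul e f x).2⟩
      change f * (f * x) = f * x
      rw [← mul_assoc, hf.2]
    · intro x hx
      exact Subtype.ext hx.1
  exact (trace_eq_finrank hproj).trans (by rw [(Submodule.submoduleOfEquivOfLe hle).finrank_eq])

theorem character_of_not_linked {e f : A} (h : ∀ u, f * u = u → u * e = u → u = 0)
    (hf : T.IsProj f) : character e f = 0 := by
  rw [character_proj hf]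
  have : corner f e = ⊥ := by
    rw [eq_bot_iff]
    rintro x ⟨h₁, h₂⟩
    exact h x h₁ h₂
  rw [this, finrank_bot, Nat.cast_zero]

/-- A tracial functional invariant under the involution and integral on minimal projections. -/
structure IsGood (T : TracialStar A) (θ : A →ₗ[ℝ] ℝ) : Prop where
  comm : ∀ a b, θ (a * b) = θ (b * a)
  st : ∀ a, θ (T.st a) = θ a
  int : ∀ e, T.IsMinProj e → ∃ c : ℕ, θ e = c * Module.finrank ℝ (corner e e)

theorem IsMinProj.apply_eq_of_link {θ : A →ₗ[ℝ] ℝ} (hθ : ∀ a b, θ (a * b) = θ (b * a)) {e f u : A}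
    (he : T.IsMinProj e) (hf : T.IsMinProj f)
    (h₁ : f * u = u) (h₂ : u * e = u) (hu : u ≠ 0) : θ f = θ e := by
  obtain ⟨c, hc, h₃, h₄⟩ := he.exists_link hf h₁ h₂ hu
  have := hθ u (T.st u)
  rw [h₃, h₄, map_smul, map_smul, smul_eq_mul, smul_eq_mul] at this
  exact mul_left_cancel₀ hc.ne' this

theorem IsGood.eq_zero {θ : A →ₗ[ℝ] ℝ} (hθ : T.IsGood θ) (hT : T.IsIntegral)
    (h : ∀ e, T.IsMinProj e → θ e = 0) : θ = 0 := by
  have key : ∀ a, θ (a * 1) = 0 := by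
    refine proj_induction (T := T) hT (P := fun p => ∀ a, θ (a * p) = 0) ?_ ?_ ?_ isProj_one
    · simp
    · intro e he a
      set x := e * a * e with hx
      have hθx : θ (a * e) = θ x := by
        rw [hx, hθ.comm (e * a) e, ← mul_assoc, he.1.2, hθ.comm]
      have hex : e * x = x := by rw [hx, ← mul_assoc, ← mul_assoc, he.1.2]
      have hxe : e * T.st x = T.st x := st_mul_of_mul he.1 (by rw [hx, mul_assoc, he.1.2])
      obtain ⟨r, hr⟩ := he.eq_smul (x := x + T.st x) (by rw [map_add, T.st_st, add_comm])
        (by rw [mul_add, hex, hxe])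
      have := congrArg θ hr
      rw [map_add, hθ.st, map_smul, h e he, smul_zero] at this
      linarith
    · intro p q hp hq a
      rw [mul_add, map_add, hp, hq, add_zero]
  ext a
  simpa using key a

theorem IsGood.one_nonneg {θ : A →ₗ[ℝ] ℝ} (hθ : T.IsGood θ) (hT : T.IsIntegral) : 0 ≤ θ 1 := by
  refine proj_induction (T := T) hT (P := fun p => 0 ≤ θ p) (by simp) ?_ ?_ isProj_one
  · intro e he
    obtain ⟨c, hc⟩ := hθ.int e he
    rw [hc]
    positivity
  · intro a b ha hb
    rw [map_add]
    positivity

theorem IsGood.realizable {θ : A →ₗ[ℝ] ℝ} (hθ : T.IsGood θ) (hT : T.IsIntegral) :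
    T.Realizable θ := by
  obtain ⟨N, hN⟩ := exists_nat_gt (θ 1)
  induction N generalizing θ with
  | zero =>
    have := hθ.one_nonneg hT
    simp at hN
    linarith
  | succ N ih =>
    by_cases h0 : ∀ e, T.IsMinProj e → θ e = 0
    · rw [hθ.eq_zero hT h0]
      exact Realizable.zero
    push Not at h0
    obtain ⟨e, he, hθe⟩ := h0
    have hre : T.Realizable (character e) := realizable_character e
    have hgood : T.IsGood (θ - character e) := by
      refine ⟨?_, ?_, ?_⟩
      · intro a b
        rw [LinearMap.sub_apply, LinearMap.sub_apply, hθ.comm, hre.comm]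
      · intro a
        rw [LinearMap.sub_apply, LinearMap.sub_apply, hθ.st, hre.st]
      · intro f hf
        rw [LinearMap.sub_apply]
        by_cases hlink : ∀ u, f * u = u → u * e = u → u = 0
        · rw [character_of_not_linked hlink hf.1, sub_zero]
          exact hθ.int f hf
        · push Not at hlink
          obtain ⟨u, h₁, h₂, hu⟩ := hlink
          obtain ⟨c, hc⟩ := hθ.int e he
          have hc0 : c ≠ 0 := by
            rintro rfl
            simp [hc] at hθe
          refine ⟨c - 1, ?_⟩
          rw [he.apply_eq_of_link hθ.comm hf h₁ h₂ hu, he.apply_eq_of_link hre.comm hf h₁ h₂ hu,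
            character_proj he.1, hc, he.finrank_corner_eq hf h₁ h₂ hu,
            Nat.cast_sub (Nat.one_le_iff_ne_zero.2 hc0)]
          ring
    have h1 : 1 ≤ character e (1 : A) := by
      rw [character_proj (isProj_one (T := T))]
      have : Nontrivial (corner 1 e) :=
        ⟨⟨⟨e, one_mul e, he.1.2⟩, 0, fun h => he.2.1 (congrArg Subtype.val h)⟩⟩
      exact_mod_cast Module.finrank_pos (R := ℝ) (M := corner 1 e)
    have := ih hgood (by
      rw [LinearMap.sub_apply]
      push_cast at hN
      linarith)
    simpa using this.add hre

/-- An integral positive trace is the trace of a representation by real matrices. -/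
theorem IsIntegral.exists_rep (hT : T.IsIntegral) {n : ℕ} (hn : T.tr 1 = n) :
    ∃ π : A →ₐ[ℝ] Matrix (Fin n) (Fin n) ℝ,
      (∀ a, π (T.st a) = (π a)ᵀ) ∧ ∀ a, trace (π a) = T.tr a := by
  have hgood : T.IsGood T.tr :=
    ⟨T.tr_mul_comm, T.tr_st, fun e he => he.exists_tr_eq hT⟩
  obtain ⟨d, π, h₁, h₂⟩ := hgood.realizable hT
  have hd : d = n := by
    have := h₂ 1
    rw [map_one, trace_one, Fintype.card_fin, hn] at this
    exact_mod_cast this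
  subst hd
  exact ⟨π, h₁, h₂⟩

end TracialStar

namespace TracialStar

variable {A : Type*} [Ring A] [Algebra ℝ A] {T : TracialStar A}

/-- `p` behaves as the polynomial `det (1 + X a)` and `N` as the coefficients of the adjugate of
`1 + X a`. -/
structure IsNewton (T : TracialStar A) (a : A) (p : Polynomial ℝ) (N : ℕ → A) : Prop where
  zero : p.coeff 0 = 1
  N_zero : N 0 = 1
  succ : ∀ k : ℕ, (k + 1) * p.coeff (k + 1) = T.tr (N k * a)
  N_succ : ∀ k : ℕ, N (k + 1) = p.coeff (k + 1) • (1 : A) - a * N k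

theorem exists_coeff_eq_zero (s : ℕ → ℝ) (p : Polynomial ℝ) (h0 : s 0 ≠ 0) {d : ℕ} (hd : 0 < d)
    (hs : ∀ k, s k = p.coeff (d * k)) : ∃ k, s k ≠ 0 ∧ s (k + 1) = 0 := by
  by_contra! h
  have : ∀ k, s k ≠ 0 := fun k => by
    induction k with
    | zero => exact h0
    | succ k ih => exact h k ih
  apply this (p.natDegree + 1)
  rw [hs]
  apply Polynomial.coeff_eq_zero_of_natDegree_lt
  nlinarith

theorem IsNewton.proj {e : A} (he : T.IsProj e) {p : Polynomial ℝ} {N : ℕ → A}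
    (h : T.IsNewton e p N) : ∃ k : ℕ, T.tr e = k := by
  obtain ⟨k, hk, hk'⟩ := exists_coeff_eq_zero (fun k => p.coeff k) p (by simp [h.zero]) one_pos
    (by simp)
  refine ⟨k, ?_⟩
  have h1 := h.succ k
  rw [hk', mul_zero] at h1
  cases k with
  | zero => rw [h.N_zero, one_mul] at h1; simpa using h1.symm
  | succ k =>
    rw [h.N_succ, sub_mul, smul_mul_assoc, one_mul, map_sub, map_smul, mul_assoc,
      T.tr_mul_comm, mul_assoc, he.2, ← h.succ, smul_eq_mul] at h1
    apply mul_left_cancel₀ hk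
    push_cast
    linear_combination -h1

theorem tr_eq_zero_of_skew {j : A} (hj : T.st j = -j) : T.tr j = 0 := by
  have := T.tr_st j
  rw [hj, map_neg] at this
  linarith

theorem IsNewton.skew_rec {e j : A} (hej : e * j = j) (hj : T.st j = -j)
    (hjj : j * j = -e) {p : Polynomial ℝ} {N : ℕ → A} (h : T.IsNewton j p N) :
    p.coeff 1 = 0 ∧ ∀ k, (k + 2) * p.coeff (k + 2) = (T.tr e - k) * p.coeff k := by
  have htr := tr_eq_zero_of_skew hj
  have hc : ∀ k, T.tr (N (k + 1) * j) = T.tr (N k * e) := by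
    intro k
    rw [h.N_succ, sub_mul, smul_mul_assoc, one_mul, map_sub, map_smul, htr, mul_assoc,
      T.tr_mul_comm, mul_assoc, hjj, mul_neg, map_neg]
    simp
  refine ⟨?_, ?_⟩
  · have := h.succ 0
    rw [h.N_zero, one_mul, htr] at this
    simpa using this
  · intro k
    have h2 := h.succ (k + 1)
    rw [hc] at h2
    push_cast at h2
    cases k with
    | zero =>
      rw [h.N_zero, one_mul] at h2
      rw [h.zero]
      push_cast at h2 ⊢
      linear_combination h2
    | succ k =>
      rw [h.N_succ, sub_mul, smul_mul_assoc, one_mul, map_sub, map_smul, mul_assoc,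
        T.tr_mul_comm, mul_assoc, hej, ← h.succ, smul_eq_mul] at h2
      push_cast at h2 ⊢
      linear_combination h2

theorem IsNewton.skew {e j : A} (hej : e * j = j) (hj : T.st j = -j)
    (hjj : j * j = -e) {p : Polynomial ℝ} {N : ℕ → A} (h : T.IsNewton j p N) :
    ∃ k : ℕ, T.tr e = 2 * k := by
  obtain ⟨k, hk, hk'⟩ := exists_coeff_eq_zero (fun k => p.coeff (2 * k)) p (by simp [h.zero])
    two_pos (fun _ => rfl)
  have h1 := (h.skew_rec hej hj hjj).2 (2 * k)
  simp only [mul_add, mul_one] at hk'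
  rw [hk', mul_zero] at h1
  refine ⟨k, ?_⟩
  have := (mul_eq_zero.1 h1.symm).resolve_right hk
  push_cast at this
  linarith

open Polynomial in
theorem IsNewton.quat {e j : A} (hej : e * j = j) (hj : T.st j = -j)
    (hjj : j * j = -e) {p q : Polynomial ℝ} {N : ℕ → A} (h : T.IsNewton j p N) (hq : q * q = p) :
    ∃ k : ℕ, T.tr e = 4 * k := by
  obtain ⟨h1, h2⟩ := h.skew_rec hej hj hjj
  have hode : (1 + X ^ 2) * derivative p = C (T.tr e) * (X * p) := by
    ext k
    rw [add_mul, one_mul, coeff_add, coeff_C_mul, coeff_X_pow_mul', coeff_derivative]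
    match k with
    | 0 => simp [h1]
    | 1 =>
      have := h2 0
      simp only [Nat.cast_zero, zero_add, sub_zero] at this
      rw [show X * p = p * X from mul_comm _ _, show 1 = 0 + 1 from rfl, coeff_mul_X]
      simp
      linear_combination this
    | k + 2 =>
      have := h2 (k + 1)
      rw [if_pos (by omega), show k + 2 - 2 = k by omega, coeff_derivative,
        show X * p = p * X from mul_comm _ _, coeff_mul_X]
      push_cast at this ⊢
      linear_combination this
  have hq0 : q.coeff 0 ≠ 0 := by
    intro h0
    have := h.zero
    rw [← hq, mul_coeff_zero, h0, mul_zero] at this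
    exact zero_ne_one this
  have hq1 : q ≠ 0 := fun h0 => hq0 (by simp [h0])
  have hode' : 2 * ((1 + X ^ 2) * derivative q) = C (T.tr e) * (X * q) := by
    apply mul_left_cancel₀ hq1
    rw [← hq, derivative_mul] at hode
    linear_combination hode
  obtain ⟨k, hk, hk'⟩ := exists_coeff_eq_zero (fun k => q.coeff (2 * k)) q (by simpa using hq0)
    two_pos (fun _ => rfl)
  refine ⟨k, ?_⟩
  have h3 := congrArg (fun r => r.coeff (2 * k + 1)) hode'
  simp only [mul_add, mul_one] at hk'
  simp only [add_mul, one_mul, coeff_C_mul, ← C_ofNat, coeff_add, coeff_X_pow_mul',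
    coeff_derivative, show X * q = q * X from mul_comm _ _, coeff_mul_X, hk'] at h3
  apply mul_left_cancel₀ hk
  rcases k with - | k
  · simp at h3 ⊢
    tauto
  · rw [if_pos (by omega), show 2 * (k + 1) + 1 - 2 = 2 * k + 1 by omega] at h3
    push_cast at h3 ⊢
    simp only [show 2 * (k + 1) = 2 * k + 1 + 1 by ring] at h3 ⊢
    linear_combination -h3

/-- Newton polynomials, with square roots for products of two skew elements, force
integrality. -/
theorem isIntegral_of_isNewton (h₁ : ∀ a, ∃ p N, T.IsNewton a p N)
    (h₂ : ∀ i j, T.st i = -i → T.st j = -j → ∃ q N, T.IsNewton (i * j) (q * q) N) :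
    T.IsIntegral where
  proj e he := by
    obtain ⟨p, N, h⟩ := h₁ e
    exact h.proj he
  skew e j _ hej hj hjj := by
    obtain ⟨p, N, h⟩ := h₁ j
    exact h.skew hej hj hjj
  quat e i j he hei hi hii hej hj hjj hij := by
    obtain ⟨q, N, h⟩ := h₂ i j hi hj
    refine h.quat (e := e) (by rw [← mul_assoc, hei]) ?_ ?_ rfl
    · rw [T.st_mul, hi, hj, neg_mul_neg, hij, neg_neg]
    · have hie := mul_right_of_skew he hei hi
      rw [mul_assoc, ← mul_assoc j, ← neg_neg (j * i), ← hij, neg_mul, mul_assoc i j j, hjj,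
        mul_neg, mul_neg, mul_neg, neg_neg, ← mul_assoc, hii, neg_mul, he.2]

/-- Quotient of an algebra with involution and positive semidefinite trace by the kernel of the
trace form. -/
theorem exists_quotient {B : Type*} [Ring B] [Algebra ℝ B] (st : B →ₗ[ℝ] B) (τ : B →ₗ[ℝ] ℝ)
    (st_st : ∀ a, st (st a) = a) (st_mul : ∀ a b, st (a * b) = st b * st a)
    (comm : ∀ a b, τ (a * b) = τ (b * a)) (τ_st : ∀ a, τ (st a) = τ a)
    (nonneg : ∀ a, 0 ≤ τ (st a * a)) :
    ∃ (I : Ideal B) (_ : I.IsTwoSided) (T : TracialStar (B ⧸ I)),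
      (∀ a, a ∈ I ↔ ∀ b, τ (b * a) = 0) ∧
      (∀ a, T.st (Ideal.Quotient.mk I a) = Ideal.Quotient.mk I (st a)) ∧
      ∀ a, T.tr (Ideal.Quotient.mk I a) = τ a := by
  let I : Ideal B :=
    { carrier := {a | ∀ b, τ (b * a) = 0}
      zero_mem' := by simp
      add_mem' := fun {a a'} h h' b => by rw [mul_add, map_add, h, h', add_zero]
      smul_mem' := fun c a h b => by rw [smul_eq_mul, ← mul_assoc, h] }
  have hI : ∀ a, a ∈ I ↔ ∀ b, τ (b * a) = 0 := fun _ => Iff.rfl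
  have : I.IsTwoSided := ⟨fun {a} b ha c => by rw [← mul_assoc, comm, ← mul_assoc, ha]⟩
  have hst : ∀ a ∈ I, st a ∈ I := fun a ha b => by
    rw [← τ_st, st_mul, st_st, comm, ha]
  have hnull : ∀ a, τ (st a * a) = 0 → a ∈ I := by
    intro a ha b
    by_contra h0
    set c := τ (b * a)
    have key : ∀ t : ℝ, 0 ≤ 2 * t * c + t ^ 2 * τ (b * st b) := by
      intro t
      have h1 := nonneg (a + t • st b)
      have h2 : τ (st a * st b) = c := by rw [← st_mul, τ_st]
      simp only [map_add, map_smul, st_st, add_mul, mul_add, smul_mul_assoc, mul_smul_comm, ha,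
        smul_eq_mul, h2] at h1
      nlinarith
    have hd : 0 ≤ τ (b * st b) := by rw [comm]; exact nonneg b
    have h3 := key (-c / (τ (b * st b) + 1))
    have h4 : 2 * (-c / (τ (b * st b) + 1)) * c + (-c / (τ (b * st b) + 1)) ^ 2 * τ (b * st b) =
      -(c ^ 2 * (τ (b * st b) + 2)) / (τ (b * st b) + 1) ^ 2 := by
      field_simp
      ring
    rw [h4, le_div_iff₀ (by positivity), zero_mul] at h3
    have : 0 < c ^ 2 * (τ (b * st b) + 2) := by positivity
    linarith
  refine ⟨I, this,
    { st := (I.restrictScalars ℝ).mapQ (I.restrictScalars ℝ) st (fun a ha => hst a ha)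
      tr := (I.restrictScalars ℝ).liftQ τ (fun a ha => by
        have := ha 1
        rw [one_mul] at this
        exact this)
      st_st := ?_
      st_mul := ?_
      tr_mul_comm := ?_
      tr_st := ?_
      tr_pos := ?_ }, hI, fun _ => rfl, fun _ => rfl⟩
  · intro a
    obtain ⟨a, rfl⟩ := Ideal.Quotient.mk_surjective a
    exact congrArg (Ideal.Quotient.mk I) (st_st a)
  · intro a b
    obtain ⟨a, rfl⟩ := Ideal.Quotient.mk_surjective a
    obtain ⟨b, rfl⟩ := Ideal.Quotient.mk_surjective b
    exact congrArg (Ideal.Quotient.mk I) (st_mul a b)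
  · intro a b
    obtain ⟨a, rfl⟩ := Ideal.Quotient.mk_surjective a
    obtain ⟨b, rfl⟩ := Ideal.Quotient.mk_surjective b
    exact comm a b
  · intro a
    obtain ⟨a, rfl⟩ := Ideal.Quotient.mk_surjective a
    exact τ_st a
  · intro a ha
    obtain ⟨a, rfl⟩ := Ideal.Quotient.mk_surjective a
    refine lt_of_le_of_ne (nonneg a) fun h => ha ?_
    rw [Ideal.Quotient.eq_zero_iff_mem]
    exact hnull a h.symm

end TracialStar

section Jacobi

open Polynomial

variable {R : Type*} [CommRing R] {m : Type*} [Fintype m] [DecidableEq m]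

/-- Jacobi's formula. -/
theorem Matrix.derivative_det (M : Matrix m m R[X]) :
    derivative M.det = trace (M.adjugate * M.map derivative) := by
  have h1 : ∀ j, (M.adjugate * M.map derivative) j j =
      (M.updateCol j fun i => derivative (M i j)).det := by
    intro j
    have := congrFun (cramer_eq_adjugate_mulVec M fun i => derivative (M i j)) j
    rw [cramer_apply] at this
    rw [this]
    rfl
  rw [trace]
  simp only [diag_apply, h1]
  simp only [det_apply, derivative_sum, derivative_smul]
  rw [Finset.sum_comm]
  refine Finset.sum_congr rfl fun σ _ => ?_
  rw [← Finset.smul_sum, derivative_prod_finset]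
  congr 1
  refine Finset.sum_congr rfl fun j _ => ?_
  rw [← Finset.prod_erase_mul _ _ (Finset.mem_univ j), updateCol_self]
  congr 1
  refine Finset.prod_congr rfl fun l hl => ?_
  rw [updateCol_ne (Finset.ne_of_mem_erase hl)]

/-- The polynomial `det (1 + X h)`. -/
def detPoly (h : Matrix m m R) : R[X] := (1 + (X : R[X]) • h.map C).det

/-- The coefficients of the adjugate of `1 + X h`. -/
def adjCoeff (h : Matrix m m R) (k : ℕ) : Matrix m m R :=
  of fun i j => ((1 + (X : R[X]) • h.map C).adjugate i j).coeff k

theorem detPoly_coeff_zero (h : Matrix m m R) : (detPoly h).coeff 0 = 1 := by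
  rw [detPoly, coeff_zero_eq_eval_zero, ← coe_evalRingHom, RingHom.map_det]
  convert det_one (n := m) (R := R)
  ext i j
  by_cases hij : i = j <;> simp [one_apply, hij]

theorem one_add_mul_adjugate_apply (h : Matrix m m R) (i j : m) :
    (1 + (X : R[X]) • h.map C).adjugate i j +
      (∑ l, C (h i l) * (1 + (X : R[X]) • h.map C).adjugate l j) * X =
    C ((1 : Matrix m m R) i j) * detPoly h := by
  have := mul_adjugate (1 + (X : R[X]) • h.map C)
  rw [add_mul, one_mul, smul_mul_assoc] at this
  have := congrFun (congrFun this i) j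
  rw [Matrix.add_apply, Matrix.smul_apply, Matrix.smul_apply, mul_apply, smul_eq_mul, smul_eq_mul, mul_comm] at this
  rw [detPoly, mul_comm (C _)]
  convert this using 2
  · simp
  · rw [one_apply, one_apply]
    split_ifs <;> simp

theorem adjCoeff_zero (h : Matrix m m R) : adjCoeff h 0 = 1 := by
  ext i j
  have := congrArg (fun p => p.coeff 0) (one_add_mul_adjugate_apply h i j)
  simp only [coeff_add, mul_coeff_zero, coeff_X_zero, mul_zero, add_zero, coeff_C_zero,
    detPoly_coeff_zero, mul_one] at this
  exact this

theorem adjCoeff_succ (h : Matrix m m R) (k : ℕ) :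
    adjCoeff h (k + 1) = (detPoly h).coeff (k + 1) • 1 - h * adjCoeff h k := by
  ext i j
  have := congrArg (fun p => p.coeff (k + 1)) (one_add_mul_adjugate_apply h i j)
  simp only [coeff_add, coeff_mul_X, coeff_C_mul, finsetSum_coeff] at this
  rw [Matrix.sub_apply, Matrix.smul_apply, smul_eq_mul, mul_apply, mul_comm, ← this]
  exact (add_sub_cancel_right _ _).symm

theorem trace_adjCoeff_mul (h : Matrix m m R) (k : ℕ) :
    trace (adjCoeff h k * h) = (k + 1) * (detPoly h).coeff (k + 1) := by
  have h1 : derivative (detPoly h) = _ := Matrix.derivative_det (1 + (X : R[X]) • h.map C)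
  have h2 : (1 + (X : R[X]) • h.map C).map derivative = h.map C := by
    ext1 i j
    by_cases hij : i = j <;> simp [one_apply, hij]
  rw [h2] at h1
  have := congrArg (fun p => p.coeff k) h1
  simp only [coeff_derivative, trace, mul_apply, finsetSum_coeff, diag_apply, map_apply,
    coeff_mul_C] at this
  rw [mul_comm, this]
  simp [trace, mul_apply, adjCoeff]

end Jacobi

section Skew

/-- The determinant of a skew-symmetric matrix over a field is a square. -/
theorem Matrix.isSquare_det_of_skew {F : Type*} [Field F] [NeZero (2 : F)] (N : ℕ) :
    ∀ (m : ℕ), m < N → ∀ S : Matrix (Fin m) (Fin m) F, Sᵀ = -S → IsSquare S.det := by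
  induction N with
  | zero => intro m hm; omega
  | succ N ih =>
    intro m hm S hS
    have hS' : ∀ i j, S j i = -S i j := fun i j => congrFun (congrFun hS i) j
    have hdiag : ∀ i, S i i = 0 := by
      intro i
      have h1 := hS' i i
      have h2 : (2 : F) * S i i = 0 := by linear_combination h1
      exact (mul_eq_zero.1 h2).resolve_left (NeZero.ne 2)
    by_cases h0 : S = 0
    · subst h0
      rcases m with - | m
      · exact ⟨1, by simp⟩
      · exact ⟨0, by simp⟩
    obtain ⟨i, j, hij⟩ : ∃ i j, S i j ≠ 0 := by
      by_contra! hcon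
      exact h0 (by ext i j; exact hcon i j)
    have hne : i ≠ j := by
      rintro rfl
      exact hij (hdiag i)
    obtain ⟨k, rfl⟩ : ∃ k, m = k + 2 := by
      rcases m with - | - | m
      · exact i.elim0
      · exact absurd (Fin.subsingleton_one.elim i j) hne
      · exact ⟨m, rfl⟩
    let e₁ : Fin 2 ⊕ Fin k ≃ Fin (k + 2) := finSumFinEquiv.trans (finCongr (add_comm 2 k))
    obtain ⟨e, he₀, he₁⟩ : ∃ e : Fin 2 ⊕ Fin k ≃ Fin (k + 2), e (Sum.inl 0) = i ∧
        e (Sum.inl 1) = j := by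
      let e₂ := e₁.trans (Equiv.swap (e₁ (Sum.inl 0)) i)
      have h1 : e₂ (Sum.inl 0) = i := Equiv.swap_apply_left (e₁ (Sum.inl 0)) i
      refine ⟨e₂.trans (Equiv.swap (e₂ (Sum.inl 1)) j), ?_,
        Equiv.swap_apply_left (e₂ (Sum.inl 1)) j⟩
      rw [Equiv.trans_apply, h1]
      refine Equiv.swap_apply_of_ne_of_ne ?_ hne
      rw [← h1]
      exact fun h => by simpa using e₂.injective h
    rw [← det_submatrix_equiv_self e S]
    set M := S.submatrix e e with hM
    have hMs : ∀ a b, M b a = -M a b := fun a b => hS' _ _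
    have hM00 : ∀ a, M a a = 0 := fun a => hdiag _
    set c := M (Sum.inl 0) (Sum.inl 1) with hc
    have hc0 : c ≠ 0 := by
      rw [hc, hM, submatrix_apply, he₀, he₁]
      exact hij
    have hA : M.toBlocks₁₁ = !![0, c; -c, 0] := by
      ext a b
      fin_cases a <;> fin_cases b <;> simp [toBlocks₁₁, hM00, hMs (Sum.inl 0) (Sum.inl 1), ← hc]
    have hAdet : M.toBlocks₁₁.det = c * c := by
      rw [hA, det_fin_two_of]
      ring
    have hinv : Invertible M.toBlocks₁₁ := by
      apply invertibleOfIsUnitDet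
      rw [hAdet]
      exact (mul_ne_zero hc0 hc0).isUnit
    have hAt : M.toBlocks₁₁ᵀ = -M.toBlocks₁₁ := by
      ext a b
      exact hMs _ _
    rw [← fromBlocks_toBlocks M, det_fromBlocks₁₁, hAdet]
    refine IsSquare.mul ⟨c, rfl⟩ (ih k (by omega) _ ?_)
    have h12 : M.toBlocks₂₁ᵀ = -M.toBlocks₁₂ := by
      ext a b
      exact hMs _ _
    have h21 : M.toBlocks₁₂ᵀ = -M.toBlocks₂₁ := by
      ext a b
      exact hMs _ _
    have h22 : M.toBlocks₂₂ᵀ = -M.toBlocks₂₂ := by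
      ext a b
      exact hMs _ _
    rw [transpose_sub, transpose_mul, transpose_mul, h12, h21, h22, invOf_eq_nonsing_inv,
      transpose_nonsing_inv, hAt]
    have : (-M.toBlocks₁₁)⁻¹ = -M.toBlocks₁₁⁻¹ := by
      apply inv_eq_right_inv
      rw [neg_mul_neg, mul_nonsing_inv]
      rw [hAdet]
      exact (mul_ne_zero hc0 hc0).isUnit
    rw [this]
    simp only [Matrix.mul_neg, Matrix.neg_mul, neg_neg, Matrix.mul_assoc]
    abel

theorem Matrix.det_one_add_mul_eq {R : Type*} [CommRing R] {m : Type*} [Fintype m] [DecidableEq m]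
    (a b : Matrix m m R) : (1 + a * b).det = (fromBlocks a (-1) 1 b).det := by
  have h : fromBlocks a (-1) 1 b * (fromBlocks 1 (-b) 0 1 * (fromBlocks 1 1 0 1 *
      (fromBlocks 1 0 (-1) 1 * fromBlocks 1 1 0 1))) = fromBlocks (1 + a * b) a 0 1 := by
    simp [fromBlocks_multiply, add_comm]
  have := congrArg det h
  simp only [det_mul, det_fromBlocks_zero₂₁, det_fromBlocks_zero₁₂, det_one, mul_one] at this
  exact this.symm

end Skew

/-- More than `n²` real `n × n` matrices have vanishing Gram determinant. -/
theorem Matrix.det_gram_eq_zero {R : Type*} [CommRing R] {n : ℕ}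
    (h : Option (Fin n × Fin n) → Matrix (Fin n) (Fin n) R) :
    (of fun i j => trace ((h i)ᵀ * h j)).det = 0 := by
  let H : Matrix (Option (Fin n × Fin n)) (Option (Fin n × Fin n)) R :=
    of fun i j => j.elim 0 fun p => h i p.1 p.2
  have : (of fun i j => trace ((h i)ᵀ * h j)) = H * Hᵀ := by
    ext i j
    simp [H, trace, mul_apply, Fintype.sum_option, Fintype.sum_prod_type]
    exact Finset.sum_comm
  rw [this, det_mul, det_eq_zero_of_column_eq_zero none (fun _ => rfl), zero_mul]

section SquareRoots

open Polynomial

theorem Matrix.isSquare_det_of_skew' {R : Type*} [CommRing R] [IsDomain R] [IsIntegrallyClosed R]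
    [NeZero (2 : R)] {m : Type*} [Fintype m] [DecidableEq m] (S : Matrix m m R) (hS : Sᵀ = -S) :
    IsSquare S.det := by
  let e := Fintype.equivFin m
  let f := algebraMap R (FractionRing R)
  have hf : Function.Injective f := IsFractionRing.injective R (FractionRing R)
  have : NeZero (2 : FractionRing R) := ⟨fun h => NeZero.ne (2 : R) (hf ((map_ofNat f 2).trans (h.trans (map_zero f).symm)))⟩
  obtain ⟨x, hx⟩ := Matrix.isSquare_det_of_skew (F := FractionRing R) _ (Fintype.card m)
    (Nat.lt_succ_self _) (f.mapMatrix (S.submatrix e.symm e.symm)) (by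
      ext i j
      have := congrFun (congrFun hS (e.symm i)) (e.symm j)
      simpa using congrArg f this)
  rw [← RingHom.map_det, det_submatrix_equiv_self] at hx
  have hint : IsIntegral R x := by
    refine ⟨Polynomial.X ^ 2 - Polynomial.C S.det, Polynomial.monic_X_pow_sub_C _ two_ne_zero, ?_⟩
    simp only [eval₂_sub, eval₂_X_pow, eval₂_C]
    rw [sub_eq_zero, sq]
    exact hx.symm
  obtain ⟨y, rfl⟩ := IsIntegrallyClosed.isIntegral_iff.1 hint
  refine ⟨y, hf ?_⟩
  rw [hx, map_mul]

theorem exists_sqrt_detPoly {σ : Type*} {n : ℕ} (a b : Matrix (Fin n) (Fin n) (MvPolynomial σ ℝ))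
    (ha : aᵀ = -a) (hb : bᵀ = -b) :
    ∃ Q : (MvPolynomial σ ℝ)[X], detPoly (a * b) = Q * Q ∧ Q.coeff 0 = 1 := by
  have h1 : detPoly (a * b) =
      (fromBlocks ((X : (MvPolynomial σ ℝ)[X]) • a.map C) (-1) 1 (b.map C)).det := by
    rw [← Matrix.det_one_add_mul_eq, detPoly, smul_mul_assoc, Matrix.map_mul]
  have ha' : (a.map (C : MvPolynomial σ ℝ →+* _))ᵀ = -a.map C := by
    rw [← transpose_map, ha]
    ext1 i j
    simp
  have hb' : (b.map (C : MvPolynomial σ ℝ →+* _))ᵀ = -b.map C := by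
    rw [← transpose_map, hb]
    ext1 i j
    simp
  have : NeZero (2 : (MvPolynomial σ ℝ)[X]) := ⟨two_ne_zero⟩
  obtain ⟨Q, hQ⟩ := Matrix.isSquare_det_of_skew'
    (fromBlocks ((X : (MvPolynomial σ ℝ)[X]) • a.map C) (-1) 1 (b.map C)) (by
      rw [fromBlocks_transpose, transpose_smul, ha', hb', fromBlocks_neg]
      simp)
  rw [← h1] at hQ
  have h0 : Q.coeff 0 * Q.coeff 0 = 1 := by
    rw [← mul_coeff_zero, ← hQ, detPoly_coeff_zero]
  rcases mul_self_eq_one_iff.1 h0 with h | h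
  · exact ⟨Q, hQ, h⟩
  · exact ⟨-Q, by rw [hQ]; ring, by rw [coeff_neg, h, neg_neg]⟩

theorem coeff_mem_of_mul_self {R : Type*} [CommRing R] [Algebra ℝ R] (C₀ : Subalgebra ℝ R)
    {Q : R[X]} (h0 : Q.coeff 0 = 1) (h : ∀ k, (Q * Q).coeff k ∈ C₀) (k : ℕ) : Q.coeff k ∈ C₀ := by
  induction k using Nat.strong_induction_on with
  | _ k ih =>
    rcases k with - | k
    · rw [h0]; exact one_mem _
    have h1 := h (k + 1)
    rw [coeff_mul, Finset.Nat.sum_antidiagonal_succ, h0, one_mul] at h1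
    rcases k with - | k
    · simp only [Finset.Nat.antidiagonal_zero, Finset.sum_singleton, h0, zero_add, mul_one] at h1
      have h2 : Q.coeff 1 = (2⁻¹ : ℝ) • (Q.coeff 1 + Q.coeff 1) := by module
      rw [zero_add, h2]
      exact Subalgebra.smul_mem _ h1 _
    · rw [Finset.Nat.sum_antidiagonal_succ', h0, mul_one] at h1
      have h2 : ∑ p ∈ Finset.HasAntidiagonal.antidiagonal k, Q.coeff (p.1 + 1) * Q.coeff (p.2 + 1) ∈ C₀ := by
        refine sum_mem fun p hp => ?_
        have := Finset.HasAntidiagonal.mem_antidiagonal.1 hp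
        exact mul_mem (ih _ (by omega)) (ih _ (by omega))
      have h3 := Subalgebra.smul_mem _ (sub_mem h1 h2) (2⁻¹ : ℝ)
      convert h3 using 1
      module

end SquareRoots

section Newton

open Polynomial

variable {n g : ℕ}

theorem detPoly_coeff_mem {h : MatP n g} (hh : h ∈ traceRing n g) (k : ℕ) :
    (detPoly h).coeff k ∈ traceSubalgebra n g ∧ adjCoeff h k ∈ traceRing n g := by
  induction k with
  | zero =>
    rw [detPoly_coeff_zero, adjCoeff_zero]
    exact ⟨one_mem _, one_mem _⟩
  | succ k ih =>
    have h1 := trace_mem_traceSubalgebra (mul_mem ih.2 hh)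
    rw [trace_adjCoeff_mul] at h1
    have h2 : (detPoly h).coeff (k + 1) ∈ traceSubalgebra n g := by
      have h3 := Subalgebra.smul_mem _ h1 ((k + 1 : ℝ)⁻¹)
      convert h3 using 1
      have : ((k + 1 : PolyRing n g)) = algebraMap ℝ _ (k + 1 : ℝ) := by simp
      rw [this, ← Algebra.smul_def, smul_smul, inv_mul_cancel₀ (by positivity), one_smul]
    refine ⟨h2, ?_⟩
    rw [adjCoeff_succ]
    exact sub_mem (smul_one_mem_traceRing h2) (mul_mem hh ih.2)

theorem exists_lift_of_coeff_mem {R : Type*} [CommRing R] [Algebra ℝ R] {C₀ : Subalgebra ℝ R}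
    {p : R[X]} (hp : ∀ k, p.coeff k ∈ C₀) : ∃ p' : C₀[X], p'.map (algebraMap C₀ R) = p :=
  (mem_lifts _).1 ((lifts_iff_coeff_lifts p).2 fun k => ⟨⟨_, hp k⟩, rfl⟩)

end Newton

section ProcesiSchwarz

open Polynomial

variable {n g : ℕ}

/-- The functional induced by an `ℝ`-algebra map on the subalgebra of traces. -/
def traceFunctional (φ : traceSubalgebra n g →ₐ[ℝ] ℝ) : traceRing n g →ₗ[ℝ] ℝ where
  toFun h := φ ⟨trace h.1, trace_mem_traceSubalgebra h.2⟩
  map_add' h k := by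
    rw [← map_add]
    exact congrArg φ (Subtype.ext (trace_add h.1 k.1))
  map_smul' r h := by
    rw [RingHom.id_apply, ← map_smul]
    exact congrArg φ (Subtype.ext (trace_smul r h.1))

theorem traceFunctional_apply (φ : traceSubalgebra n g →ₐ[ℝ] ℝ) (h : traceRing n g) :
    traceFunctional φ h = φ ⟨trace h.1, trace_mem_traceSubalgebra h.2⟩ := rfl

/-- The transposition of the trace ring. -/
def traceTranspose (n g : ℕ) : traceRing n g →ₗ[ℝ] traceRing n g where
  toFun h := ⟨h.1ᵀ, transpose_mem_traceRing h.2⟩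
  map_add' _ _ := rfl
  map_smul' _ _ := rfl

/-- Trace polynomials form a module over the traces. -/
def traceSmul (c : traceSubalgebra n g) : traceRing n g :=
  ⟨c.1 • 1, smul_one_mem_traceRing c.2⟩

theorem traceFunctional_traceSmul_mul (φ : traceSubalgebra n g →ₐ[ℝ] ℝ) (c : traceSubalgebra n g)
    (b : traceRing n g) : traceFunctional φ (traceSmul c * b) = φ c * traceFunctional φ b := by
  rw [traceFunctional_apply, traceFunctional_apply, ← map_mul]
  refine congrArg φ (Subtype.ext ?_)
  change trace ((c.1 • (1 : MatP n g)) * b.1) = c.1 * trace b.1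
  rw [smul_mul_assoc, one_mul, trace_smul, smul_eq_mul]

/-- The Gram matrix of a family of trace polynomials. -/
def gramMatrix {κ : Type*} (b : κ → traceRing n g) : Matrix κ κ (traceSubalgebra n g) :=
  of fun i j => ⟨trace ((b i).1ᵀ * (b j).1),
    trace_mem_traceSubalgebra (mul_mem (transpose_mem_traceRing (b i).2) (b j).2)⟩

theorem det_gramMatrix_eq_zero (b : Option (Fin n × Fin n) → traceRing n g) :
    (gramMatrix b).det = 0 :=
  Subtype.val_injective (((algebraMap (traceSubalgebra n g) (PolyRing n g)).map_det
    (gramMatrix b)).trans (Matrix.det_gram_eq_zero fun i => (b i).1))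

theorem TracialStar.finite_of_det_gram_eq_zero {A : Type*} [Ring A] [Algebra ℝ A]
    (T : TracialStar A) {κ : Type*} [Fintype κ] [DecidableEq κ]
    (hdet : ∀ v : κ → A, (of fun i j => T.tr (T.st (v i) * v j)).det = 0) :
    Module.Finite ℝ A := by
  have hdep : ∀ v : κ → A, ¬ LinearIndependent ℝ v := by
    intro v hv
    obtain ⟨w, hw0, hw⟩ := Matrix.exists_mulVec_eq_zero_iff.2 (hdet v)
    have hx : ∀ i, T.tr (T.st (v i) * ∑ j, w j • v j) = 0 := by
      intro i
      have := congrFun hw i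
      rw [mulVec, dotProduct] at this
      rw [Finset.mul_sum, map_sum]
      refine Eq.trans (Finset.sum_congr rfl fun j _ => ?_) this
      rw [mul_smul_comm, map_smul, of_apply, smul_eq_mul, mul_comm]
    have hsum : ∑ i, w i • v i = 0 := by
      by_contra h0
      refine (T.tr_pos _ h0).ne' ?_
      rw [map_sum T.st, Finset.sum_mul, map_sum]
      refine Finset.sum_eq_zero fun i _ => ?_
      rw [map_smul, smul_mul_assoc, map_smul, hx, smul_zero]
    exact hw0 (funext fun i => Fintype.linearIndependent_iff.1 hv w hsum i)
  rw [← Module.rank_lt_aleph0_iff]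
  refine lt_of_le_of_lt (rank_le (n := Fintype.card κ) fun s hs => ?_) Cardinal.natCast_lt_aleph0
  by_contra! hcon
  obtain ⟨e⟩ : Nonempty (κ ↪ s) := by
    rw [Function.Embedding.nonempty_iff_card_le, Fintype.card_coe]
    exact hcon.le
  exact hdep _ (hs.comp e e.injective)

/-- Ring homomorphisms from the traces to the reals that are nonnegative on the traces of hermitian
squares are evaluations. -/
theorem exists_evalPoly_eq (φ : traceSubalgebra n g →ₐ[ℝ] ℝ)
    (hφ : ∀ h : traceRing n g, 0 ≤ traceFunctional φ (traceTranspose n g h * h)) :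
    ∃ X : Fin g → Matrix (Fin n) (Fin n) ℝ, ∀ c : traceSubalgebra n g, evalPoly X c.1 = φ c := by
  obtain ⟨I, hI2, T, hI, hst, htr⟩ := TracialStar.exists_quotient (traceTranspose n g)
    (traceFunctional φ) (fun a => Subtype.ext (transpose_transpose _))
    (fun a b => Subtype.ext (transpose_mul _ _))
    (fun a b => congrArg φ (Subtype.ext (trace_mul_comm a.1 b.1)))
    (fun a => congrArg φ (Subtype.ext (trace_transpose a.1))) hφ
  set q := Ideal.Quotient.mk I with hq
  have hqsmul : ∀ (r : ℝ) b, q (r • b) = r • q b := fun r b => rfl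
  have hscal : ∀ c, q (traceSmul c) = φ c • 1 := by
    intro c
    rw [← map_one q, ← hqsmul, hq, Ideal.Quotient.mk_eq_mk_iff_sub_mem, hI]
    intro b
    rw [mul_sub, map_sub, mul_smul_comm, mul_one, map_smul, smul_eq_mul,
      ← traceFunctional_traceSmul_mul, sub_eq_zero]
    exact congrArg φ (Subtype.ext (trace_mul_comm b.1 (traceSmul c).1))
  -- `det (1 + X h)` and the adjugate
  have hnewton : ∀ (h : traceRing n g) (p : (traceSubalgebra n g)[X]),
      p.map (algebraMap _ (PolyRing n g)) = detPoly h.1 →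
      ∃ N, T.IsNewton (q h) (p.map (φ : traceSubalgebra n g →+* ℝ)) N := by
    intro h p hp
    have hc : ∀ k, (p.coeff k).1 = (detPoly h.1).coeff k := fun k => by
      rw [← hp, coeff_map]; rfl
    refine ⟨fun k => q ⟨adjCoeff h.1 k, (detPoly_coeff_mem h.2 k).2⟩, ?_, ?_, ?_, ?_⟩
    · have : p.coeff 0 = 1 := Subtype.ext (by rw [hc, detPoly_coeff_zero]; rfl)
      rw [coeff_map, this, map_one]
    · rw [← map_one q]
      exact congrArg q (Subtype.ext (adjCoeff_zero _))
    · intro k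
      rw [← map_mul q, htr, traceFunctional_apply, coeff_map]
      have : (⟨trace (adjCoeff h.1 k * h.1), trace_mem_traceSubalgebra
          (mul_mem (detPoly_coeff_mem h.2 k).2 h.2)⟩ : traceSubalgebra n g) =
          (k + 1) * p.coeff (k + 1) := by
        refine Subtype.ext ?_
        change trace (adjCoeff h.1 k * h.1) = (k + 1) * (p.coeff (k + 1)).1
        rw [trace_adjCoeff_mul, hc]
      refine Eq.trans ?_ (congrArg φ this).symm
      simp
    · intro k
      rw [coeff_map]
      change _ = φ (p.coeff (k + 1)) • 1 - _
      rw [← hscal, ← map_mul q, ← map_sub]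
      refine congrArg q (Subtype.ext ?_)
      change adjCoeff h.1 (k + 1) = (p.coeff (k + 1)).1 • 1 - h.1 * adjCoeff h.1 k
      rw [adjCoeff_succ, hc]
  have hskew : ∀ i, T.st i = -i → ∃ b : traceRing n g, q b = i ∧ b.1ᵀ = -b.1 := by
    intro i hi
    obtain ⟨b, rfl⟩ := Ideal.Quotient.mk_surjective i
    refine ⟨(2⁻¹ : ℝ) • (b - traceTranspose n g b), ?_, ?_⟩
    · rw [hqsmul, map_sub, ← hst, hi]
      module
    · change ((2⁻¹ : ℝ) • (b.1 - b.1ᵀ))ᵀ = -((2⁻¹ : ℝ) • (b.1 - b.1ᵀ))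
      rw [transpose_smul, transpose_sub, transpose_transpose]
      module
  have hint : T.IsIntegral := by
    refine TracialStar.isIntegral_of_isNewton ?_ ?_
    · intro a
      obtain ⟨b, rfl⟩ := Ideal.Quotient.mk_surjective a
      obtain ⟨p, hp⟩ := exists_lift_of_coeff_mem fun k => (detPoly_coeff_mem b.2 k).1
      exact ⟨_, hnewton b p hp⟩
    · intro i j hi hj
      obtain ⟨a, rfl, ha⟩ := hskew i hi
      obtain ⟨b, rfl, hb⟩ := hskew j hj
      obtain ⟨Q, hQ, hQ0⟩ := exists_sqrt_detPoly a.1 b.1 ha hb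
      obtain ⟨p, hp⟩ := exists_lift_of_coeff_mem (coeff_mem_of_mul_self (traceSubalgebra n g) hQ0
        fun k => by
          rw [← hQ]
          exact (detPoly_coeff_mem (mul_mem a.2 b.2) k).1)
      refine ⟨p.map (φ : traceSubalgebra n g →+* ℝ), ?_⟩
      rw [← map_mul q, ← Polynomial.map_mul]
      refine hnewton (a * b) (p * p) ?_
      rw [Polynomial.map_mul, hp, ← hQ]
      rfl
  have hfin : Module.Finite ℝ (traceRing n g ⧸ I) := by
    refine T.finite_of_det_gram_eq_zero (κ := Option (Fin n × Fin n)) fun v => ?_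
    choose b hb using fun i => Ideal.Quotient.mk_surjective (v i)
    have hGe : (of fun i j => T.tr (T.st (v i) * v j)) = (gramMatrix b).map φ := by
      ext i j
      rw [of_apply, ← hb i, ← hb j, hst, ← map_mul, htr]
      rfl
    have := φ.map_det (gramMatrix b)
    rw [det_gramMatrix_eq_zero, map_zero] at this
    rw [hGe]
    exact this.symm
  have hone : T.tr 1 = n := by
    rw [← map_one q, htr, traceFunctional_apply]
    have : (⟨trace (1 : traceRing n g).1, trace_mem_traceSubalgebra (1 : traceRing n g).2⟩ :
      traceSubalgebra n g) = n := Subtype.ext (by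
        change trace (1 : MatP n g) = _
        simp)
    exact (congrArg φ this).trans (map_natCast φ n)
  obtain ⟨π, hπst, hπtr⟩ := hint.exists_rep hone
  have hΞ : ∀ j, genMat n g j ∈ traceRing n g := fun j =>
    Algebra.subset_adjoin (.inl (.inl ⟨j, rfl⟩))
  refine ⟨fun j => π (q ⟨genMat n g j, hΞ j⟩), ?_⟩
  set X : Fin g → Matrix (Fin n) (Fin n) ℝ := fun j => π (q ⟨genMat n g j, hΞ j⟩) with hX
  have hgen : ∀ j, evalMat n g X (genMat n g j) = X j := by
    intro j
    ext a b
    simp [evalMat, genMat]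
  have hword : ∀ w (hw : w ∈ Submonoid.closure (genSet n g)),
      π (q ⟨w, mem_traceRing_of_mem_closure hw⟩) = evalMat n g X w := by
    intro w hw
    induction hw using Submonoid.closure_induction with
    | mem x hx =>
      rcases hx with ⟨j, rfl⟩ | ⟨j, rfl⟩
      · rw [hgen]
      · rw [evalMat_transpose, hgen, hX, ← hπst, hst]
        rfl
    | one =>
      rw [evalMat_one, ← map_one π, ← map_one q]
      rfl
    | mul x y hx hy ihx ihy =>
      rw [evalMat_mul, ← ihx, ← ihy, ← map_mul, ← map_mul]
      rfl
  rintro ⟨c, hc⟩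
  induction hc using Algebra.adjoin_induction with
  | mem x hx =>
    obtain ⟨w, hw, rfl⟩ := hx
    rw [← evalMat_trace, ← hword w hw, hπtr, htr]
    rfl
  | algebraMap r =>
    rw [AlgHom.commutes]
    exact (φ.commutes r).symm
  | add x y hx hy ihx ihy =>
    rw [map_add, ihx, ihy, ← map_add]
    rfl
  | mul x y hx hy ihx ihy =>
    rw [map_mul, ihx, ihy, ← map_mul]
    rfl

end ProcesiSchwarz

section Diagonalization

theorem Matrix.posSemidef_of_trace_nonneg {m : Type*} [Fintype m] [DecidableEq m]
    {A : Matrix m m ℝ} (hA : A.IsHermitian)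
    (h : ∀ p : Polynomial ℝ, 0 ≤ trace (Polynomial.aeval A p * A * Polynomial.aeval A p)) :
    A.PosSemidef := by
  have htr : ∀ q : Polynomial ℝ, trace (Polynomial.aeval A q) =
      ∑ i, q.eval (hA.eigenvalues i) := by
    intro q
    let ψ := Unitary.conjStarAlgAut ℝ _ hA.eigenvectorUnitary
    have h1 : A = ψ (diagonal hA.eigenvalues) := hA.spectral_theorem
    have h2 : Polynomial.aeval A q = ψ (Polynomial.aeval (diagonal hA.eigenvalues) q) := by
      conv_lhs => rw [h1]
      exact Polynomial.aeval_algHom_apply (ψ : Matrix m m ℝ →ₐ[ℝ] Matrix m m ℝ) _ q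
    have h3 : Polynomial.aeval (diagonal hA.eigenvalues) q =
        diagonal (fun i => q.eval (hA.eigenvalues i)) := by
      have := Polynomial.aeval_algHom_apply (diagonalAlgHom (n := m) (α := ℝ) ℝ) hA.eigenvalues q
      refine Eq.trans this ?_
      change diagonal _ = _
      congr 1
      ext i
      have := Polynomial.aeval_algHom_apply (Pi.evalAlgHom ℝ (fun _ : m => ℝ) i) hA.eigenvalues q
      exact this.symm
    rw [h2, h3, Unitary.conjStarAlgAut_apply, trace_mul_cycle, Unitary.coe_star_mul_self, one_mul,
      trace_diagonal]
  rw [hA.posSemidef_iff_eigenvalues_nonneg]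
  intro i
  by_contra! hi
  rw [Pi.zero_apply] at hi
  set c := hA.eigenvalues i
  let p : Polynomial ℝ := ∏ μ ∈ (Finset.univ.image hA.eigenvalues).erase c,
    (Polynomial.X - Polynomial.C μ)
  have hp0 : ∀ j, hA.eigenvalues j ≠ c → p.eval (hA.eigenvalues j) = 0 := by
    intro j hj
    rw [Polynomial.eval_prod]
    refine Finset.prod_eq_zero (i := hA.eigenvalues j) (by simp [hj]) (by simp)
  have hp1 : p.eval c ≠ 0 := by
    rw [Polynomial.eval_prod, Finset.prod_ne_zero_iff]
    intro μ hμ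
    rw [Polynomial.eval_sub, Polynomial.eval_X, Polynomial.eval_C, sub_ne_zero]
    exact (Finset.ne_of_mem_erase hμ).symm
  have h1 := h p
  have h2 : Polynomial.aeval A p * A * Polynomial.aeval A p =
      Polynomial.aeval A (p * Polynomial.X * p) := by simp
  rw [h2, htr] at h1
  refine h1.not_gt (Finset.sum_neg' (fun j _ => ?_) ⟨i, Finset.mem_univ _, ?_⟩)
  · simp only [Polynomial.eval_mul, Polynomial.eval_X]
    by_cases hj : hA.eigenvalues j = c
    · rw [hj]
      nlinarith [mul_self_nonneg (p.eval c)]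
    · rw [hp0 j hj]; simp
  · simp only [Polynomial.eval_mul, Polynomial.eval_X]
    change p.eval c * c * p.eval c < 0
    nlinarith [mul_self_pos.2 hp1]

theorem Matrix.exists_diagonalization {K : Type*} [Field K] [LinearOrder K] [IsStrictOrderedRing K]
    {r : ℕ} (M : Matrix (Fin r) (Fin r) K) (hM : Mᵀ = M) (hpos : ∀ x, 0 ≤ x ⬝ᵥ M *ᵥ x) :
    ∃ (m : ℕ) (d : Fin m → K) (L : Matrix (Fin m) (Fin r) K), (∀ l, 0 ≤ d l) ∧
      ∀ x, x ⬝ᵥ M *ᵥ x = ∑ l, d l * ((L *ᵥ x) l * (L *ᵥ x) l) := by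
  have : Invertible (2 : K) := invertibleOfNonzero two_ne_zero
  let B : (Fin r → K) →ₗ[K] (Fin r → K) →ₗ[K] K := Matrix.toBilin' M
  have hB : LinearMap.IsSymm B := ⟨fun x y => by
    simp only [B, Matrix.toBilin'_apply']
    rw [dotProduct_mulVec, ← mulVec_transpose, hM, dotProduct_comm]
    rfl⟩
  obtain ⟨v, hv⟩ := LinearMap.BilinForm.exists_orthogonal_basis hB
  refine ⟨_, fun l => B (v l) (v l), LinearMap.toMatrix' v.equivFun.toLinearMap, fun l => ?_,
    fun x => ?_⟩
  · simp only [B, Matrix.toBilin'_apply']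
    exact hpos _
  · have h1 : x ⬝ᵥ M *ᵥ x = B x x := by simp only [B, Matrix.toBilin'_apply']
    have h2 : ∀ l, (LinearMap.toMatrix' v.equivFun.toLinearMap *ᵥ x) l = v.equivFun x l := by
      intro l
      rw [LinearMap.toMatrix'_mulVec]
      rfl
    simp only [h2]
    rw [h1]
    conv_lhs => rw [← v.sum_equivFun x]
    simp only [map_sum, LinearMap.sum_apply, map_smul, LinearMap.smul_apply, smul_eq_mul]
    refine Finset.sum_congr rfl fun l _ => ?_
    rw [Finset.sum_eq_single l]
    · ring
    · intro k _ hk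
      rw [hv hk]
      simp
    · simp

end Diagonalization

/-- The Artin–Lang homomorphism theorem. -/
theorem exists_algHom_adjoin {K : Type u} [Field K] [LinearOrder K] [IsStrictOrderedRing K]
    [Algebra ℝ K] {Y : Set K} (hY : Y.Finite) :
    ∃ ρ : Algebra.adjoin ℝ Y →ₐ[ℝ] ℝ,
      ∀ y (hy : y ∈ Y), 0 ≤ y → 0 ≤ ρ ⟨y, Algebra.subset_adjoin hy⟩ := by
  have : Finite Y := hY
  obtain ⟨z, hz, hz'⟩ := exists_real_specialization (fun y : Y => (y : K))
  have hmem : ∀ x : Algebra.adjoin ℝ Y, ∃ p : MvPolynomial Y ℝ,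
      MvPolynomial.aeval (fun y : Y => (y : K)) p = x.1 := by
    rintro ⟨x, hx⟩
    rw [Algebra.adjoin_eq_range] at hx
    exact hx
  choose p hp using hmem
  have key : ∀ x (q : MvPolynomial Y ℝ), MvPolynomial.aeval (fun y : Y => (y : K)) q = x.1 →
      MvPolynomial.aeval z (p x) = MvPolynomial.aeval z q := by
    intro x q hq
    rw [← sub_eq_zero, ← map_sub]
    exact hz' _ (by rw [map_sub, hp, hq, sub_self])
  refine ⟨⟨⟨⟨⟨fun x => MvPolynomial.aeval z (p x), ?_⟩, ?_⟩, ?_, ?_⟩, ?_⟩, ?_⟩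
  · rw [key 1 1 (by simp), map_one]
  · intro x y
    change MvPolynomial.aeval z (p (x * y)) = _
    rw [key _ (p x * p y) (by simp [hp]), map_mul]
  · change MvPolynomial.aeval z (p 0) = 0
    rw [key 0 0 (by simp), map_zero]
  · intro x y
    change MvPolynomial.aeval z (p (x + y)) = _
    rw [key _ (p x + p y) (by simp [hp]), map_add]
  · intro r
    change MvPolynomial.aeval z (p _) = _
    rw [key _ (MvPolynomial.C r) (by simp)]
    simp
  · intro y hy h0
    change 0 ≤ MvPolynomial.aeval z (p _)
    rw [key _ (MvPolynomial.X ⟨y, hy⟩) (by simp), MvPolynomial.aeval_X]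
    exact hz ⟨y, hy⟩ h0

section Pairing

variable {n g : ℕ} {K : Type*} [Field K] (φ : traceSubalgebra n g →+* K)

/-- The symmetric form induced by a ring homomorphism on the subalgebra of traces. -/
def tracePairing (h k : traceRing n g) : K :=
  φ ⟨trace (h.1ᵀ * k.1), trace_mem_traceSubalgebra (mul_mem (transpose_mem_traceRing h.2) k.2)⟩

variable {φ} (h k l a : traceRing n g)

theorem tracePairing_comm : tracePairing φ h k = tracePairing φ k h := by
  refine congrArg φ (Subtype.ext ?_)
  change trace (h.1ᵀ * k.1) = trace (k.1ᵀ * h.1)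
  rw [← trace_transpose, transpose_mul, transpose_transpose]

theorem tracePairing_add_right :
    tracePairing φ h (k + l) = tracePairing φ h k + tracePairing φ h l := by
  unfold tracePairing
  rw [← map_add]
  refine congrArg φ (Subtype.ext ?_)
  change trace (h.1ᵀ * (k.1 + l.1)) = trace (h.1ᵀ * k.1) + trace (h.1ᵀ * l.1)
  rw [mul_add, trace_add]

theorem tracePairing_traceSmul_mul (p : traceSubalgebra n g) :
    tracePairing φ h (traceSmul p * k) = φ p * tracePairing φ h k := by
  unfold tracePairing
  rw [← map_mul]
  refine congrArg φ (Subtype.ext ?_)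
  change trace (h.1ᵀ * ((p.1 • (1 : MatP n g)) * k.1)) = p.1 * trace (h.1ᵀ * k.1)
  rw [smul_mul_assoc, one_mul, mul_smul_comm, trace_smul, smul_eq_mul]

theorem tracePairing_mul_right :
    tracePairing φ h (a * k) = tracePairing φ (traceTranspose n g a * h) k := by
  refine congrArg φ (Subtype.ext ?_)
  change trace (h.1ᵀ * (a.1 * k.1)) = trace ((a.1ᵀ * h.1)ᵀ * k.1)
  rw [transpose_mul, transpose_transpose, mul_assoc]

/-- The Gram matrix of the form twisted by `a`. -/
def pairingMatrix (φ : traceSubalgebra n g →+* K) {r : ℕ} (b : Fin r → traceRing n g)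
    (a : traceRing n g) : Matrix (Fin r) (Fin r) K :=
  of fun i j => tracePairing φ (b i) (a * b j)

theorem pairingMatrix_transpose {r : ℕ} (b : Fin r → traceRing n g) (a : traceRing n g) :
    (pairingMatrix φ b a)ᵀ = pairingMatrix φ b (traceTranspose n g a) := by
  ext i j
  rw [transpose_apply, pairingMatrix, pairingMatrix, of_apply, of_apply, tracePairing_mul_right,
    tracePairing_comm]

theorem exists_maximal_gram (φ : traceSubalgebra n g →+* K) :
    ∃ (r : ℕ) (b : Fin r → traceRing n g), ((gramMatrix b).map φ).det ≠ 0 ∧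
      ∀ h, ((gramMatrix (Sum.elim b fun _ : Unit => h)).map φ).det = 0 := by
  classical
  have hmap : ∀ {κ : Type} [Fintype κ] [DecidableEq κ] (b : κ → traceRing n g),
      ((gramMatrix b).map φ).det = φ (gramMatrix b).det := fun b => (φ.map_det _).symm
  have hreindex : ∀ {κ κ' : Type} [Fintype κ] [DecidableEq κ] [Fintype κ'] [DecidableEq κ']
      (e : κ' ≃ κ) (b : κ → traceRing n g), (gramMatrix (b ∘ e)).det = (gramMatrix b).det :=
    fun e b => det_submatrix_equiv_self e (gramMatrix b)
  let p : ℕ → Prop := fun r => ∀ b : Fin r → traceRing n g, ((gramMatrix b).map φ).det = 0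
  have hp : ∃ r, p r := by
    refine ⟨Fintype.card (Option (Fin n × Fin n)), fun b => ?_⟩
    rw [hmap, ← hreindex (Fintype.equivFin (Option (Fin n × Fin n))), det_gramMatrix_eq_zero,
      map_zero]
  have h0 : Nat.find hp ≠ 0 := by
    intro h0
    have : p 0 := h0 ▸ Nat.find_spec hp
    simpa using this fun _ => 0
  obtain ⟨r, hr⟩ := Nat.exists_eq_succ_of_ne_zero h0
  have h1 : ¬ p r := Nat.find_min hp (by omega)
  obtain ⟨b, hb⟩ := not_forall.1 h1
  refine ⟨r, b, hb, fun h => ?_⟩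
  have h2 : p (r + 1) := by
    have := Nat.find_spec hp
    rwa [hr] at this
  rw [hmap, ← hreindex (finSumFinEquiv.symm.trans (Equiv.sumCongr (Equiv.refl (Fin r))
    finOneEquiv)), ← hmap]
  exact h2 _

theorem exists_coordinates [CharZero K] (φ : traceSubalgebra n g →+* K) :
    ∃ (r : ℕ) (b : Fin r → traceRing n g) (c : traceRing n g →+ (Fin r → K)),
      (∀ p h, c (traceSmul p * h) = φ p • c h) ∧ (∀ j, c (b j) = Pi.single j 1) ∧
      (∀ a, ∃ L : Matrix (Fin r) (Fin r) K, ∀ h, c (a * h) = L *ᵥ c h) ∧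
      ∀ a h k, tracePairing φ h (a * k) = c h ⬝ᵥ pairingMatrix φ b a *ᵥ c k := by
  obtain ⟨r, b, hb, hmax⟩ := exists_maximal_gram φ
  set G := (gramMatrix b).map φ with hG
  have hGu : IsUnit G.det := hb.isUnit
  have hGs : Gᵀ = G := by
    ext i j
    exact tracePairing_comm _ _
  have hGi : G⁻¹ᵀ = G⁻¹ := by rw [transpose_nonsing_inv, hGs]
  let v : traceRing n g →+ (Fin r → K) :=
    { toFun := fun h i => tracePairing φ (b i) h
      map_zero' := by
        ext i
        have := tracePairing_add_right (φ := φ) (b i) 0 0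
        rw [add_zero] at this
        simpa using this
      map_add' := fun h k => by
        ext i
        exact tracePairing_add_right _ _ _ }
  have hself : ∀ h, tracePairing φ h h = v h ⬝ᵥ G⁻¹ *ᵥ v h := by
    intro h
    have := hmax h
    have hinv : Invertible G := invertibleOfIsUnitDet _ hGu
    have hblock : (gramMatrix (Sum.elim b fun _ : Unit => h)).map φ =
        fromBlocks G (of fun i _ => v h i) (of fun _ j => v h j)
          (of fun _ _ => tracePairing φ h h) := by
      ext (i | i) (j | j)
      · rfl
      · rfl
      · exact tracePairing_comm _ _
      · rfl
    rw [hblock, det_fromBlocks₁₁, mul_eq_zero] at this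
    have := this.resolve_left hb
    rw [det_unique, Matrix.sub_apply, of_apply, sub_eq_zero] at this
    rw [this, Matrix.mul_assoc, invOf_eq_nonsing_inv]
    simp only [mul_apply, dotProduct, mulVec, of_apply]
  have hbil : ∀ h k, tracePairing φ h k = v h ⬝ᵥ G⁻¹ *ᵥ v k := by
    intro h k
    have h1 := hself (h + k)
    have h2 : v k ⬝ᵥ G⁻¹ *ᵥ v h = v h ⬝ᵥ G⁻¹ *ᵥ v k := by
      rw [dotProduct_mulVec, ← mulVec_transpose, hGi, dotProduct_comm]
    rw [map_add, mulVec_add, add_dotProduct, dotProduct_add, dotProduct_add, ← hself, ← hself, h2,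
      tracePairing_add_right, tracePairing_comm (h + k), tracePairing_comm (h + k),
      tracePairing_add_right, tracePairing_add_right, tracePairing_comm k h] at h1
    have h3 : (2 : K) ≠ 0 := two_ne_zero
    exact mul_left_cancel₀ h3 (by linear_combination h1)
  let c : traceRing n g →+ (Fin r → K) := (G⁻¹.mulVecLin : _ →+ _).comp v
  have hc : ∀ h, c h = G⁻¹ *ᵥ v h := fun h => rfl
  have hpair : ∀ h k, tracePairing φ h k = v h ⬝ᵥ c k := hbil
  have hv : ∀ a h, v (a * h) = pairingMatrix φ b a *ᵥ c h := by
    intro a h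
    ext i
    change tracePairing φ (b i) (a * h) = _
    rw [tracePairing_mul_right, hpair, mulVec]
    refine congrArg (· ⬝ᵥ c h) (funext fun j => ?_)
    change tracePairing φ (b j) _ = tracePairing φ (b i) _
    rw [tracePairing_mul_right, tracePairing_comm]
    rfl
  refine ⟨r, b, c, fun p h => ?_, fun j => ?_, fun a => ⟨G⁻¹ * pairingMatrix φ b a, fun h => ?_⟩,
    fun a h k => ?_⟩
  · have : v (traceSmul p * h) = φ p • v h := by
      ext i
      exact tracePairing_traceSmul_mul _ _ _
    rw [hc, this, mulVec_smul, hc]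
  · have : v (b j) = G *ᵥ Pi.single j 1 := by
      ext i
      rw [mulVec_single_one]
      rfl
    rw [hc, this, mulVec_mulVec, nonsing_inv_mul _ hGu, one_mulVec]
  · rw [hc, hv, mulVec_mulVec]
  · rw [hbil, dotProduct_mulVec, ← mulVec_transpose, hGi, ← hc, hv]

end Pairing

section Specialization

variable {n g : ℕ}

theorem exists_common_denominator {A K : Type*} [CommRing A] [Field K] {φ : A →+* K}
    (hφ : ∀ x, ∃ a b, φ b ≠ 0 ∧ x * φ b = φ a) {r : ℕ} (x : Fin r → K) :
    ∃ (y : Fin r → A) (D : A), φ D ≠ 0 ∧ ∀ i, φ (y i) = φ D * x i := by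
  choose num den hden hnum using fun i => hφ (x i)
  refine ⟨fun i => num i * ∏ j ∈ Finset.univ.erase i, den j, ∏ j, den j, ?_, fun i => ?_⟩
  · rw [map_prod]
    exact Finset.prod_ne_zero_iff.2 fun i _ => hden i
  · rw [← Finset.mul_prod_erase _ _ (Finset.mem_univ i), map_mul, map_mul, ← hnum]
    ring

variable {K : Type} [Field K] {φ : traceSubalgebra n g →+* K} {r : ℕ} {b : Fin r → traceRing n g}
  {c : traceRing n g →+ (Fin r → K)}

theorem pairingMatrix_nonneg [LinearOrder K] [IsStrictOrderedRing K]
    (hφ : ∀ x, ∃ a b, φ b ≠ 0 ∧ x * φ b = φ a)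
    (hsmul : ∀ p h, c (traceSmul p * h) = φ p • c h) (hb : ∀ j, c (b j) = Pi.single j 1)
    {a : traceRing n g}
    (hpair : ∀ h k, tracePairing φ h (a * k) = c h ⬝ᵥ pairingMatrix φ b a *ᵥ c k)
    (ha : ∀ h, 0 ≤ tracePairing φ h (a * h)) (x : Fin r → K) :
    0 ≤ x ⬝ᵥ pairingMatrix φ b a *ᵥ x := by
  obtain ⟨y, D, hD, hy⟩ := exists_common_denominator hφ x
  have hc : c (∑ j, traceSmul (y j) * b j) = φ D • x := by
    rw [map_sum]
    ext i
    simp [hsmul, hb, Pi.single_apply, hy]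
  have h := ha (∑ j, traceSmul (y j) * b j)
  rw [hpair, hc, mulVec_smul, smul_dotProduct, dotProduct_smul, smul_eq_mul, smul_eq_mul,
    ← mul_assoc] at h
  exact nonneg_of_mul_nonneg_right h (mul_self_pos.2 hD)

theorem mulVec_mem_of_mem {R ι κ : Type*} [CommSemiring R] [Algebra R K] [Fintype κ]
    {B : Subalgebra R K} {M : Matrix ι κ K} (hM : ∀ i j, M i j ∈ B) {v : κ → K}
    (hv : ∀ j, v j ∈ B) (i : ι) : (M *ᵥ v) i ∈ B :=
  sum_mem fun j _ => mul_mem (hM i j) (hv j)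

/-- The generic matrices and their transposes as elements of the trace ring. -/
def genTrace (w : genSet n g) : traceRing n g :=
  ⟨w.1, mem_traceRing_of_mem_closure (Submonoid.subset_closure w.2)⟩

theorem coordinates_mem [Algebra ℝ K] (hφ : ∀ t : ℝ, φ (algebraMap ℝ _ t) = algebraMap ℝ K t)
    (hsmul : ∀ p h, c (traceSmul p * h) = φ p • c h)
    (hpair : ∀ h k, tracePairing φ h (1 * k) = c h ⬝ᵥ pairingMatrix φ b 1 *ᵥ c k)
    {M : genSet n g → Matrix (Fin r) (Fin r) K}
    (hM : ∀ w h, c (genTrace w * h) = M w *ᵥ c h) {B : Subalgebra ℝ K} (hB1 : ∀ i, c 1 i ∈ B)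
    (hBG : ∀ i j, pairingMatrix φ b 1 i j ∈ B) (hBM : ∀ w i j, M w i j ∈ B) :
    (∀ p, φ p ∈ B) ∧ ∀ h i, c h i ∈ B := by
  have hword : ∀ w (hw : w ∈ Submonoid.closure (genSet n g)) i,
      c ⟨w, mem_traceRing_of_mem_closure hw⟩ i ∈ B := by
    intro w hw
    induction hw using Submonoid.closure_induction_left with
    | one => exact hB1
    | mul_left x hx y hy ih =>
      intro i
      have := hM ⟨x, hx⟩ ⟨y, mem_traceRing_of_mem_closure hy⟩
      have h2 := mulVec_mem_of_mem (hBM ⟨x, hx⟩) ih i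
      rw [← this] at h2
      exact h2
  have hφB : ∀ p, φ p ∈ B := by
    rintro ⟨p, hp⟩
    induction hp using Algebra.adjoin_induction with
    | mem x hx =>
      obtain ⟨w, hw, rfl⟩ := hx
      have h := hpair 1 ⟨w, mem_traceRing_of_mem_closure hw⟩
      have h2 : tracePairing φ 1 (1 * ⟨w, mem_traceRing_of_mem_closure hw⟩) =
          φ ⟨trace w, Algebra.subset_adjoin ⟨w, hw, rfl⟩⟩ := by
        refine congrArg φ (Subtype.ext ?_)
        change trace ((1 : MatP n g)ᵀ * (1 * w)) = trace w
        rw [transpose_one, one_mul, one_mul]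
      rw [← h2, h]
      exact sum_mem fun i _ => mul_mem (hB1 i) (mulVec_mem_of_mem hBG (hword w hw) i)
    | algebraMap t =>
      have := hφ t
      exact this ▸ B.algebraMap_mem t
    | add x y hx hy ihx ihy =>
      have := map_add φ ⟨x, hx⟩ ⟨y, hy⟩
      exact this ▸ add_mem ihx ihy
    | mul x y hx hy ihx ihy =>
      have := map_mul φ ⟨x, hx⟩ ⟨y, hy⟩
      exact this ▸ mul_mem ihx ihy
  refine ⟨hφB, ?_⟩
  rintro ⟨h, hh⟩
  refine traceRing_induction (P := fun h => ∀ hh : h ∈ traceRing n g, ∀ i, c ⟨h, hh⟩ i ∈ B)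
    (fun w hw _ => hword w hw) (fun hh i => ?_) (fun x y hx hy ihx ihy hh i => ?_)
    (fun p hp x hx ih hh i => ?_) hh hh
  · have : c ⟨0, hh⟩ = 0 := map_zero c
    rw [this]
    exact zero_mem B
  · have : c ⟨x + y, hh⟩ = c ⟨x, hx⟩ + c ⟨y, hy⟩ := map_add c ⟨x, hx⟩ ⟨y, hy⟩
    rw [this]
    exact add_mem (ihx hx i) (ihy hy i)
  · have h1 : (⟨p • x, hh⟩ : traceRing n g) = traceSmul ⟨p, hp⟩ * ⟨x, hx⟩ := by
      refine Subtype.ext ?_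
      change p • x = p • (1 : MatP n g) * x
      rw [smul_mul_assoc, one_mul]
    rw [h1, hsmul]
    exact mul_mem (hφB _) (ih hx i)

theorem exists_algHom_tracePairing_nonneg [LinearOrder K] [IsStrictOrderedRing K]
    (hφ : ∀ x, ∃ a b, φ b ≠ 0 ∧ x * φ b = φ a) {S : Set (traceRing n g)} (hSfin : S.Finite)
    (hS : ∀ s ∈ S, traceTranspose n g s = s)
    (hφS : ∀ s ∈ S, ∀ h, 0 ≤ tracePairing φ h (s * h)) {f : traceSubalgebra n g} (hf : φ f ≤ 0) :
    ∃ ψ : traceSubalgebra n g →ₐ[ℝ] ℝ, ψ f ≤ 0 ∧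
      ∀ s ∈ S, ∀ h, 0 ≤ tracePairing (ψ : traceSubalgebra n g →+* ℝ) h (s * h) := by
  let _ : Algebra ℝ K := (φ.comp (algebraMap ℝ (traceSubalgebra n g))).toAlgebra
  obtain ⟨r, b, c, hsmul, hb, hL, hpair⟩ := exists_coordinates φ
  choose M hM using fun w : genSet n g => hL (genTrace w)
  choose m d L hd hdL using fun s : S => exists_diagonalization (pairingMatrix φ b s.1)
    (by rw [pairingMatrix_transpose, hS s.1 s.2])
    (pairingMatrix_nonneg hφ hsmul hb (hpair s.1) (hφS s.1 s.2))
  have : Finite S := hSfin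
  have : Finite (genSet n g) := 
    ((Set.finite_range (genMat n g)).union (Set.finite_range fun j => (genMat n g j)ᵀ)).to_subtype
  let Y : Set K :=
    ((((Set.range (c 1) ∪ Set.range fun t : Fin r × Fin r => pairingMatrix φ b 1 t.1 t.2) ∪
      Set.range fun t : genSet n g × Fin r × Fin r => M t.1 t.2.1 t.2.2) ∪
      Set.range fun t : Σ s, Fin (m s) => d t.1 t.2) ∪
      Set.range fun t : Σ s, Fin (m s) × Fin r => L t.1 t.2.1 t.2.2) ∪ {-φ f}
  have hY : Y.Finite := (((((Set.finite_range _).union (Set.finite_range _)).union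
    (Set.finite_range _)).union (Set.finite_range _)).union (Set.finite_range _)).union
    (Set.finite_singleton _)
  obtain ⟨ρ, hρ⟩ := exists_algHom_adjoin hY
  let B := Algebra.adjoin ℝ Y
  have hsub : ∀ y ∈ Y, y ∈ B := fun y hy => Algebra.subset_adjoin hy
  have hdY : ∀ s l, d s l ∈ Y := fun s l => .inl (.inl (.inr ⟨⟨s, l⟩, rfl⟩))
  have hLB : ∀ s l i, L s l i ∈ B := fun s l i => hsub _ (.inl (.inr ⟨⟨s, l, i⟩, rfl⟩))
  obtain ⟨hφB, hcB⟩ := coordinates_mem (fun t => rfl) hsmul (hpair 1) hM (B := B)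
    (fun i => hsub _ (.inl (.inl (.inl (.inl (.inl ⟨i, rfl⟩))))))
    (fun i j => hsub _ (.inl (.inl (.inl (.inl (.inr ⟨(i, j), rfl⟩))))))
    (fun w i j => hsub _ (.inl (.inl (.inl (.inr ⟨(w, i, j), rfl⟩)))))
  let φ' : traceSubalgebra n g →ₐ[ℝ] K := { φ with commutes' := fun _ => rfl }
  refine ⟨ρ.comp (φ'.codRestrict B hφB), ?_, fun s hs h => ?_⟩
  · have h1 := hρ (-φ f) (.inr rfl) (neg_nonneg.2 hf)
    have h2 : (⟨-φ f, hsub _ (.inr rfl)⟩ : B) = -φ'.codRestrict B hφB f := rfl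
    rw [h2, map_neg] at h1
    exact neg_nonneg.1 h1
  · have hv := mulVec_mem_of_mem (hLB ⟨s, hs⟩) (hcB h)
    have h1 : φ'.codRestrict B hφB ⟨trace (h.1ᵀ * (s * h).1), trace_mem_traceSubalgebra
        (mul_mem (transpose_mem_traceRing h.2) (s * h).2)⟩ =
        ∑ l, (⟨d ⟨s, hs⟩ l, hsub _ (hdY _ l)⟩ : B) * (⟨_, hv l⟩ * ⟨_, hv l⟩) := by
      refine Subtype.ext ?_
      rw [AddSubmonoidClass.coe_finsetSum]
      exact (hpair s h h).trans (hdL ⟨s, hs⟩ (c h))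
    change 0 ≤ ρ (φ'.codRestrict B hφB _)
    rw [h1, map_sum]
    refine Finset.sum_nonneg fun l _ => ?_
    rw [map_mul, map_mul]
    exact mul_nonneg (hρ _ (hdY _ l) (hd _ l)) (mul_self_nonneg _)

end Specialization

section CentralPositivstellensatz

variable {n g : ℕ} {S : Set (MatP n g)}

theorem Matrix.transpose_aeval {R A m : Type*} [CommSemiring R] [CommSemiring A] [Algebra R A]
    [Fintype m] [DecidableEq m] (M : Matrix m m A) (p : Polynomial R) :
    (Polynomial.aeval M p)ᵀ = Polynomial.aeval Mᵀ p := by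
  rw [Polynomial.aeval_eq_sum_range, Polynomial.aeval_eq_sum_range, transpose_sum]
  simp [transpose_smul, transpose_pow]

theorem mem_KSet_of_trace_nonneg (hS : ∀ s ∈ S, s ∈ traceRing n g ∧ sᵀ = s)
    {X : Fin g → Matrix (Fin n) (Fin n) ℝ}
    (h : ∀ s ∈ S, ∀ k ∈ traceRing n g, 0 ≤ evalPoly X (trace (kᵀ * (s * k)))) :
    X ∈ KSet n g S := by
  intro s hs
  have hA : (evalMat n g X s)ᵀ = evalMat n g X s := by rw [← evalMat_transpose, (hS s hs).2]
  refine posSemidef_of_trace_nonneg hA fun p => ?_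
  have h1 : Polynomial.aeval s p ∈ traceRing n g :=
    Polynomial.aeval_subalgebra_coe p (traceRing n g) ⟨s, (hS s hs).1⟩ ▸ SetLike.coe_mem _
  have h2 : Polynomial.aeval (evalMat n g X s) p = evalMat n g X (Polynomial.aeval s p) := by
    rw [evalMat_eq, evalMat_eq]
    exact Polynomial.aeval_algHom_apply _ _ _
  have h3 := h s hs _ h1
  rw [transpose_aeval, (hS s hs).2, ← evalMat_trace, evalMat_mul, evalMat_mul, ← mul_assoc] at h3
  rwa [h2]

theorem exists_mul_eq_one_add (hSfin : S.Finite)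
    (hS : ∀ s ∈ S, s ∈ traceRing n g ∧ sᵀ = s) {f : PolyRing n g} (hf : f ∈ traceSubalgebra n g)
    (hpos : ∀ X ∈ KSet n g S, 0 < evalPoly X f) :
    ∃ c ∈ centralPart S, ∃ d ∈ centralPart S, f * c = 1 + d := by
  by_contra hcon
  have hadd := fun {p q} => centralPart_add (p := p) (q := q) hS
  have hmul := fun {p q} => centralPart_mul (p := p) (q := q) hS
  have hsq := fun {p} => centralPart_sq (p := p) hS
  have h0 : (0 : PolyRing n g) ∈ centralPart S := by
    have := hsq (zero_mem (traceSubalgebra n g))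
    rwa [mul_zero] at this
  have h1 : (1 : PolyRing n g) ∈ centralPart S := by
    have := hsq (one_mem (traceSubalgebra n g))
    rwa [mul_one] at this
  have hcone : IsPreorderCone {x : traceSubalgebra n g |
      ∃ c ∈ centralPart S, ∃ d ∈ centralPart S, x.1 = c - f * d} :=
    { add := by
        rintro x ⟨c, hc, d, hd, hx⟩ y ⟨c', hc', d', hd', hy⟩
        refine ⟨c + c', hadd hc hc', d + d', hadd hd hd', ?_⟩
        change x.1 + y.1 = _
        rw [hx, hy]
        ring
      mul := by
        rintro x ⟨c, hc, d, hd, hx⟩ y ⟨c', hc', d', hd', hy⟩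
        refine ⟨c * c' + f * f * (d * d'), hadd (hmul hc hc') (hmul (hsq hf) (hmul hd hd')),
          c * d' + d * c', hadd (hmul hc hd') (hmul hd hc'), ?_⟩
        change x.1 * y.1 = _
        rw [hx, hy]
        ring
      sq := fun a => ⟨a.1 * a.1, hsq a.2, 0, h0, by simp⟩
      neg_one := by
        rintro ⟨c, hc, d, hd, hx⟩
        refine hcon ⟨d, hd, c, hc, ?_⟩
        change (-1 : PolyRing n g) = _ at hx
        linear_combination hx }
  obtain ⟨P, hP, hPprime⟩ := hcone.exists_isPrimeCone
  obtain ⟨K, _, _, _, φ, hφ, hfrac⟩ := hPprime.exists_orderedField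
  have hφf : φ ⟨f, hf⟩ ≤ 0 := by
    have := (hφ (-⟨f, hf⟩)).2 (hP ⟨0, h0, 1, h1, by simp⟩)
    rw [map_neg] at this
    exact neg_nonneg.1 this
  obtain ⟨ψ, hψf, hψ⟩ := exists_algHom_tracePairing_nonneg hfrac
    (S := {s | s.1 ∈ insert 1 S}) ((hSfin.insert 1).preimage Subtype.val_injective.injOn)
    (fun s hs => Subtype.ext <| by
      rcases hs with hs | hs
      · change s.1ᵀ = s.1
        rw [hs, transpose_one]
      · exact (hS _ hs).2)
    (fun s hs h => (hφ _).2 (hP ⟨_, centralPart_trace hS (transpose_mem_traceRing h.2) hs, 0, h0, by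
      rw [mul_zero, sub_zero, transpose_transpose, mul_assoc]
      rfl⟩)) hφf
  obtain ⟨X, hX⟩ := exists_evalPoly_eq ψ fun h => by
    have := hψ 1 (.inl rfl) h
    rw [one_mul] at this
    exact this
  refine (hpos X (mem_KSet_of_trace_nonneg hS fun s hs k hk => ?_)).not_ge ?_
  · have := hψ ⟨s, (hS s hs).1⟩ (.inr hs) ⟨k, hk⟩
    refine this.trans_eq (hX _).symm
  · exact (hX ⟨f, hf⟩).trans_le hψf

end CentralPositivstellensatz

section Coefficients

open Polynomial in
theorem Matrix.charpoly_neg_coeff {R m : Type*} [CommRing R] [Nontrivial R] [Fintype m]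
    [DecidableEq m] (M : Matrix m m R) {i : ℕ} (hi : i ≤ Fintype.card m) :
    (-M).charpoly.coeff i = (detPoly M).coeff (Fintype.card m - i) := by
  have h : detPoly M = (-M).charpoly.reverse := by
    rw [reverse_charpoly, charpolyRev, detPoly]
    refine congrArg det ?_
    ext1 i j
    simp
  rw [h, coeff_reverse, charpoly_natDegree_eq_dim, revAt_le (Nat.sub_le _ _),
    Nat.sub_sub_self hi]

open Polynomial in
theorem Polynomial.coeff_prod_X_add_C_pos {ι R : Type*} [CommRing R] [LinearOrder R]
    [IsStrictOrderedRing R] (s : Finset ι) {v : ι → R} (hv : ∀ i ∈ s, 0 < v i) {j : ℕ}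
    (hj : j ≤ s.card) : 0 < (∏ i ∈ s, (X + C (v i))).coeff j := by
  classical
  suffices ∀ j, 0 ≤ (∏ i ∈ s, (X + C (v i))).coeff j ∧
      (j ≤ s.card → 0 < (∏ i ∈ s, (X + C (v i))).coeff j) from (this j).2 hj
  clear hj j
  induction s using Finset.induction_on with
  | empty =>
    rintro (_ | j)
    · simp
    · simp [coeff_one]
  | insert a s ha ih =>
    have ih := ih fun i hi => hv i (Finset.mem_insert_of_mem hi)
    have hva := hv a (Finset.mem_insert_self _ _)
    rw [Finset.prod_insert ha, Finset.card_insert_of_notMem ha]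
    rintro (_ | j)
    · rw [mul_coeff_zero]
      have := mul_pos hva ((ih 0).2 (Nat.zero_le _))
      simpa using ⟨this.le, this⟩
    · rw [add_mul, coeff_add, coeff_X_mul, coeff_C_mul]
      have h1 := mul_nonneg hva.le (ih (j + 1)).1
      exact ⟨add_nonneg (ih j).1 h1, fun h => add_pos_of_pos_of_nonneg ((ih j).2 (by omega)) h1⟩

theorem Matrix.PosDef.charpoly_neg_coeff_pos {m : Type*} [Fintype m] [DecidableEq m]
    {A : Matrix m m ℝ} (hA : A.PosDef) {i : ℕ} (hi : i ≤ Fintype.card m) :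
    0 < (-A).charpoly.coeff i := by
  have hB : (-A).IsHermitian := hA.isHermitian.neg
  have h : (-A).charpoly = ∏ i, (Polynomial.X + Polynomial.C (-hB.eigenvalues i)) := by
    rw [hB.charpoly_eq]
    simp [sub_eq_add_neg]
  rw [h]
  refine Polynomial.coeff_prod_X_add_C_pos _ (fun i _ => ?_) hi
  rw [hB.eigenvalues_eq, neg_mulVec, dotProduct_neg, map_neg, neg_neg]
  refine hA.re_dotProduct_pos fun h0 => hB.eigenvectorBasis.orthonormal.ne_zero i ?_
  ext k
  exact congrFun h0 k

theorem Matrix.exists_even_odd_charpoly {R m : Type*} [CommRing R] [Nontrivial R] [Fintype m]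
    [DecidableEq m] (M : Matrix m m R) :
    M * ∑ i ∈ Finset.range (Fintype.card m + 1), (-M).charpoly.coeff (2 * i + 1) • M ^ (2 * i) =
      ∑ i ∈ Finset.range (Fintype.card m + 1), (-M).charpoly.coeff (2 * i) • M ^ (2 * i) := by
  have hsplit : ∀ (f : ℕ → Matrix m m R) N, ∑ i ∈ Finset.range (2 * N), f i =
      ∑ i ∈ Finset.range N, (f (2 * i) + f (2 * i + 1)) := by
    intro f N
    induction N with
    | zero => simp
    | succ N ih => rw [mul_add, mul_one, Finset.sum_range_succ, Finset.sum_range_succ, ih,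
        Finset.sum_range_succ, add_assoc]
  have h := aeval_self_charpoly (-M)
  rw [Polynomial.aeval_eq_sum_range' (n := 2 * (Fintype.card m + 1))
    (by rw [charpoly_natDegree_eq_dim]; omega), hsplit, Finset.sum_add_distrib] at h
  rw [Finset.mul_sum, eq_comm, ← sub_eq_zero, ← h, sub_eq_add_neg, ← Finset.sum_neg_distrib]
  refine congrArg₂ (· + ·) (Finset.sum_congr rfl fun i _ => ?_) (Finset.sum_congr rfl fun i _ => ?_)
  · rw [(even_two_mul i).neg_pow]
  · rw [Odd.neg_pow ⟨i, rfl⟩, smul_neg, mul_smul_comm, pow_succ']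

end Coefficients

section PositiveDefinite

variable {n g : ℕ} {S : Set (MatP n g)}

theorem charpoly_neg_coeff_mem {a : MatP n g} (ha : a ∈ traceRing n g) {i : ℕ} (hi : i ≤ n) :
    (-a).charpoly.coeff i ∈ traceSubalgebra n g := by
  rw [charpoly_neg_coeff a (by simpa using hi)]
  exact (detPoly_coeff_mem ha _).1

theorem evalPoly_charpoly_neg_coeff_pos {a : MatP n g} {X : Fin g → Matrix (Fin n) (Fin n) ℝ}
    (ha : (evalMat n g X a).PosDef) {i : ℕ} (hi : i ≤ n) :
    0 < evalPoly X ((-a).charpoly.coeff i) := by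
  have h := ha.charpoly_neg_coeff_pos (i := i) (by simpa using hi)
  have h2 : -evalMat n g X a = (-a).map (evalPoly X : PolyRing n g →+* ℝ) := by
    rw [evalMat_eq, ← map_neg]
    rfl
  rwa [h2, charpoly_map, Polynomial.coeff_map] at h

theorem exists_common_multiplier (hSfin : S.Finite) (hS : ∀ s ∈ S, s ∈ traceRing n g ∧ sᵀ = s)
    (f : ℕ → PolyRing n g) (N : ℕ) (hf : ∀ i ≤ N, f i ∈ traceSubalgebra n g)
    (hpos : ∀ i ≤ N, ∀ X ∈ KSet n g S, 0 < evalPoly X (f i)) :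
    ∃ c, (∃ d ∈ centralPart S, f 0 * c = 1 + d) ∧ ∀ i ≤ N, f i * c ∈ centralPart S := by
  have hadd := fun {p q} => centralPart_add (p := p) (q := q) hS
  have hmul := fun {p q} => centralPart_mul (p := p) (q := q) hS
  have h1 : (1 : PolyRing n g) ∈ centralPart S := by
    have := centralPart_sq hS (one_mem (traceSubalgebra n g))
    rwa [mul_one] at this
  suffices ∃ c ∈ centralPart S, (∃ d ∈ centralPart S, f 0 * c = 1 + d) ∧
      ∀ i ≤ N, f i * c ∈ centralPart S from this.imp fun _ h => h.2
  induction N with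
  | zero =>
    obtain ⟨c, hc, d, hd, h⟩ := exists_mul_eq_one_add hSfin hS (hf 0 le_rfl) (hpos 0 le_rfl)
    refine ⟨c, hc, ⟨d, hd, h⟩, fun i hi => ?_⟩
    rw [Nat.le_zero.1 hi, h]
    exact hadd h1 hd
  | succ N ih =>
    obtain ⟨c, hc, ⟨d, hd, h⟩, hfc⟩ := ih (fun i hi => hf i (by omega)) fun i hi => hpos i (by omega)
    obtain ⟨c', hc', d', hd', h'⟩ :=
      exists_mul_eq_one_add hSfin hS (hf (N + 1) le_rfl) (hpos (N + 1) le_rfl)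
    refine ⟨c * (1 + d'), hmul hc (hadd h1 hd'), ⟨d + (d' + d * d'), ?_, ?_⟩, fun i hi => ?_⟩
    · exact hadd hd (hadd hd' (hmul hd hd'))
    · linear_combination (1 + d') * h
    · rcases hi.lt_or_eq with hi | rfl
      · rw [← mul_assoc]
        exact hmul (hfc i (by omega)) (hadd h1 hd')
      · rw [← h', show f (N + 1) * (c * (f (N + 1) * c')) = f (N + 1) * f (N + 1) * (c * c') by ring]
        exact hmul (centralPart_sq hS (hf _ le_rfl)) (hmul hc hc')

theorem exists_TtrS_of_posDef (hSfin : S.Finite) (hS : ∀ s ∈ S, s ∈ traceRing n g ∧ sᵀ = s)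
    {a : MatP n g} (haT : a ∈ traceRing n g) (haSym : aᵀ = a)
    (h : ∀ X ∈ KSet n g S, (evalMat n g X a).PosDef) :
    ∃ t₁ ∈ TtrS n g S, ∃ t₂ ∈ TtrS n g S, a * t₁ = 1 + t₂ ∧ t₁ * a = 1 + t₂ := by
  obtain ⟨⟨-, -, hadd, hconj, -⟩, -⟩ := isCyclicPreordering_TtrS hS
  have h0 : (0 : PolyRing n g) ∈ centralPart S := by
    have := centralPart_sq hS (zero_mem (traceSubalgebra n g))
    rwa [mul_zero] at this
  have hsum : ∀ {I : Finset ℕ} {v : ℕ → MatP n g}, (∀ i ∈ I, v i ∈ TtrS n g S) →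
      ∑ i ∈ I, v i ∈ TtrS n g S := fun {I v} hv =>
    Finset.sum_induction v (· ∈ TtrS n g S) (fun x y hx hy => hadd x hx y hy)
      (by simpa [centralPart] using h0) hv
  obtain ⟨c, ⟨d, hd, hcd⟩, hc⟩ := exists_common_multiplier hSfin hS
    (fun i => (-a).charpoly.coeff i) n (fun i hi => charpoly_neg_coeff_mem haT hi)
    (fun i hi X hX => evalPoly_charpoly_neg_coeff_pos (h X hX) hi)
  have hc' : ∀ i, (-a).charpoly.coeff i * c ∈ centralPart S := by
    intro i
    rcases le_or_gt i n with hi | hi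
    · exact hc i hi
    · rwa [Polynomial.coeff_eq_zero_of_natDegree_lt
        (by rwa [charpoly_natDegree_eq_dim, Fintype.card_fin]), zero_mul]
  have heven : ∀ {p : PolyRing n g}, p ∈ centralPart S → ∀ i, p • a ^ (2 * i) ∈ TtrS n g S := by
    intro p hp i
    have := hconj (a ^ i) (pow_mem haT i) _ hp
    rwa [transpose_pow, haSym, mul_smul_comm, mul_one, smul_mul_assoc, ← pow_add, ← two_mul] at this
  have hkey := congrArg (c • ·) (exists_even_odd_charpoly a)
  simp only [Fintype.card_fin, ← mul_smul_comm, Finset.smul_sum, smul_smul, mul_comm c] at hkey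
  rw [Finset.sum_range_succ' (fun i => ((-a).charpoly.coeff (2 * i) * c) • a ^ (2 * i)) n, mul_zero, pow_zero, hcd, add_smul, one_smul,
    add_left_comm] at hkey
  have hcomm : ∀ {I : Finset ℕ} {v : ℕ → PolyRing n g},
      (∑ i ∈ I, v i • a ^ (2 * i)) * a = a * ∑ i ∈ I, v i • a ^ (2 * i) := by
    intro I v
    rw [Finset.sum_mul, Finset.mul_sum]
    refine Finset.sum_congr rfl fun i _ => ?_
    rw [smul_mul_assoc, mul_smul_comm, ← pow_succ, pow_succ']
  exact ⟨_, hsum fun i _ => heven (hc' _) i, _, hadd _ (hsum fun i _ => heven (hc' _) (i + 1)) _ hd,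
    hkey, hcomm.trans hkey⟩

end PositiveDefinite

/-- Krivine-Stengle Positivstellensatz for trace polynomials, positive definite case. -/
theorem stmt1 (n g : ℕ) (hn : 0 < n) (hg : 0 < g)
    (S : Set (MatP n g)) (hSfin : S.Finite)
    (hS : ∀ s ∈ S, s ∈ traceRing n g ∧ sᵀ = s)
    (a : MatP n g) (haT : a ∈ traceRing n g) (haSym : aᵀ = a) :
    (∀ X ∈ KSet n g S, (evalMat n g X a).PosDef) ↔
      ∃ t₁ ∈ TtrS n g S, ∃ t₂ ∈ TtrS n g S,
        a * t₁ = 1 + t₂ ∧ t₁ * a = 1 + t₂ := by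
  exact ⟨exists_TtrS_of_posDef hSfin hS haT haSym, fun h _ hX => posDef_of_exists_TtrS hS haSym h hX⟩
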